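/- arXiv:1809.06141 — 3 statements merged into one kernel-verified Lean document; each statement's English description precedes it below -/
import Mathlib

section
/- There exist a constant c > 0 and m₀ ∈ ℕ such that for all m ≥ m₀ the following holds: for Lebesgue-almost every tuple (θ₁, …, θ_m) ∈ [0, π)^m, setting S_i = span{(cos θ_i, sin θ_i)} for i = 1, …, m, every finite set F ⊆ ℝ² with |F| ≤ 2^{c·m/log m} is uniquely determined among finite subsets of ℝ² by its X-rays parallel to S₁, …, S_m. -/
open Set

variable {d : ℕ}

/-- The affine line through the coset `T` of the modulo-`S` quotient, i.e. an affine
line parallel to `S` when `S` is 1-dimensional. -/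
def fiber (S : Submodule ℝ (Fin d → ℝ)) (T : (Fin d → ℝ) ⧸ S) : Set (Fin d → ℝ) :=
  {x | (Submodule.Quotient.mk x : (Fin d → ℝ) ⧸ S) = T}

/-- `F₁` and `F₂` have the same (discrete) X-ray parallel to `S`. -/
def XrayEq (S : Submodule ℝ (Fin d → ℝ)) (F₁ F₂ : Set (Fin d → ℝ)) : Prop :=
  ∀ T : (Fin d → ℝ) ⧸ S, (F₁ ∩ fiber S T).ncard = (F₂ ∩ fiber S T).ncard

/-- `F₁` and `F₂` are tomographically equivalent w.r.t. the family `𝒮` of lines. -/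
def TomEq (𝒮 : Set (Submodule ℝ (Fin d → ℝ))) (F₁ F₂ : Set (Fin d → ℝ)) : Prop :=
  ∀ S ∈ 𝒮, XrayEq S F₁ F₂

/-- A lattice line: a line through the origin spanned by a nonzero integer vector. -/
def IsLatticeLine (S : Submodule ℝ (Fin d → ℝ)) : Prop :=
  ∃ v : Fin d → ℤ, v ≠ 0 ∧ S = Submodule.span ℝ {fun i => (v i : ℝ)}

/-- The canonical embedding of `ℤ^d` into `ℝ^d`. -/
def embed (x : Fin d → ℤ) : Fin d → ℝ := fun i => (x i : ℝ)

/-- The X-ray difference `Δ_𝒮(F₁,F₂)`. -/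
noncomputable def xrayDiff (𝒮 : Set (Submodule ℝ (Fin d → ℝ))) (F₁ F₂ : Set (Fin d → ℝ)) : ℕ :=
  ∑ᶠ S ∈ 𝒮, ∑ᶠ T : (Fin d → ℝ) ⧸ S,
    (((F₁ ∩ fiber S T).ncard : ℤ) - ((F₂ ∩ fiber S T).ncard : ℤ)).natAbs

/-- A convex lattice set: `F = conv(F) ∩ ℤ^d`. -/
def IsConvexLatticeSet (F : Finset (Fin d → ℤ)) : Prop :=
  embed '' ↑F = convexHull ℝ (embed '' ↑F) ∩ Set.range (embed : (Fin d → ℤ) → (Fin d → ℝ))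



open MeasureTheory in
lemma analytic_null_aux : ∀ (n : ℕ) (f : (Fin n → ℝ) → ℝ), AnalyticOnNhd ℝ f univ →
    ∀ x0, f x0 ≠ 0 → volume {x | f x = 0} = 0 := by
  intro n
  induction n with
  | zero =>
    intro f hf x0 h0
    have : {x | f x = 0} = ∅ := by
      ext x
      simp only [mem_ofPred_eq, mem_empty_iff_false, iff_false]
      rwa [Subsingleton.elim x x0]
    rw [this]; simp
  | succ n ih =>
    intro f hf x0 h0
    have hcont : Continuous f := continuous_iff_continuousAt.2 fun x => (hf x (mem_univ x)).continuousAt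
    let e := MeasurableEquiv.piFinSuccAbove (fun _ : Fin (n+1) => ℝ) 0
    have he : MeasurePreserving e volume volume :=
      volume_preserving_piFinSuccAbove (fun _ : Fin (n+1) => ℝ) 0
    have hm : MeasurableSet {x | f x = 0} := (isClosed_eq hcont continuous_const).measurableSet
    have hes := he.symm e
    rw [← hes.measure_preimage hm.nullMeasurableSet]
    have hm2 : MeasurableSet (e.symm ⁻¹' {x | f x = 0}) := e.symm.measurable hm
    rw [Measure.volume_eq_prod, Measure.measure_prod_null hm2]
    have hsymm : ∀ t y, e.symm (t, y) = Fin.cons t y := by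
      intro t y
      simp [e, MeasurableEquiv.piFinSuccAbove, Fin.insertNthEquiv]
    have hcons : ∀ p : ℝ × (Fin n → ℝ), AnalyticAt ℝ (fun p : ℝ × (Fin n → ℝ) => (Fin.cons p.1 p.2 : Fin (n+1) → ℝ)) p := by
      intro p
      rw [analyticAt_pi_iff]
      intro i
      refine Fin.cases ?_ (fun j => ?_) i
      · simpa using analyticAt_fst
      · simp only [Fin.cons_succ]
        exact ((ContinuousLinearMap.proj (R := ℝ) (φ := fun _ : Fin n => ℝ) j).analyticAt _).comp analyticAt_snd
    have hF : ∀ p : ℝ × (Fin n → ℝ), AnalyticAt ℝ (fun p : ℝ × (Fin n → ℝ) => f (Fin.cons p.1 p.2)) p :=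
      fun p => (hf _ (mem_univ _)).comp (hcons p)
    have h1 : AnalyticOnNhd ℝ (fun t : ℝ => f (Fin.cons t (Fin.tail x0))) univ := by
      intro t _
      exact (hF (t, Fin.tail x0)).comp (f := fun t : ℝ => (t, Fin.tail x0))
        (analyticAt_id.prod analyticAt_const)
    have h2 : ∀ᵐ t : ℝ, f (Fin.cons t (Fin.tail x0)) ≠ 0 := by
      rcases h1.eqOn_zero_or_eventually_ne_zero_of_preconnected isPreconnected_univ with h | h
      · exact absurd (h (mem_univ (x0 0))) (by simpa using h0)
      · have := ae_restrict_le_codiscreteWithin (μ := (volume : Measure ℝ)) MeasurableSet.univ h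
        rwa [Measure.restrict_univ] at this
    filter_upwards [h2] with t ht
    have := ih (fun y => f (Fin.cons t y)) (by
      intro y _
      exact (hF (t, y)).comp (f := fun y : Fin n → ℝ => (t, y))
        (analyticAt_const.prod analyticAt_id)) (Fin.tail x0) ht
    refine Eq.trans ?_ this
    congr 1
    ext y
    simp [hsymm]

open Matrix in
lemma generic_null {m : ℕ} {W : Type} [Fintype W] [DecidableEq W]
    (R : Fin m → W → W → Prop) (A B : Finset (Fin m)) (hAB : Disjoint A B)
    (hW : Nontrivial W)
    (hA : ∀ p q, Relation.EqvGen (fun p q => ∃ c ∈ A, R c p q) p q)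
    (hB : ∀ p q, Relation.EqvGen (fun p q => ∃ c ∈ B, R c p q) p q) :
    ∀ᵐ θ : Fin m → ℝ, ∀ x : W → Fin 2 → ℝ, Function.Injective x →
      ¬ ∀ c p q, R c p q →
        -Real.sin (θ c) * (x q 0 - x p 0) + Real.cos (θ c) * (x q 1 - x p 1) = 0 := by
  classical
  obtain ⟨w0, w1, hw01⟩ := hW
  let M : (Fin m → ℝ) → Matrix ((Fin m × W × W) ⊕ Fin 2) (W × Fin 2) ℝ := fun θ => Matrix.of fun r v =>
    Sum.elim (fun r => if R r.1 r.2.1 r.2.2 then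
      ((if v.1 = r.2.2 then 1 else 0) - (if v.1 = r.2.1 then 1 else 0)) *
      (if v.2 = 0 then -Real.sin (θ r.1) else Real.cos (θ r.1)) else 0)
      (fun i => if v = (w0, i) then 1 else 0) r
  have hM1 : ∀ θ (x : W × Fin 2 → ℝ) c p q, R c p q → (M θ *ᵥ x) (Sum.inl (c,p,q)) =
      -Real.sin (θ c) * (x (q,0) - x (p,0)) + Real.cos (θ c) * (x (q,1) - x (p,1)) := by
    intro θ x c p q h
    simp only [mulVec, dotProduct, M, of_apply, Sum.elim_inl, h, if_true, Fintype.sum_prod_type, Fin.sum_univ_two]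
    simp [sub_mul, Finset.sum_add_distrib, Finset.sum_sub_distrib]
    ring
  have hM2 : ∀ θ (x : W × Fin 2 → ℝ) c p q, ¬ R c p q → (M θ *ᵥ x) (Sum.inl (c,p,q)) = 0 := by
    intro θ x c p q h
    simp [mulVec, dotProduct, M, h]
  have hM3 : ∀ θ (x : W × Fin 2 → ℝ) i, (M θ *ᵥ x) (Sum.inr i) = x (w0, i) := by
    intro θ x i
    simp [mulVec, dotProduct, M]
  let f : (Fin m → ℝ) → ℝ := fun θ => ((M θ)ᵀ * M θ).det
  have hf : AnalyticOnNhd ℝ f univ := by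
    have hproj : ∀ (c : Fin m) (θ : Fin m → ℝ), AnalyticAt ℝ (fun θ : Fin m → ℝ => θ c) θ := fun c θ =>
      (ContinuousLinearMap.proj (R := ℝ) (φ := fun _ : Fin m => ℝ) c).analyticAt _
    have hent : ∀ r v (θ : Fin m → ℝ), AnalyticAt ℝ (fun θ => M θ r v) θ := by
      intro r v θ
      rcases r with r | i
      · simp only [M, of_apply, Sum.elim_inl]
        split_ifs <;> first
          | exact analyticAt_const
          | exact analyticAt_const.mul (Real.analyticAt_sin.comp (hproj _ θ)).neg
          | exact analyticAt_const.mul (Real.analyticAt_cos.comp (hproj _ θ))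
      · simp only [M, of_apply, Sum.elim_inr]
        exact analyticAt_const
    intro θ _
    simp only [f, det_apply, mul_apply, transpose_apply]
    refine Finset.analyticAt_fun_sum _ fun σ _ => ?_
    simp only [Units.smul_def, zsmul_eq_mul]
    refine analyticAt_const.mul (Finset.analyticAt_fun_prod _ fun i _ => ?_)
    refine Finset.analyticAt_fun_sum _ fun j _ => ?_
    exact (hent _ _ θ).mul (hent _ _ θ)
  let θ0 : Fin m → ℝ := fun c => if c ∈ A then 0 else Real.pi / 2
  have h0 : f θ0 ≠ 0 := by
    intro h
    obtain ⟨v, hv, hMv⟩ := exists_mulVec_eq_zero_iff.2 h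
    have hv0 : M θ0 *ᵥ v = 0 := by
      have := congrArg (fun u => v ⬝ᵥ u) hMv
      rw [← mulVec_mulVec, dotProduct_zero, dotProduct_mulVec, vecMul_transpose] at this
      exact dotProduct_self_eq_zero.1 this
    apply hv
    have hb : ∀ i, v (w0, i) = 0 := fun i => by rw [← hM3 θ0 v i, hv0]; rfl
    have ha : ∀ p q, v (p, 1) = v (q, 1) := by
      intro p q
      induction hA p q with
      | rel p q h =>
        obtain ⟨c, hc, hR⟩ := h
        have := hM1 θ0 v c p q hR
        rw [hv0] at this
        simp [θ0, hc] at this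
        linarith
      | refl => rfl
      | symm _ _ _ ih => exact ih.symm
      | trans _ _ _ _ _ ih1 ih2 => exact ih1.trans ih2
    have ha' : ∀ p q, v (p, 0) = v (q, 0) := by
      intro p q
      induction hB p q with
      | rel p q h =>
        obtain ⟨c, hc, hR⟩ := h
        have := hM1 θ0 v c p q hR
        rw [hv0] at this
        simp [θ0, Finset.disjoint_right.1 hAB hc] at this
        linarith
      | refl => rfl
      | symm _ _ _ ih => exact ih.symm
      | trans _ _ _ _ _ ih1 ih2 => exact ih1.trans ih2
    ext ⟨p, i⟩
    fin_cases i
    · exact (ha' p w0).trans (hb 0)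
    · exact (ha p w0).trans (hb 1)
  have hnull := analytic_null_aux m f hf θ0 h0
  have hae : ∀ᵐ θ : Fin m → ℝ, f θ ≠ 0 := by
    rw [MeasureTheory.ae_iff]; simpa using hnull
  filter_upwards [hae] with θ hθ x hx hall
  apply hθ
  apply exists_mulVec_eq_zero_iff.1
  refine ⟨fun v => x v.1 v.2 - x w0 v.2, ?_, ?_⟩
  · intro h
    apply hw01
    apply hx
    ext i
    have := congrFun h (w1, i)
    simp at this
    linarith
  · rw [← mulVec_mulVec]
    have : (M θ *ᵥ fun v : W × Fin 2 => x v.1 v.2 - x w0 v.2) = 0 := by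
      ext r
      rcases r with ⟨c, p, q⟩ | i
      · by_cases hR : R c p q
        · rw [hM1 _ _ _ _ _ hR]
          have := hall c p q hR
          simp only [Pi.zero_apply]
          rw [← this]; ring
        · exact hM2 _ _ _ _ _ hR
      · rw [hM3]; simp
    rw [this]; simp


lemma fiber_merge {α β : Type*} [Fintype α] [Fintype β] [DecidableEq α] [DecidableEq β] (g : α → β)
    (hg : Function.Surjective g) (T : Finset α) (hT : ∀ a ∈ T, ∃ b, b ≠ a ∧ g b = g a) :
    T.card + 2 * Fintype.card β ≤ 2 * Fintype.card α := by
  have h1 : T.card = ∑ b : β, (T.filter (fun a => g a = b)).card :=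
    Finset.card_eq_sum_card_fiberwise (fun _ _ => Finset.mem_coe.2 (Finset.mem_univ _))
  have h2 : Fintype.card α = ∑ b : β, (Finset.univ.filter (fun a => g a = b)).card :=
    Finset.card_eq_sum_card_fiberwise (fun _ _ => Finset.mem_coe.2 (Finset.mem_univ _))
  have h3 : 2 * Fintype.card β = ∑ b : β, 2 := by simp [mul_comm]
  rw [h1, h2, h3, ← Finset.sum_add_distrib, Finset.mul_sum]
  refine Finset.sum_le_sum fun b _ => ?_
  obtain ⟨a, rfl⟩ := hg b
  have hsub : T.filter (fun x => g x = g a) ⊆ Finset.univ.filter (fun x => g x = g a) :=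
    Finset.filter_subset_filter _ (Finset.subset_univ _)
  have hle := Finset.card_le_card hsub
  rcases (T.filter (fun x => g x = g a)).eq_empty_or_nonempty with h | ⟨x, hx⟩
  · rw [h]
    have : 0 < (Finset.univ.filter (fun x => g x = g a)).card := Finset.card_pos.2 ⟨a, by simp⟩
    simp only [Finset.card_empty]; omega
  · rw [Finset.mem_filter] at hx
    obtain ⟨y, hy, hgy⟩ := hT x hx.1
    have : 1 < (Finset.univ.filter (fun x => g x = g a)).card :=
      Finset.one_lt_card.2 ⟨x, by simp [hx.2], y, by simp [hgy, hx.2], hy.symm⟩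
    omega

def colSetoid {ι W : Type*} (R : ι → W → W → Prop) (A : Finset ι) : Setoid W :=
  Relation.EqvGen.setoid (fun p q => ∃ c ∈ A, R c p q)

noncomputable def numComp {ι W : Type*} (R : ι → W → W → Prop) (A : Finset ι) : ℕ :=
  Nat.card (Quotient (colSetoid R A))

open Classical in
lemma merge_step {ι W : Type*} [Fintype ι] [Fintype W] [Nonempty W] (R : ι → W → W → Prop) (r : ℝ)
    (hr : 0 ≤ r)
    (hcross : ∀ S : Finset W, S.Nonempty → r / 2 * Real.log (Fintype.card W / S.card) ≤
      (Finset.univ.filter (fun c : ι => ∃ p ∈ S, ∃ q, q ∉ S ∧ (R c p q ∨ R c q p))).card)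
    (A : Finset ι) :
    r / 4 * Real.log (numComp R A) ≤
      ∑ c : ι, (Real.log (numComp R A) - Real.log (numComp R (insert c A))) := by
  set K := numComp R A with hK
  have hKpos : ∀ A, 0 < numComp R A := fun A => by
    unfold numComp
    have : Nonempty (Quotient (colSetoid R A)) := ⟨Quotient.mk _ (Classical.arbitrary W)⟩
    exact Nat.card_pos
  let Q := Quotient (colSetoid R A)
  have hKQ : K = Fintype.card Q := Nat.card_eq_fintype_card
  let cl : Q → Finset W := fun s => Finset.univ.filter (fun w => (Quotient.mk (colSetoid R A) w) = s)
  have hcl : ∀ s, (cl s).Nonempty := fun s => by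
    obtain ⟨w, rfl⟩ := Quotient.exists_rep s
    exact ⟨w, by simp [cl]⟩
  let X : ι → Q → Prop := fun c s => ∃ p ∈ cl s, ∃ q, q ∉ cl s ∧ (R c p q ∨ R c q p)
  have hstep : ∀ c, ((Finset.univ.filter (X c)).card : ℝ) / (2 * K) ≤
      Real.log K - Real.log (numComp R (insert c A)) := by
    intro c
    let Q' := Quotient (colSetoid R (insert c A))
    have hle : ∀ p q, (colSetoid R A).r p q → (colSetoid R (insert c A)).r p q := by
      intro p q h
      exact Relation.EqvGen.mono (r := fun p q => ∃ c ∈ A, R c p q) (fun a b ⟨d, hd, hR⟩ => ⟨d, Finset.mem_insert_of_mem hd, hR⟩) p q h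
    let g : Q → Q' := Quotient.map' id hle
    have hg : Function.Surjective g := by
      intro s
      obtain ⟨w, rfl⟩ := Quotient.exists_rep s
      exact ⟨Quotient.mk _ w, rfl⟩
    have hcard := fiber_merge g hg (Finset.univ.filter (X c)) (by
      intro s hs
      rw [Finset.mem_filter] at hs
      obtain ⟨-, p, hp, q, hq, hR⟩ := hs
      simp only [cl, Finset.mem_filter, Finset.mem_univ, true_and] at hp hq
      refine ⟨Quotient.mk _ q, hq, ?_⟩
      rw [← hp]
      apply Quotient.sound
      rcases hR with hR | hR
      · exact Relation.EqvGen.symm _ _ (Relation.EqvGen.rel _ _ ⟨c, Finset.mem_insert_self _ _, hR⟩)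
      · exact Relation.EqvGen.rel _ _ ⟨c, Finset.mem_insert_self _ _, hR⟩)
    have hK' : numComp R (insert c A) = Fintype.card Q' := Nat.card_eq_fintype_card
    rw [← hK', ← hKQ] at hcard
    have hcard' : ((Finset.univ.filter (X c)).card : ℝ) + 2 * numComp R (insert c A) ≤ 2 * K := by
      exact_mod_cast hcard
    have hp : (0:ℝ) < K := by exact_mod_cast hKpos A
    have hp' : (0:ℝ) < numComp R (insert c A) := by exact_mod_cast hKpos _
    have hlog := Real.log_le_sub_one_of_pos (div_pos hp' hp)
    rw [Real.log_div hp'.ne' hp.ne'] at hlog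
    have : ((Finset.univ.filter (X c)).card : ℝ) / (2 * K) ≤ 1 - numComp R (insert c A) / K := by
      rw [div_le_iff₀ (by positivity)]
      field_simp
      linarith
    linarith
  have hp : (0:ℝ) < K := by exact_mod_cast hKpos A
  have hwp : (0:ℝ) < Fintype.card W := by exact_mod_cast Fintype.card_pos
  have hdc : ∑ c, ((Finset.univ.filter (X c)).card : ℝ) =
      ∑ s : Q, ((Finset.univ.filter (fun c => X c s)).card : ℝ) := by
    simp only [Finset.card_filter, Nat.cast_sum]
    exact Finset.sum_comm
  have hcs : ∑ s : Q, ((cl s).card : ℝ) = Fintype.card W := by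
    have : Fintype.card W = ∑ s : Q, (cl s).card :=
      Finset.card_eq_sum_card_fiberwise (fun _ _ => Finset.mem_coe.2 (Finset.mem_univ _))
    rw [this]; push_cast; rfl
  have hjen : K * Real.log K ≤ ∑ s : Q, Real.log (Fintype.card W / (cl s).card) := by
    have h1 : ∀ s : Q, Real.log K - Real.log (Fintype.card W / (cl s).card) ≤
        (cl s).card * (K / Fintype.card W) - 1 := by
      intro s
      have hsp : (0:ℝ) < (cl s).card := by exact_mod_cast Finset.card_pos.2 (hcl s)
      have := Real.log_le_sub_one_of_pos (x := (cl s).card * (K / Fintype.card W)) (by positivity)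
      refine le_trans (le_of_eq ?_) this
      rw [Real.log_mul (by positivity) (by positivity), Real.log_div hp.ne' hwp.ne',
        Real.log_div hwp.ne' hsp.ne']
      ring
    have h2 := Finset.sum_le_sum (fun s (_ : s ∈ (Finset.univ : Finset Q)) => h1 s)
    rw [Finset.sum_sub_distrib, Finset.sum_sub_distrib, ← Finset.sum_mul, hcs] at h2
    simp only [Finset.sum_const, Finset.card_univ, nsmul_eq_mul, ← hKQ, mul_one] at h2
    have : (Fintype.card W : ℝ) * (K / Fintype.card W) = K := by field_simp
    rw [this] at h2
    linarith
  calc r / 4 * Real.log K = (r / 2 * (K * Real.log K)) / (2 * K) := by field_simp; ring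
    _ ≤ (r / 2 * ∑ s : Q, Real.log (Fintype.card W / (cl s).card)) / (2 * K) := by gcongr
    _ ≤ (∑ s : Q, ((Finset.univ.filter (fun c => X c s)).card : ℝ)) / (2 * K) := by
        rw [Finset.mul_sum]
        gcongr with s
        exact hcross (cl s) (hcl s)
    _ = ∑ c, ((Finset.univ.filter (X c)).card : ℝ) / (2 * K) := by
        rw [← hdc, Finset.sum_div]
    _ ≤ _ := Finset.sum_le_sum fun c _ => hstep c


open Classical in
lemma avg_step {ι : Type*} [Fintype ι] (F : Finset ι → ℝ) (hF : ∀ A, 0 ≤ F A) (a : ℝ) (ha : 0 ≤ a)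
    (h : ∀ A, a * F A ≤ ∑ c, (F A - F (insert c A))) (k : ℕ) (hk : k ≤ Fintype.card ι) :
    ∑ A ∈ Finset.powersetCard k Finset.univ, F A ≤
      (Fintype.card ι).choose k * (F ∅ * Real.exp (-(a * k / Fintype.card ι))) := by
  induction k with
  | zero => simp
  | succ k ih =>
    set m := Fintype.card ι with hm
    have ih := ih (by omega)
    have hmp : (0:ℝ) < m := by
      have : 0 < m := by omega
      exact_mod_cast this
    have hkm : (k:ℝ) + 1 ≤ m := by exact_mod_cast hk
    set S := ∑ A ∈ Finset.powersetCard k Finset.univ, F A with hS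
    set S' := ∑ A ∈ Finset.powersetCard (k+1) Finset.univ, F A with hS'
    have hS0 : 0 ≤ S := Finset.sum_nonneg fun A _ => hF A
    have hdc : ∑ A ∈ Finset.powersetCard k Finset.univ, ∑ c ∈ Aᶜ, F (insert c A) = (k+1) * S' := by
      have : ((k:ℝ)+1) * S' = ∑ B ∈ Finset.powersetCard (k+1) (Finset.univ : Finset ι), ∑ c ∈ B, F B := by
        rw [hS', Finset.mul_sum]
        refine Finset.sum_congr rfl fun B hB => ?_
        rw [Finset.sum_const, (Finset.mem_powersetCard.1 hB).2]
        simp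
      rw [this, Finset.sum_sigma', Finset.sum_sigma']
      refine Finset.sum_bij' (fun x _ => ⟨insert x.2 x.1, x.2⟩) (fun x _ => ⟨x.1.erase x.2, x.2⟩) ?_ ?_ ?_ ?_ ?_
      · rintro ⟨A, c⟩ hx
        simp only [Finset.mem_sigma, Finset.mem_powersetCard, Finset.subset_univ, true_and, Finset.mem_compl] at hx ⊢
        exact ⟨by rw [Finset.card_insert_of_notMem hx.2, hx.1], Finset.mem_insert_self _ _⟩
      · rintro ⟨A, c⟩ hx
        simp only [Finset.mem_sigma, Finset.mem_powersetCard, Finset.subset_univ, true_and, Finset.mem_compl] at hx ⊢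
        exact ⟨by rw [Finset.card_erase_of_mem hx.2, hx.1]; simp, Finset.notMem_erase _ _⟩
      · rintro ⟨A, c⟩ hx
        simp only [Finset.mem_sigma, Finset.mem_powersetCard, Finset.subset_univ, true_and, Finset.mem_compl] at hx
        simp [Finset.erase_insert hx.2]
      · rintro ⟨A, c⟩ hx
        simp only [Finset.mem_sigma, Finset.mem_powersetCard, Finset.subset_univ, true_and] at hx
        simp [Finset.insert_erase hx.2]
      · rintro ⟨A, c⟩ hx
        rfl
    have h1 : a * S ≤ (m - k) * S - (k+1) * S' := by
      rw [← hdc, hS, Finset.mul_sum, Finset.mul_sum, ← Finset.sum_sub_distrib]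
      refine Finset.sum_le_sum fun A hA => (h A).trans (le_of_eq ?_)
      rw [← Finset.sum_add_sum_compl A]
      have : ∑ c ∈ A, (F A - F (insert c A)) = 0 := Finset.sum_eq_zero fun c hc => by
        rw [Finset.insert_eq_of_mem hc, sub_self]
      rw [this, zero_add, Finset.sum_sub_distrib, Finset.sum_const, Finset.card_compl,
        (Finset.mem_powersetCard.1 hA).2, nsmul_eq_mul, Nat.cast_sub (by omega)]
    have h2 : (k+1) * S' ≤ (m - k) * Real.exp (-(a/m)) * S := by
      have e1 : 1 - a / m ≤ Real.exp (-(a/m)) := by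
        have := Real.add_one_le_exp (-(a/m)); linarith
      have e2 : ((m:ℝ) - k) - a ≤ (m-k) * (1 - a/m) := by
        have : (m - k : ℝ) * (a / m) ≤ a := by
          rw [mul_div_assoc', div_le_iff₀ hmp]
          nlinarith [(Nat.cast_nonneg k : (0:ℝ) ≤ k)]
        linarith
      have e3 : (m-k : ℝ) * (1 - a/m) ≤ (m-k) * Real.exp (-(a/m)) :=
        mul_le_mul_of_nonneg_left e1 (by linarith)
      have := mul_le_mul_of_nonneg_right (e2.trans e3) hS0
      linarith
    have h3 : ((m.choose (k+1) : ℕ) : ℝ) * (k+1) = m.choose k * (m - k) := by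
      have := Nat.choose_succ_right_eq m k
      have h' : (k:ℕ) ≤ m := by omega
      rw [← Nat.cast_sub h']
      exact_mod_cast this
    have h4 : Real.exp (-(a * (k+1 : ℕ) / m)) = Real.exp (-(a/m)) * Real.exp (-(a * k / m)) := by
      rw [← Real.exp_add]; congr 1; push_cast; ring
    have hk1 : (0:ℝ) < k + 1 := by positivity
    refine le_of_mul_le_mul_left ?_ hk1
    calc (k+1) * S' ≤ (m - k) * Real.exp (-(a/m)) * S := h2
      _ ≤ (m - k) * Real.exp (-(a/m)) * (m.choose k * (F ∅ * Real.exp (-(a * k / m)))) := by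
          apply mul_le_mul_of_nonneg_left ih
          exact mul_nonneg (by linarith) (Real.exp_pos _).le
      _ = (m.choose k * (m - k)) * (F ∅ * (Real.exp (-(a/m)) * Real.exp (-(a * k / m)))) := by ring
      _ = _ := by rw [← h3, h4]; ring

open Classical in
lemma exists_split {ι : Type*} [Fintype ι] (F : Finset ι → ℝ) (hF : ∀ A, 0 ≤ F A) (a : ℝ) (ha : 0 ≤ a)
    (h : ∀ A, a * F A ≤ ∑ c, (F A - F (insert c A))) (h3 : 2 ≤ Fintype.card ι) (δ : ℝ)
    (hδ : 2 * (F ∅ * Real.exp (-(a / 3))) < δ) : ∃ A : Finset ι, F A + F Aᶜ < δ := by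
  set m := Fintype.card ι with hm
  have hmp : (0:ℝ) < m := by exact_mod_cast (by omega : 0 < m)
  by_contra! hcon
  let k := m / 2
  have hk : k ≤ m := Nat.div_le_self _ _
  have b : ∀ j : ℕ, m ≤ 3 * j → j ≤ m → ∑ A ∈ Finset.powersetCard j Finset.univ, F A ≤
      m.choose j * (F ∅ * Real.exp (-(a / 3))) := by
    intro j hj hjm
    refine (avg_step F hF a ha h j hjm).trans ?_
    have : a / 3 ≤ a * j / m := by
      rw [div_le_div_iff₀ (by norm_num) hmp]
      have : (m:ℝ) ≤ 3 * j := by exact_mod_cast hj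
      nlinarith
    have := hF ∅
    gcongr
  have b1 := b k (by omega) hk
  have b2 := b (m - k) (by omega) (by omega)
  rw [Nat.choose_symm hk] at b2
  have hc : ∑ A ∈ Finset.powersetCard (m-k) Finset.univ, F A =
      ∑ A ∈ Finset.powersetCard k Finset.univ, F Aᶜ := by
    refine Finset.sum_bij' (fun x _ => xᶜ) (fun x _ => xᶜ) ?_ ?_ ?_ ?_ ?_
    · intro A hA
      simp only [Finset.mem_powersetCard, Finset.subset_univ, true_and, Finset.card_compl] at hA ⊢
      omega
    · intro A hA
      simp only [Finset.mem_powersetCard, Finset.subset_univ, true_and, Finset.card_compl] at hA ⊢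
      omega
    · simp
    · simp
    · simp
  rw [hc] at b2
  have hs : ∑ A ∈ Finset.powersetCard k (Finset.univ : Finset ι), δ ≤
      ∑ A ∈ Finset.powersetCard k (Finset.univ : Finset ι), (F A + F Aᶜ) :=
    Finset.sum_le_sum fun A _ => hcon A
  rw [Finset.sum_add_distrib, Finset.sum_const, Finset.card_powersetCard, Finset.card_univ, nsmul_eq_mul] at hs
  have hcp : (0:ℝ) < m.choose k := by exact_mod_cast Nat.choose_pos hk
  rw [← hm] at hs
  nlinarith

open Classical in
lemma dense_piece {ι V : Type*} [Fintype ι] [Fintype V] (τ : ι → Equiv.Perm V)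
    (hτ : ∀ c v, τ c v ≠ v) (r : ℝ) (hr : 0 ≤ r) (hV : 2 ≤ Fintype.card V)
    (hm : r * Real.log (Fintype.card V) ≤ Fintype.card ι) :
    ∃ W : Finset V, 2 ≤ W.card ∧ ∀ S ⊆ W, S.Nonempty →
      r / 2 * Real.log (W.card / S.card) ≤ (Finset.univ.filter
        (fun c : ι => ∃ p ∈ S, ∃ q ∈ W, q ∉ S ∧ (τ c p = q ∨ τ c q = p))).card := by
  let E : Finset V → ℕ := fun S => ∑ c, (S.filter (fun p => τ c p ∈ S)).card
  let P : Finset V → Prop := fun S => 2 ≤ S.card ∧ r * (S.card * Real.log S.card) ≤ E S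
  have huniv : P Finset.univ := by
    refine ⟨by simpa using hV, ?_⟩
    simp only [E, Finset.mem_univ, Finset.filter_true, Finset.card_univ, Finset.sum_const, smul_eq_mul]
    push_cast
    nlinarith [(Nat.cast_nonneg (Fintype.card V) : (0:ℝ) ≤ Fintype.card V)]
  obtain ⟨W, -, hW⟩ := exists_minimal_le_of_wellFoundedLT P Finset.univ huniv
  refine ⟨W, hW.prop.1, fun S hSW hS => ?_⟩
  have hsmall : ∀ T ⊆ W, T ≠ W → (E T : ℝ) ≤ r * (T.card * Real.log T.card) := by
    intro T hT hne
    by_contra! hcon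
    by_cases h2 : 2 ≤ T.card
    · exact hne (le_antisymm hT (hW.le_of_le ⟨h2, hcon.le⟩ hT))
    · have h0 : E T = 0 := by
        refine Finset.sum_eq_zero fun c _ => ?_
        rw [Finset.card_eq_zero, Finset.filter_eq_empty_iff]
        intro p hp hp'
        exact hτ c p (Finset.card_le_one.1 (by omega) _ hp' _ hp)
      rw [h0] at hcon
      have : (T.card : ℝ) * Real.log T.card = 0 := by
        interval_cases h : T.card <;> simp
      rw [this] at hcon
      simp at hcon
  by_cases hSeq : S = W
  · subst hSeq
    have : (0:ℝ) < S.card := by exact_mod_cast Finset.card_pos.2 hS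
    rw [div_self this.ne']; simp
  have hs0 : 0 < S.card := Finset.card_pos.2 hS
  have hlt : S.card < W.card := Finset.card_lt_card (hSW.ssubset_of_ne hSeq)
  set T := W \ S with hT
  have hTc : T.card = W.card - S.card := Finset.card_sdiff_of_subset hSW
  have hTne : T ≠ W := by intro h; rw [h] at hTc; omega
  let X := Finset.univ.filter
        (fun c : ι => ∃ p ∈ S, ∃ q ∈ W, q ∉ S ∧ (τ c p = q ∨ τ c q = p))
  have hdecomp : (E W : ℝ) ≤ E S + E T + 2 * S.card * X.card := by
    have : E W ≤ E S + E T + ∑ c, if c ∈ X then 2 * S.card else 0 := by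
      simp only [E]
      rw [← Finset.sum_add_distrib, ← Finset.sum_add_distrib]
      refine Finset.sum_le_sum fun c _ => ?_
      have hsub : W.filter (fun p => τ c p ∈ W) ⊆
          ((S.filter (fun p => τ c p ∈ S)) ∪ (T.filter (fun p => τ c p ∈ T))) ∪
          ((S.filter (fun p => τ c p ∈ T)) ∪ (T.filter (fun p => τ c p ∈ S))) := by
        intro p hp
        simp only [hT, Finset.mem_filter, Finset.mem_union, Finset.mem_sdiff] at hp ⊢
        tauto
      have h1 := (Finset.card_le_card hsub).trans (Finset.card_union_le _ _)
      have h2 := Finset.card_union_le (S.filter (fun p => τ c p ∈ S)) (T.filter (fun p => τ c p ∈ T))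
      have h3 := Finset.card_union_le (S.filter (fun p => τ c p ∈ T)) (T.filter (fun p => τ c p ∈ S))
      have h4 : (S.filter (fun p => τ c p ∈ T)).card ≤ if c ∈ X then S.card else 0 := by
        split_ifs with h
        · exact Finset.card_filter_le _ _
        · rw [Nat.le_zero, Finset.card_eq_zero, Finset.filter_eq_empty_iff]
          intro p hp hp'
          apply h
          rw [hT, Finset.mem_sdiff] at hp'
          simp only [X, Finset.mem_filter, Finset.mem_univ, true_and]
          exact ⟨p, hp, _, hp'.1, hp'.2, Or.inl rfl⟩
      have h5 : (T.filter (fun p => τ c p ∈ S)).card ≤ if c ∈ X then S.card else 0 := by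
        split_ifs with h
        · refine Finset.card_le_card_of_injOn (τ c) ?_ (τ c).injective.injOn
          intro p hp
          exact (Finset.mem_filter.1 hp).2
        · rw [Nat.le_zero, Finset.card_eq_zero, Finset.filter_eq_empty_iff]
          intro p hp hp'
          apply h
          rw [hT, Finset.mem_sdiff] at hp
          simp only [X, Finset.mem_filter, Finset.mem_univ, true_and]
          exact ⟨_, hp', p, hp.1, hp.2, Or.inr rfl⟩
      split_ifs at h4 h5 ⊢ <;> omega
    rw [Finset.sum_ite_mem, Finset.univ_inter, Finset.sum_const, smul_eq_mul] at this
    have h' : (E W : ℝ) ≤ E S + E T + X.card * (2 * S.card) := by exact_mod_cast this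
    linarith
  have hES := hsmall S hSW hSeq
  have hET := hsmall T Finset.sdiff_subset hTne
  have hEW := hW.prop.2
  have hsp : (0:ℝ) < S.card := by exact_mod_cast hs0
  have hwp : (0:ℝ) < W.card := by exact_mod_cast hs0.trans hlt
  have htp : (0:ℝ) < T.card := by exact_mod_cast (by omega : 0 < T.card)
  have hsum : (T.card : ℝ) = W.card - S.card := by rw [hTc, Nat.cast_sub hlt.le]
  have hTlog : (T.card : ℝ) * Real.log T.card ≤ T.card * Real.log W.card := by
    apply mul_le_mul_of_nonneg_left _ htp.le
    exact Real.log_le_log htp (by linarith)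
  change _ ≤ (X.card : ℝ)
  rw [Real.log_div hwp.ne' hsp.ne']
  have key : r * (S.card * (Real.log W.card - Real.log S.card)) ≤ 2 * S.card * X.card := by
    have h1 : r * (W.card * Real.log W.card) ≤ r * (S.card * Real.log S.card) +
      r * (T.card * Real.log W.card) + 2 * S.card * X.card := by
      have := mul_le_mul_of_nonneg_left hTlog hr
      linarith
    rw [hsum] at h1
    linarith
  refine le_of_mul_le_mul_left ?_ (mul_pos two_pos hsp)
  linarith


open Classical in
lemma comb_main {ι V : Type*} [Fintype ι] [Fintype V] (τ : ι → Equiv.Perm V)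
    (hτ : ∀ c v, τ c v ≠ v) (r : ℝ) (hr : 0 ≤ r) (hV : 2 ≤ Fintype.card V)
    (hm : r * Real.log (Fintype.card V) ≤ Fintype.card ι) (hι : 2 ≤ Fintype.card ι)
    (hexp : 2 * (Real.log (Fintype.card V) * Real.exp (-(r / 12))) < Real.log 2) :
    ∃ W : Finset V, Nontrivial W ∧ ∃ A B : Finset ι, Disjoint A B ∧
      (∀ p q : W, Relation.EqvGen (fun p q : W => ∃ c ∈ A, τ c p = q) p q) ∧
      (∀ p q : W, Relation.EqvGen (fun p q : W => ∃ c ∈ B, τ c p = q) p q) := by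
  obtain ⟨W, hW2, hW⟩ := dense_piece τ hτ r hr hV hm
  have hnt : Nontrivial W := Fintype.one_lt_card_iff_nontrivial.1 (by rw [Fintype.card_coe]; omega)
  refine ⟨W, hnt, ?_⟩
  let R : ι → W → W → Prop := fun c p q => τ c p = q
  have hcross : ∀ S : Finset W, S.Nonempty → r / 2 * Real.log (Fintype.card W / S.card) ≤
      (Finset.univ.filter (fun c : ι => ∃ p ∈ S, ∃ q, q ∉ S ∧ (R c p q ∨ R c q p))).card := by
    intro S hS
    have := hW (S.map (Function.Embedding.subtype _)) (by
      intro v hv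
      simp only [Finset.mem_map, Function.Embedding.subtype_apply] at hv
      obtain ⟨a, -, rfl⟩ := hv
      exact a.2) (hS.map)
    rw [Finset.card_map] at this
    rw [Fintype.card_coe]
    refine this.trans ?_
    norm_cast
    apply Finset.card_le_card
    intro c hc
    simp only [Finset.mem_filter, Finset.mem_univ, true_and] at hc ⊢
    obtain ⟨p, hp, q, hq, hqS, h⟩ := hc
    simp only [Finset.mem_map, Function.Embedding.subtype_apply] at hp hqS
    obtain ⟨p, hp, rfl⟩ := hp
    exact ⟨p, hp, ⟨q, hq⟩, fun h' => hqS ⟨_, h', rfl⟩, h⟩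
  have hpos : ∀ A, 0 < numComp R A := fun A => by
    unfold numComp
    have : Nonempty (Quotient (colSetoid R A)) := ⟨Quotient.mk _ (Classical.arbitrary W)⟩
    exact Nat.card_pos
  have hFn : ∀ A, 0 ≤ Real.log (numComp R A) := fun A =>
    Real.log_nonneg (by exact_mod_cast hpos A)
  have hF0 : Real.log (numComp R ∅) ≤ Real.log (Fintype.card V) := by
    apply Real.log_le_log (by exact_mod_cast hpos _)
    have h1 : numComp R ∅ ≤ Fintype.card W := by
      unfold numComp
      rw [← Nat.card_eq_fintype_card]
      exact Nat.card_le_card_of_surjective _ (Quotient.mk_surjective)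
    have h2 : Fintype.card W ≤ Fintype.card V := by
      rw [Fintype.card_coe]; exact Finset.card_le_univ _
    exact_mod_cast h1.trans h2
  have hmerge : ∀ A : Finset ι, r / 4 * Real.log (numComp R A) ≤
      ∑ c : ι, (Real.log (numComp R A) - Real.log (numComp R (insert c A))) := by
    intro A
    refine merge_step R r hr ?_ A
    intro S hS
    convert hcross S hS
  obtain ⟨A, hA⟩ := exists_split (fun A => Real.log (numComp R A)) hFn (r/4) (by positivity)
    hmerge hι (Real.log 2) (by
      refine lt_of_le_of_lt ?_ hexp
      have : r / 4 / 3 = r / 12 := by ring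
      rw [this]
      gcongr)
  have hconn : ∀ A, Real.log (numComp R A) < Real.log 2 → ∀ p q : W,
      Relation.EqvGen (fun p q : W => ∃ c ∈ A, R c p q) p q := by
    intro A hA p q
    have h1 : numComp R A < 2 := by
      have := (Real.log_lt_log_iff (by exact_mod_cast hpos A) two_pos).1 hA
      exact_mod_cast this
    have h2 : numComp R A = 1 := by have := hpos A; omega
    have h3 : Subsingleton (Quotient (colSetoid R A)) := (Nat.card_eq_one_iff_unique.1 h2).1
    have h4 : (Quotient.mk (colSetoid R A) p) = Quotient.mk _ q := Subsingleton.elim _ _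
    exact Quotient.exact h4
  refine ⟨A, Aᶜ, disjoint_compl_right, hconn A ?_, hconn Aᶜ ?_⟩
  · exact lt_of_le_of_lt (le_add_of_nonneg_right (hFn Aᶜ)) hA
  · exact lt_of_le_of_lt (le_add_of_nonneg_left (hFn A)) hA

lemma fiber_equiv {α β Q : Type*} [Finite α] [Finite β] (f : α → Q) (g : β → Q)
    (h : ∀ t, Nat.card {a // f a = t} = Nat.card {b // g b = t}) :
    ∃ e : α ≃ β, ∀ a, g (e a) = f a := by
  have h' : ∀ t, Nonempty ({a // f a = t} ≃ {b // g b = t}) := fun t =>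
    Finite.card_eq.1 (h t)
  let E : ∀ t, ({a // f a = t} ≃ {b // g b = t}) := fun t => (h' t).some
  refine ⟨(Equiv.sigmaFiberEquiv f).symm.trans ((Equiv.sigmaCongrRight E).trans (Equiv.sigmaFiberEquiv g)), ?_⟩
  intro a
  exact (E (f a) ⟨a, rfl⟩).2

lemma numeric (m : ℕ) (hm : 10000 ≤ m) (n : ℕ) (hn : 0 < n)
    (h : (n : ℝ) ≤ (2:ℝ) ^ ((1/100 : ℝ) * m / Real.log m)) :
    24 * Real.log m * Real.log ((n + n : ℕ) : ℝ) ≤ m ∧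
    2 * (Real.log ((n + n : ℕ) : ℝ) * Real.exp (-(24 * Real.log m / 12))) < Real.log 2 := by
  have hm' : (10000:ℝ) ≤ m := by exact_mod_cast hm
  have hmp : (0:ℝ) < m := by linarith
  have hn' : (0:ℝ) < n := by exact_mod_cast hn
  have hl1 : 1 ≤ Real.log m := by
    rw [Real.le_log_iff_exp_le hmp]
    linarith [Real.exp_one_lt_d9]
  have hls : Real.log m ≤ m / 50 := by
    have h1 : Real.log m = 2 * Real.log (Real.sqrt m) := by
      rw [Real.log_sqrt hmp.le]; ring
    have h2 := Real.log_le_sub_one_of_pos (Real.sqrt_pos.2 hmp)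
    have h3 : 100 ≤ Real.sqrt m := Real.le_sqrt_of_sq_le (by linarith)
    have h4 := Real.mul_self_sqrt hmp.le
    nlinarith
  have hl2 : Real.log 2 ≤ 1 := by linarith [Real.log_two_lt_d9]
  have hl2' : 0.69 < Real.log 2 := by linarith [Real.log_two_gt_d9]
  have hlogn : Real.log n ≤ (1/100 : ℝ) * m / Real.log m * Real.log 2 := by
    have := Real.log_le_log hn' h
    rwa [Real.log_rpow two_pos] at this
  have hN : Real.log ((n + n : ℕ) : ℝ) = Real.log 2 + Real.log n := by
    rw [← Real.log_mul two_ne_zero hn'.ne']; congr 1; push_cast; ring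
  have hprod : Real.log m * Real.log n ≤ m / 100 := by
    have h1 : Real.log m * Real.log n ≤ Real.log m * ((1/100 : ℝ) * m / Real.log m * Real.log 2) :=
      mul_le_mul_of_nonneg_left hlogn (by linarith)
    have h2 : Real.log m * ((1/100 : ℝ) * m / Real.log m * Real.log 2) = m / 100 * Real.log 2 := by
      have : Real.log m ≠ 0 := by linarith
      field_simp
    rw [h2] at h1
    nlinarith
  have hfirst : 24 * Real.log m * Real.log ((n + n : ℕ) : ℝ) ≤ m := by
    rw [hN]
    nlinarith
  refine ⟨hfirst, ?_⟩
  have hexp : Real.exp (-(24 * Real.log m / 12)) = 1 / (m * m) := by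
    have : -(24 * Real.log m / 12) = -(Real.log m + Real.log m) := by ring
    rw [this, Real.exp_neg, Real.exp_add, Real.exp_log hmp, one_div]
  rw [hexp]
  have hlogn0 : 0 ≤ Real.log n := Real.log_nonneg (by exact_mod_cast hn)
  have hN0 : 0 ≤ Real.log ((n + n : ℕ) : ℝ) := by rw [hN]; linarith
  have hNm : Real.log ((n + n : ℕ) : ℝ) ≤ m := by nlinarith
  have : Real.log ((n + n : ℕ) : ℝ) * (1 / (m * m)) ≤ 1 / m := by
    rw [mul_one_div, div_le_div_iff₀ (by positivity) hmp]
    nlinarith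
  have h5 : 1 / (m:ℝ) ≤ 1 / 10000 := one_div_le_one_div_of_le (by norm_num) hm'
  linarith

lemma xray_ne_false {m : ℕ} (hm : 10000 ≤ m) (θ : Fin m → ℝ)
    (hθ : ∀ (N : ℕ) (W : Finset (Fin N)) (R : Fin m → W → W → Prop) (A B : Finset (Fin m)),
      Disjoint A B → Nontrivial W →
      (∀ p q, Relation.EqvGen (fun p q => ∃ c ∈ A, R c p q) p q) →
      (∀ p q, Relation.EqvGen (fun p q => ∃ c ∈ B, R c p q) p q) →
      ∀ x : W → Fin 2 → ℝ, Function.Injective x →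
      ¬ ∀ c p q, R c p q →
        -Real.sin (θ c) * (x q 0 - x p 0) + Real.cos (θ c) * (x q 1 - x p 1) = 0)
    (F : Set (Fin 2 → ℝ)) (hF : F.Finite)
    (hcard : (F.ncard : ℝ) ≤ (2 : ℝ) ^ ((1/100 : ℝ) * (m : ℝ) / Real.log (m : ℝ)))
    (F' : Set (Fin 2 → ℝ)) (hF' : F'.Finite)
    (hX : ∀ i : Fin m,
      XrayEq (Submodule.span ℝ {![Real.cos (θ i), Real.sin (θ i)]}) F' F) :
    F' = F := by
  classical
  by_contra hne
  let D1 := F \ F'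
  let D2 := F' \ F
  have hf1 : D1.Finite := hF.subset sdiff_subset
  have hf2 : D2.Finite := hF'.subset sdiff_subset
  have := hf1.fintype
  have := hf2.fintype
  let S : Fin m → Submodule ℝ (Fin 2 → ℝ) := fun i => Submodule.span ℝ {![Real.cos (θ i), Real.sin (θ i)]}
  have hfib : ∀ i (t : (Fin 2 → ℝ) ⧸ S i), (D1 ∩ fiber (S i) t).ncard = (D2 ∩ fiber (S i) t).ncard := by
    intro i t
    have h := hX i t
    have h1 := Set.ncard_inter_add_ncard_sdiff_eq_ncard (F ∩ fiber (S i) t) F' (hF.subset inter_subset_left)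
    have h2 := Set.ncard_inter_add_ncard_sdiff_eq_ncard (F' ∩ fiber (S i) t) F (hF'.subset inter_subset_left)
    have e1 : F ∩ fiber (S i) t ∩ F' = F' ∩ fiber (S i) t ∩ F := by ext; simp; tauto
    have e2 : (F ∩ fiber (S i) t) \ F' = D1 ∩ fiber (S i) t := by ext; simp [D1]; tauto
    have e3 : (F' ∩ fiber (S i) t) \ F = D2 ∩ fiber (S i) t := by ext; simp [D2]; tauto
    rw [e1, e2] at h1
    rw [e3] at h2
    change (F' ∩ fiber (S i) t).ncard = (F ∩ fiber (S i) t).ncard at h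
    omega
  have hσ : ∀ i, ∃ e : D1 ≃ D2, ∀ a : D1, (Submodule.Quotient.mk (e a).1 : (Fin 2 → ℝ) ⧸ S i) =
      Submodule.Quotient.mk a.1 := by
    intro i
    apply fiber_equiv (fun a : D1 => (Submodule.Quotient.mk a.1 : (Fin 2 → ℝ) ⧸ S i))
      (fun a : D2 => (Submodule.Quotient.mk a.1 : (Fin 2 → ℝ) ⧸ S i))
    intro t
    have hc : ∀ D : Set (Fin 2 → ℝ), Nat.card {a : D // (Submodule.Quotient.mk a.1 : (Fin 2 → ℝ) ⧸ S i) = t} =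
        (D ∩ fiber (S i) t).ncard := by
      intro D
      rw [← Nat.card_coe_set_eq]
      exact Nat.card_congr (Equiv.subtypeSubtypeEquivSubtypeInter (fun x => x ∈ D) (fun x => (Submodule.Quotient.mk x : (Fin 2 → ℝ) ⧸ S i) = t))
    rw [hc, hc, hfib]
  choose σ hσ using hσ
  have hm0 : 0 < m := by omega
  let n := Fintype.card D1
  have hn2 : Fintype.card D2 = n := (Fintype.card_congr (σ ⟨0, hm0⟩)).symm
  have hn : 0 < n := by
    rcases Nat.eq_zero_or_pos n with h0 | h0
    · exfalso
      apply hne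
      have i1 : IsEmpty D1 := Fintype.card_eq_zero_iff.1 h0
      have i2 : IsEmpty D2 := Fintype.card_eq_zero_iff.1 (hn2.trans h0)
      rw [Set.isEmpty_coe_sort] at i1 i2
      exact Set.Subset.antisymm (Set.sdiff_eq_empty.1 i2) (Set.sdiff_eq_empty.1 i1)
    · exact h0
  have hnF : n ≤ F.ncard := by
    have : n = D1.ncard := by rw [← Nat.card_coe_set_eq, Nat.card_eq_fintype_card]
    rw [this]
    exact Set.ncard_le_ncard sdiff_subset hF
  obtain ⟨hnum1, hnum2⟩ := numeric m hm n hn (le_trans (by exact_mod_cast hnF) hcard)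
  have hcardV : Fintype.card (D1 ⊕ D2) = n + n := by rw [Fintype.card_sum, hn2]
  let e : (D1 ⊕ D2) ≃ Fin (n + n) := Fintype.equivFinOfCardEq hcardV
  let τ0 : Fin m → Equiv.Perm (D1 ⊕ D2) := fun i =>
    ((σ i).sumCongr (σ i).symm).trans (Equiv.sumComm _ _)
  let pos : D1 ⊕ D2 → (Fin 2 → ℝ) := Sum.elim Subtype.val Subtype.val
  have hpos : Function.Injective pos := by
    rintro (a | a) (b | b) h
    · exact congrArg _ (Subtype.ext h)
    · exact absurd b.2.1 (by have : a.1 = b.1 := h; rw [← this]; exact a.2.2)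
    · exact absurd a.2.1 (by have : a.1 = b.1 := h; rw [this]; exact b.2.2)
    · exact congrArg _ (Subtype.ext h)
  have hτ0 : ∀ i v, (Submodule.Quotient.mk (pos (τ0 i v)) : (Fin 2 → ℝ) ⧸ S i) = Submodule.Quotient.mk (pos v) := by
    rintro i (a | a)
    · exact hσ i a
    · have := hσ i ((σ i).symm a)
      rw [Equiv.apply_symm_apply] at this
      exact this.symm
  have hne_tau : ∀ i v, τ0 i v ≠ v := by
    rintro i (a | a) <;> simp [τ0]
  let τ : Fin m → Equiv.Perm (Fin (n+n)) := fun i => e.permCongr (τ0 i)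
  obtain ⟨W, hWnt, A, B, hAB, hA, hB⟩ := comb_main τ (by
      intro c v h
      apply hne_tau c (e.symm v)
      apply e.injective
      simpa [τ, Equiv.permCongr_apply] using h) (24 * Real.log m)
    (mul_nonneg (by norm_num) (Real.log_natCast_nonneg m)) (by simp; omega)
    (by simpa using hnum1) (by simp; omega) (by simpa using hnum2)
  refine hθ (n+n) W (fun c p q => τ c p = q) A B hAB hWnt hA hB (fun w => pos (e.symm w))
    (fun a b h => Subtype.ext (e.symm.injective (hpos h))) ?_
  intro c p q hpq
  have h1 := hτ0 c (e.symm p)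
  have h2 : τ0 c (e.symm p) = e.symm q := by
    rw [← hpq]; simp [τ, Equiv.permCongr_apply]
  rw [h2, Submodule.Quotient.eq, Submodule.mem_span_singleton] at h1
  obtain ⟨a, ha⟩ := h1
  have ha0 := congrFun ha 0
  have ha1 := congrFun ha 1
  simp only [Pi.smul_apply, Pi.sub_apply, Matrix.cons_val_zero, Matrix.cons_val_one, smul_eq_mul] at ha0 ha1
  rw [← ha0, ← ha1]
  ring

theorem matousek_generic_directions :
    ∃ c : ℝ, 0 < c ∧ ∃ m₀ : ℕ, ∀ m : ℕ, m₀ ≤ m →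
      ∀ᵐ θ : Fin m → ℝ
        ∂(MeasureTheory.Measure.pi fun _ : Fin m =>
            MeasureTheory.volume.restrict (Set.Ico (0 : ℝ) Real.pi)),
        ∀ F : Set (Fin 2 → ℝ), F.Finite →
          (F.ncard : ℝ) ≤ (2 : ℝ) ^ (c * (m : ℝ) / Real.log (m : ℝ)) →
          ∀ F' : Set (Fin 2 → ℝ), F'.Finite →
            (∀ i : Fin m,
              XrayEq (Submodule.span ℝ {![Real.cos (θ i), Real.sin (θ i)]}) F' F) →
            F' = F := by
  refine ⟨1/100, by norm_num, 10000, fun m hm => ?_⟩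
  rw [← MeasureTheory.Measure.restrict_pi_pi]
  apply MeasureTheory.ae_restrict_of_ae
  have key : ∀ᵐ θ : Fin m → ℝ, ∀ (N : ℕ) (W : Finset (Fin N)) (R : Fin m → W → W → Prop)
      (A B : Finset (Fin m)),
      Disjoint A B → Nontrivial W →
      (∀ p q, Relation.EqvGen (fun p q => ∃ c ∈ A, R c p q) p q) →
      (∀ p q, Relation.EqvGen (fun p q => ∃ c ∈ B, R c p q) p q) →
      ∀ x : W → Fin 2 → ℝ, Function.Injective x →
      ¬ ∀ c p q, R c p q →
        -Real.sin (θ c) * (x q 0 - x p 0) + Real.cos (θ c) * (x q 1 - x p 1) = 0 := by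
    rw [MeasureTheory.ae_all_iff]; intro N
    rw [MeasureTheory.ae_all_iff]; intro W
    rw [MeasureTheory.ae_all_iff]; intro R
    rw [MeasureTheory.ae_all_iff]; intro A
    rw [MeasureTheory.ae_all_iff]; intro B
    by_cases h : Disjoint A B ∧ Nontrivial W ∧
      (∀ p q, Relation.EqvGen (fun p q => ∃ c ∈ A, R c p q) p q) ∧
      (∀ p q, Relation.EqvGen (fun p q => ∃ c ∈ B, R c p q) p q)
    · filter_upwards [generic_null R A B h.1 h.2.1 h.2.2.1 h.2.2.2] with θ hθ _ _ _ _
      exact hθ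
    · filter_upwards with θ h1 h2 h3 h4
      exact absurd ⟨h1, h2, h3, h4⟩ h
  filter_upwards [key] with θ hθ F hF hc F' hF' hX
  exact xray_ne_false hm θ hθ F hF hc F' hF' hX
end

section
/- (Improvement of Rényi's theorem in the lattice case) Let m ∈ ℕ with m ∉ {1, 2, 3, 4, 6}, let d ≥ 2, and let 𝓛 be a set of lattice lines in ℝ^d with |𝓛| ≥ m. Then any two finite sets F₁, F₂ ⊆ ℤ^d with |F₁| ≤ m and |F₂| ≤ m that are tomographically equivalent with respect to 𝓛 are equal; i.e., the finite lattice sets of cardinality at most m are determined by their X-rays parallel to the lines in 𝓛. -/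
open Set

variable {d : ℕ}

def dt {K : Type*} [CommRing K] (p q : K × K) : K := p.1 * q.2 - p.2 * q.1

/-- A root of unity of exact order `m` with rational trace forces `m ∣ 4` or `m ∣ 6`. -/
lemma root_order (m : ℕ) (hm : 5 ≤ m) (h6 : m ≠ 6) (μ : ℂ) (h1 : μ ^ m = 1)
    (h2 : ∀ k, 0 < k → k < m → μ ^ k ≠ 1) (q : ℚ) (hq : μ ^ 2 - (q : ℂ) * μ + 1 = 0) : False := by
  have hμ0 : μ ≠ 0 := by
    rintro rfl
    rw [zero_pow (by omega)] at h1
    exact zero_ne_one h1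
  have hmu_int : IsIntegral ℤ μ := IsIntegral.of_pow (n := m) (by omega) (by rw [h1]; exact isIntegral_one)
  have hmuinv : IsIntegral ℤ (μ⁻¹) := IsIntegral.of_pow (n := m) (by omega)
    (by rw [inv_pow, h1, inv_one]; exact isIntegral_one)
  have hqe : (q : ℂ) = μ + μ⁻¹ := by
    field_simp
    linear_combination -hq
  have hqi : IsIntegral ℤ ((algebraMap ℚ ℂ) q) := by
    have : (algebraMap ℚ ℂ) q = μ + μ⁻¹ := by rw [← hqe]; rfl
    rw [this]; exact hmu_int.add hmuinv
  have hqi' : IsIntegral ℤ q := (isIntegral_algebraMap_iff (algebraMap ℚ ℂ).injective).1 hqi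
  obtain ⟨r, hr⟩ := IsIntegrallyClosed.isIntegral_iff.1 hqi'
  have hr' : q = (r : ℚ) := by rw [← hr]; rfl
  subst hr'
  have hn : ‖μ‖ = 1 := Complex.norm_eq_one_of_pow_eq_one h1 (by omega)
  have hle : |(r : ℝ)| ≤ 2 := by
    have h3 : ‖((r : ℚ) : ℂ)‖ ≤ ‖μ‖ + ‖μ⁻¹‖ := by rw [hqe]; exact norm_add_le _ _
    rw [norm_inv, hn] at h3
    have h4 : ‖((r : ℚ) : ℂ)‖ = |(r : ℝ)| := by
      have : ((r : ℚ) : ℂ) = ((r : ℝ) : ℂ) := by push_cast; rfl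
      rw [this, Complex.norm_real, Real.norm_eq_abs]
    rw [h4] at h3; linarith
  have hle2 : |r| ≤ 2 := by exact_mod_cast hle
  rw [abs_le] at hle2
  obtain ⟨ha, hb⟩ := hle2
  push_cast at hq
  interval_cases r <;> push_cast at hq
  · have : (μ + 1) ^ 2 = 0 := by linear_combination hq
    have : μ + 1 = 0 := by simpa using this
    exact h2 2 (by omega) (by omega) (by linear_combination (μ - 1) * this)
  · exact h2 3 (by omega) (by omega) (by linear_combination (μ - 1) * hq)
  · exact h2 4 (by omega) (by omega) (by linear_combination (μ ^ 2 - 1) * hq)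
  · have h66 : μ ^ 6 = 1 := by linear_combination (μ ^ 3 - 1) * (μ + 1) * hq
    rcases Nat.lt_or_ge 6 m with h | h
    · exact h2 6 (by omega) h h66
    · have : m = 5 := by omega
      subst this
      exact h2 1 (by omega) (by omega) (by linear_combination h66 - μ * h1)
  · have : (μ - 1) ^ 2 = 0 := by linear_combination hq
    have : μ - 1 = 0 := by simpa using this
    exact h2 1 (by omega) (by omega) (by linear_combination this)

set_option maxHeartbeats 1000000 in
/-- The linear recurrence step. -/
lemma eig_final (m : ℕ) (hm : 5 ≤ m) (h6 : m ≠ 6) (s : ℤ → ℚ × ℚ)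
    (hanti : ∀ k, s (k + m) = -s k)
    (hdet : ∀ k l : ℤ, k < l → l < k + m → dt (s k) (s l) ≠ 0)
    (u : ℤ → ℂ × ℂ) (lam : ℂ) (hrec : ∀ k, u (k - 1) + u (k + 1) = lam • u k)
    (hu : u ≠ 0)
    (hpar : ∀ k, ((s k).1 : ℂ) * (u k).2 - ((s k).2 : ℂ) * (u k).1 = 0) : False := by
  have hs0 : ∀ k, (s k).1 ≠ 0 ∨ (s k).2 ≠ 0 := by
    intro k
    by_contra! hc
    exact hdet k (k + 1) (by omega) (by omega) (by simp [dt, hc])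
  have hc : ∀ k, ∃ c : ℂ, u k = (c * (s k).1, c * (s k).2) := by
    intro k
    rcases hs0 k with h | h
    · have h' : ((s k).1 : ℂ) ≠ 0 := by exact_mod_cast h
      refine ⟨(u k).1 / (s k).1, Prod.ext ?_ ?_⟩
      · simp; field_simp
      · simp; field_simp; linear_combination hpar k
    · have h' : ((s k).2 : ℂ) ≠ 0 := by exact_mod_cast h
      refine ⟨(u k).2 / (s k).2, Prod.ext ?_ ?_⟩
      · simp; field_simp; linear_combination -hpar k
      · simp; field_simp
  choose c hc using hc
  have hdetC : ∀ k l : ℤ, k < l → l < k + m →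
      ((s k).1 : ℂ) * (s l).2 - ((s k).2 : ℂ) * (s l).1 ≠ 0 := by
    intro k l h1 h2
    have := hdet k l h1 h2
    unfold dt at this
    exact_mod_cast this
  have r1 : ∀ k, (u (k - 1)).1 + (u (k + 1)).1 = lam * (u k).1 := fun k => by
    simpa using congrArg Prod.fst (hrec k)
  have r2 : ∀ k, (u (k - 1)).2 + (u (k + 1)).2 = lam * (u k).2 := fun k => by
    simpa using congrArg Prod.snd (hrec k)
  -- two consecutive zeros
  have hzz : ∀ k, u k = 0 → u (k + 1) = 0 → u = 0 := by
    intro k h0 h1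
    have key : ∀ n : ℕ, (u (k + n) = 0 ∧ u (k + n + 1) = 0) ∧ (u (k - n) = 0 ∧ u (k - n + 1) = 0) := by
      intro n
      induction n with
      | zero => simp [h0, h1]
      | succ n ih =>
        obtain ⟨⟨i1, i2⟩, i3, i4⟩ := ih
        have e1 := hrec (k + n + 1)
        have e2 := hrec (k - n)
        rw [i2, add_sub_cancel_right, i1, smul_zero, zero_add] at e1
        rw [i3, i4, smul_zero, add_zero] at e2
        push_cast
        refine ⟨⟨?_, ?_⟩, ?_, ?_⟩
        · rw [← i2]; congr 1; ring
        · rw [← e1]; congr 1; ring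
        · rw [← e2]; congr 1; ring
        · rw [← i3]; congr 1; ring
    funext j
    change u j = (0 : ℂ × ℂ)
    rcases le_total k j with h | h
    · have := (key (j - k).toNat).1.1
      rw [← this]; congr 1; omega
    · have := (key (k - j).toNat).2.1
      rw [← this]; congr 1; omega
  have hc0 : ∀ k, c k ≠ 0 := by
    intro k hk
    apply hu
    have h0 : u k = 0 := by rw [hc, hk]; simp
    have a1 := r1 k
    have a2 := r2 k
    rw [h0, hc (k - 1), hc (k + 1)] at a1 a2
    simp at a1 a2
    have : c (k + 1) * (((s (k - 1)).1 : ℂ) * (s (k + 1)).2 - ((s (k - 1)).2 : ℂ) * (s (k + 1)).1) = 0 := by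
      linear_combination ((s (k - 1)).1 : ℂ) * a2 - ((s (k - 1)).2 : ℂ) * a1
    have h1 : c (k + 1) = 0 := by
      rcases mul_eq_zero.1 this with h | h
      · exact h
      · exact absurd h (hdetC _ _ (by omega) (by omega))
    exact hzz k h0 (by rw [hc, h1]; simp)
  -- determinant formula
  have hdu : ∀ k l, dt (u k) (u l) = c k * c l *
      (((s k).1 : ℂ) * (s l).2 - ((s k).2 : ℂ) * (s l).1) := by
    intro k l
    rw [hc k, hc l]; simp only [dt]; ring
  set D := dt (u 0) (u 1) with hD
  have hD0 : D ≠ 0 := by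
    rw [hD, hdu]
    exact mul_ne_zero (mul_ne_zero (hc0 _) (hc0 _)) (hdetC _ _ (by omega) (by omega))
  have hne : ∀ k : ℤ, 0 < k → k < m → dt (u 0) (u k) ≠ 0 := by
    intro k h1 h2
    rw [hdu]
    exact mul_ne_zero (mul_ne_zero (hc0 _) (hc0 _)) (hdetC _ _ (by omega) (by omega))
  have hzero : dt (u 0) (u m) = 0 := by
    rw [hdu]
    have := hanti 0
    rw [zero_add] at this
    rw [this]; simp; right; ring
  have hrecd : ∀ k, dt (u 0) (u (k - 1)) + dt (u 0) (u (k + 1)) = lam * dt (u 0) (u k) := by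
    intro k
    simp only [dt]
    linear_combination (u 0).1 * r2 k - (u 0).2 * r1 k
  -- rationality of lam ^ 2
  have hlam : ∃ q : ℚ, lam ^ 2 = (q : ℂ) := by
    have a1 := r1 1
    have a2 := r2 1
    have b1 := r1 2
    have b2 := r2 2
    norm_num at a1 a2 b1 b2
    have e1 : dt (u 0) (u 2) = lam * D := by
      simp only [hD, dt]; linear_combination (u 0).1 * a2 - (u 0).2 * a1
    have e2 : dt (u 1) (u 2) = D := by
      simp only [hD, dt]; linear_combination (u 1).1 * a2 - (u 1).2 * a1
    have e3 : dt (u 1) (u 3) = lam * D := by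
      rw [← e2]; simp only [dt]; linear_combination (u 1).1 * b2 - (u 1).2 * b1
    have e4 : dt (u 2) (u 3) = D := by
      rw [← e2]; simp only [dt]; linear_combination (u 2).1 * b2 - (u 2).2 * b1
    have h01 := hdet 0 1 (by omega) (by omega)
    have h23 := hdet 2 3 (by omega) (by omega)
    refine ⟨dt (s 0) (s 2) * dt (s 1) (s 3) / (dt (s 0) (s 1) * dt (s 2) (s 3)), ?_⟩
    have h01' := hdetC 0 1 (by omega) (by omega)
    have h23' := hdetC 2 3 (by omega) (by omega)
    have e0 : D = D := rfl
    nth_rewrite 1 [hD] at e0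
    rw [hdu] at e0 e1 e3 e4
    simp only [dt]
    push_cast
    rw [eq_div_iff (mul_ne_zero h01' h23')]
    have hcc : c 0 * c 1 * c 2 * c 3 ≠ 0 :=
      mul_ne_zero (mul_ne_zero (mul_ne_zero (hc0 _) (hc0 _)) (hc0 _)) (hc0 _)
    apply mul_left_cancel₀ hcc
    have : (lam * D) * (lam * D) = lam ^ 2 * (D * D) := by ring
    rw [← e1] at this
    nth_rewrite 2 [e1] at this
    nth_rewrite 1 [← e3] at this
    nth_rewrite 1 [← e0] at this
    rw [← e4] at this
    linear_combination -this
  obtain ⟨q, hq⟩ := hlam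
  obtain ⟨z, hz⟩ : ∃ z : ℂ, z ^ 2 - lam * z + 1 = 0 := by
    obtain ⟨t, ht⟩ := IsAlgClosed.exists_pow_nat_eq (lam ^ 2 - 4) (n := 2) (by norm_num)
    exact ⟨(lam + t) / 2, by linear_combination ht / 4⟩
  have hz0 : z ≠ 0 := by
    rintro rfl; simp at hz
  have hlz : lam * z = z ^ 2 + 1 := by linear_combination -hz
  have hform : ∀ n : ℕ, dt (u 0) (u n) * (z ^ 2 - 1) * z ^ n = D * z * ((z ^ 2) ^ n - 1) ∧
      dt (u 0) (u (n + 1 : ℕ)) * (z ^ 2 - 1) * z ^ (n + 1) = D * z * ((z ^ 2) ^ (n + 1) - 1) := by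
    intro n
    induction n with
    | zero =>
      refine ⟨by simp [dt]; left; ring, ?_⟩
      simp [← hD]; ring
    | succ n ih =>
      obtain ⟨i1, i2⟩ := ih
      refine ⟨i2, ?_⟩
      have := hrecd ((n + 1 : ℕ) : ℤ)
      have e1 : (((n + 1 : ℕ) : ℤ) - 1) = (n : ℤ) := by push_cast; ring
      have e2 : (((n + 1 : ℕ) : ℤ) + 1) = ((n + 1 + 1 : ℕ) : ℤ) := by push_cast; ring
      rw [e1, e2] at this
      have h3 : dt (u 0) (u ((n + 1 + 1 : ℕ) : ℤ)) =
        lam * dt (u 0) (u ((n + 1 : ℕ) : ℤ)) - dt (u 0) (u (n : ℤ)) := by linear_combination this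
      rw [h3]
      linear_combination (z ^ 2 + 1) * i2 - z ^ 2 * i1 + dt (u 0) (u ((n + 1 : ℕ) : ℤ)) * (z ^ 2 - 1) * z ^ (n + 1) * hlz
  by_cases hz1 : z ^ 2 = 1
  · have hform2 : ∀ n : ℕ, dt (u 0) (u n) * z = D * n * z ^ n ∧
        dt (u 0) (u (n + 1 : ℕ)) * z = D * (n + 1 : ℕ) * z ^ (n + 1) := by
      intro n
      induction n with
      | zero =>
        refine ⟨by simp [dt]; left; ring, ?_⟩
        simp [← hD]
      | succ n ih =>
        obtain ⟨i1, i2⟩ := ih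
        refine ⟨i2, ?_⟩
        have := hrecd ((n + 1 : ℕ) : ℤ)
        have e1 : (((n + 1 : ℕ) : ℤ) - 1) = (n : ℤ) := by push_cast; ring
        have e2 : (((n + 1 : ℕ) : ℤ) + 1) = ((n + 1 + 1 : ℕ) : ℤ) := by push_cast; ring
        rw [e1, e2] at this
        have h3 : dt (u 0) (u ((n + 1 + 1 : ℕ) : ℤ)) =
          lam * dt (u 0) (u ((n + 1 : ℕ) : ℤ)) - dt (u 0) (u (n : ℤ)) := by linear_combination this
        have hl : lam = 2 * z := by
          apply mul_right_cancel₀ hz0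
          linear_combination hlz - hz1
        rw [h3, hl]
        push_cast at i2 ⊢
        linear_combination 2 * z * i2 - i1 + D * n * z ^ n * hz1
    have := (hform2 m).1
    rw [hzero, zero_mul] at this
    have hm0 : (m : ℂ) ≠ 0 := by exact_mod_cast (by omega : m ≠ 0)
    exact mul_ne_zero (mul_ne_zero hD0 hm0) (pow_ne_zero _ hz0) this.symm
  · have hz1' : z ^ 2 - 1 ≠ 0 := sub_ne_zero.2 hz1
    refine root_order m hm h6 (z ^ 2) ?_ ?_ (q - 2) ?_
    · have := (hform m).1
      rw [hzero, zero_mul, zero_mul] at this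
      rcases mul_eq_zero.1 this.symm with h | h
      · exact absurd h (mul_ne_zero hD0 hz0)
      · linear_combination h
    · intro k hk1 hk2 hk
      have := (hform k).1
      rw [hk, sub_self, mul_zero] at this
      exact mul_ne_zero (mul_ne_zero (hne k (by omega) (by omega)) hz1') (pow_ne_zero _ hz0) this
    · push_cast
      rw [← hq]
      linear_combination (z^2 + 1 + lam * z) * hz

def Wsub (m : ℕ) (s : ℤ → ℚ × ℚ) : Submodule ℂ (ℤ → ℂ × ℂ) where
  carrier := {u | (∀ k, u (k + 2 * m) = u k) ∧ ∀ r i : ℤ,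
    ((s r).1 : ℂ) * ((u (r - i)).2 + (u (r + i)).2) - ((s r).2 : ℂ) * ((u (r - i)).1 + (u (r + i)).1) = 0}
  zero_mem' := by simp
  add_mem' := by
    rintro a b ⟨ha, ha'⟩ ⟨hb, hb'⟩
    refine ⟨fun k => by simp [ha, hb], fun r i => ?_⟩
    simp only [Pi.add_apply, Prod.fst_add, Prod.snd_add]
    linear_combination ha' r i + hb' r i
  smul_mem' := by
    rintro c a ⟨ha, ha'⟩
    refine ⟨fun k => by simp [ha], fun r i => ?_⟩
    simp only [Pi.smul_apply, Prod.smul_fst, Prod.smul_snd, smul_eq_mul]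
    linear_combination c * ha' r i

def Nop : (ℤ → ℂ × ℂ) →ₗ[ℂ] (ℤ → ℂ × ℂ) where
  toFun u := fun k => u (k - 1) + u (k + 1)
  map_add' a b := by funext k; simp only [Pi.add_apply]; abel
  map_smul' c a := by funext k; simp

lemma Nop_mem (m : ℕ) (s : ℤ → ℚ × ℚ) : ∀ u ∈ Wsub m s, Nop u ∈ Wsub m s := by
  rintro u ⟨h1, h2⟩
  refine ⟨fun k => ?_, fun r i => ?_⟩
  · change u (k + 2 * m - 1) + u (k + 2 * m + 1) = u (k - 1) + u (k + 1)
    rw [← h1 (k - 1), ← h1 (k + 1)]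
    congr 2 <;> ring
  · have a := h2 r (i + 1)
    have b := h2 r (i - 1)
    change ((s r).1 : ℂ) * ((u (r - i - 1) + u (r - i + 1)).2 + (u (r + i - 1) + u (r + i + 1)).2)
      - ((s r).2 : ℂ) * ((u (r - i - 1) + u (r - i + 1)).1 + (u (r + i - 1) + u (r + i + 1)).1) = 0
    rw [show r - (i + 1) = r - i - 1 by ring, show r + (i + 1) = r + i + 1 by ring] at a
    rw [show r - (i - 1) = r - i + 1 by ring, show r + (i - 1) = r + i - 1 by ring] at b
    simp only [Prod.fst_add, Prod.snd_add]
    linear_combination a + b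

lemma per_mod {α : Type*} (n : ℕ) (u : ℤ → α) (h : ∀ k, u (k + n) = u k) (k : ℤ) :
    u k = u (k % n) := by
  have : Function.Periodic u (n : ℤ) := h
  have h2 := this.int_mul (k / n) (k % n)
  rw [← h2]
  congr 1
  rw [mul_comm]
  exact (Int.emod_add_mul_ediv k n).symm

lemma no_u (m : ℕ) (hm : 5 ≤ m) (h6 : m ≠ 6) (s : ℤ → ℚ × ℚ)
    (hanti : ∀ k, s (k + m) = -s k)
    (hdet : ∀ k l : ℤ, k < l → l < k + m → dt (s k) (s l) ≠ 0)
    (u : ℤ → ℚ × ℚ) (hper : ∀ k, u (k + 2 * m) = u k) (hu : u ≠ 0)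
    (hpar : ∀ r i : ℤ, dt (s r) (u (r - i) + u (r + i)) = 0) : False := by
  have hfin : FiniteDimensional ℂ (Wsub m s) := by
    let φ : Wsub m s →ₗ[ℂ] (Fin (2 * m) → ℂ × ℂ) :=
      { toFun := fun w j => w.1 (j : ℕ)
        map_add' := fun a b => rfl
        map_smul' := fun a b => rfl }
    refine FiniteDimensional.of_injective φ ?_
    intro a b hab
    ext1
    funext k
    have ha : ∀ k, a.1 (k + ((2 * m : ℕ) : ℤ)) = a.1 k := by
      intro k; rw [← a.2.1 k]; push_cast; rfl
    have hb : ∀ k, b.1 (k + ((2 * m : ℕ) : ℤ)) = b.1 k := by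
      intro k; rw [← b.2.1 k]; push_cast; rfl
    rw [per_mod (2 * m) a.1 ha k, per_mod (2 * m) b.1 hb k]
    have h1 : 0 ≤ k % ((2 * m : ℕ) : ℤ) := Int.emod_nonneg _ (by omega)
    have h2 : k % ((2 * m : ℕ) : ℤ) < ((2 * m : ℕ) : ℤ) := Int.emod_lt_of_pos _ (by omega)
    have := congrFun hab ⟨(k % ((2 * m : ℕ) : ℤ)).toNat, by omega⟩
    change a.1 (((k % ((2 * m : ℕ) : ℤ)).toNat : ℕ) : ℤ) = b.1 (((k % ((2 * m : ℕ) : ℤ)).toNat : ℕ) : ℤ) at this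
    rwa [Int.toNat_of_nonneg h1] at this
  let w : ℤ → ℂ × ℂ := fun k => (((u k).1 : ℂ), ((u k).2 : ℂ))
  have hw : w ∈ Wsub m s := by
    refine ⟨fun k => by simp only [w, hper], fun r i => ?_⟩
    have := hpar r i
    simp only [dt, Prod.fst_add, Prod.snd_add] at this
    simp only [w]
    exact_mod_cast this
  have hw0 : (⟨w, hw⟩ : Wsub m s) ≠ 0 := by
    intro h0
    apply hu
    have h1 : w = 0 := congrArg Subtype.val h0
    funext k
    have h2 : w k = 0 := congrFun h1 k
    have h3 : ((u k).1 : ℂ) = 0 := congrArg Prod.fst h2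
    have h4 : ((u k).2 : ℂ) = 0 := congrArg Prod.snd h2
    exact Prod.ext (by exact_mod_cast h3) (by exact_mod_cast h4)
  have : Nontrivial (Wsub m s) := ⟨⟨_, _, hw0⟩⟩
  obtain ⟨lam, hl⟩ := Module.End.exists_eigenvalue (Nop.restrict (Nop_mem m s))
  obtain ⟨x, hx⟩ := hl.exists_hasEigenvector
  have hx0 := hx.2
  have hxe := hx.apply_eq_smul
  refine eig_final m hm h6 s hanti hdet x.1 lam (fun k => ?_) (fun h => hx0 (Subtype.ext h)) (fun k => ?_)
  · exact congrFun (congrArg Subtype.val hxe) k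
  · have := x.2.2 k 0
    rw [sub_zero, add_zero] at this
    linear_combination this / 2

lemma dt_sub_left (a b c : ℚ × ℚ) : dt (a - b) c = dt a c - dt b c := by
  simp only [dt, Prod.fst_sub, Prod.snd_sub]; ring

lemma dt_add_left (a b c : ℚ × ℚ) : dt (a + b) c = dt a c + dt b c := by
  simp only [dt, Prod.fst_add, Prod.snd_add]; ring

lemma dt_smul_left (t : ℚ) (a c : ℚ × ℚ) : dt (t • a) c = t * dt a c := by
  simp only [dt, Prod.smul_fst, Prod.smul_snd, smul_eq_mul]; ring

lemma dt_neg_left (a c : ℚ × ℚ) : dt (-a) c = - dt a c := by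
  simp only [dt, Prod.fst_neg, Prod.snd_neg]; ring

lemma dt_swap (a c : ℚ × ℚ) : dt a c = - dt c a := by
  simp only [dt]; ring

lemma dt_self (a : ℚ × ℚ) : dt a a = 0 := by
  simp only [dt]; ring

set_option maxHeartbeats 1000000 in
lemma core {X : Type*} [Fintype X] (m : ℕ) (hm : 5 ≤ m) (h6 : m ≠ 6) (s : ℤ → ℚ × ℚ)
    (hanti : ∀ k, s (k + m) = -s k)
    (hdet : ∀ k l : ℤ, k < l → l < k + m → 0 < dt (s k) (s l))
    (col : X → Bool) (pos : X → ℚ × ℚ)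
    (F1 : ∀ (r : ℤ) (x : X), ∃ y, col y ≠ col x ∧ dt (pos y) (s r) = dt (pos x) (s r))
    (F2 : ∀ (r : ℤ) (x y : X), col x = col y → dt (pos x) (s r) = dt (pos y) (s r) → x = y)
    (F3 : ∀ x y, col x ≠ col y → ∃ (k : ℤ) (c : ℚ), 0 < c ∧ pos x - pos y = c • s k)
    (hcard : (Finset.univ.filter (fun x => col x = true)).card = m) : False := by
  have hper : ∀ k, s (k + ((2 * m : ℕ) : ℤ)) = s k := by
    intro k
    have : k + ((2 * m : ℕ) : ℤ) = (k + m) + m := by push_cast; ring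
    rw [this, hanti, hanti, neg_neg]
  have hwin : ∀ r k : ℤ, ∃ k', s k' = s k ∧ r ≤ k' ∧ k' < r + 2 * m := by
    intro r k
    have h1 : 0 ≤ (k - r) % ((2 * m : ℕ) : ℤ) := Int.emod_nonneg _ (by omega)
    have h2 : (k - r) % ((2 * m : ℕ) : ℤ) < ((2 * m : ℕ) : ℤ) := Int.emod_lt_of_pos _ (by omega)
    refine ⟨r + (k - r) % ((2 * m : ℕ) : ℤ), ?_, by omega, by push_cast at h2 ⊢; omega⟩
    have := per_mod (2 * m) (fun j => s (r + j)) (fun j => by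
      simp only [← add_assoc]; exact hper _) (k - r)
    rw [← this]; congr 1; ring
  have hneg : ∀ k l : ℤ, k + m < l → l < k + 2 * m → dt (s k) (s l) < 0 := by
    intro k l h1 h2
    have := hdet k (l - m) (by omega) (by omega)
    have e := hanti (l - m)
    rw [sub_add_cancel] at e
    rw [e, dt_swap, dt_neg_left, dt_swap]
    linarith
  have hs0 : ∀ k, s k ≠ 0 := by
    intro k hk
    have := hdet k (k + 1) (by omega) (by omega)
    rw [hk] at this
    simp [dt] at this
  have hne : Nonempty X := by
    have : 0 < (Finset.univ.filter (fun x => col x = true)).card := by omega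
    obtain ⟨x, -⟩ := Finset.card_pos.1 this
    exact ⟨x⟩
  have L1 : ∀ r : ℤ, ∃ (p q : X) (c : ℚ), 0 < c ∧ col p ≠ col q ∧ pos p - pos q = c • s r ∧
      ∀ x, dt (pos x) (s r) ≤ dt (pos p) (s r) := by
    intro r
    obtain ⟨x, hx⟩ := Finite.exists_max (fun x => dt (pos x) (s r))
    obtain ⟨y, hy1, hy2⟩ := F1 r x
    obtain ⟨k, c, hc, hk⟩ := F3 x y (Ne.symm hy1)
    obtain ⟨k', e, h1, h2⟩ := hwin r k
    rw [← e] at hk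
    have h0 : c * dt (s k') (s r) = 0 := by
      rw [← dt_smul_left, ← hk, dt_sub_left, hy2, sub_self]
    have h0' : dt (s r) (s k') = 0 := by
      rw [dt_swap, (mul_eq_zero.1 h0).resolve_left hc.ne', neg_zero]
    have hk' : k' = r ∨ k' = r + m := by
      by_contra! hcon
      rcases lt_or_ge k' (r + m) with h | h
      · have := hdet r k' (by omega) h
        linarith
      · have := hneg r k' (by omega) h2
        linarith
    rcases hk' with rfl | rfl
    · exact ⟨x, y, c, hc, Ne.symm hy1, hk, hx⟩
    · refine ⟨y, x, c, hc, hy1, ?_, fun z => by rw [hy2]; exact hx z⟩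
      rw [hanti] at hk
      rw [← neg_sub, hk, smul_neg, neg_neg]
  choose p' q' c' hc' hpq' hdif' hmax' using L1
  let M : ℤ := ((2 * m : ℕ) : ℤ)
  let p : ℤ → X := fun r => p' (r % M)
  let q : ℤ → X := fun r => q' (r % M)
  let c : ℤ → ℚ := fun r => c' (r % M)
  have hsM : ∀ r, s r = s (r % M) := fun r => per_mod (2 * m) s hper r
  have hc : ∀ r, 0 < c r := fun r => hc' _
  have hpq : ∀ r, col (p r) ≠ col (q r) := fun r => hpq' _
  have hdif : ∀ r, pos (p r) - pos (q r) = c r • s r := fun r => by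
    rw [hsM r]; exact hdif' _
  have hmax : ∀ r x, dt (pos x) (s r) ≤ dt (pos (p r)) (s r) := fun r x => by
    rw [hsM r]; exact hmax' _ _
  have hpper : ∀ r, p (r + 2 * m) = p r := by
    intro r
    simp only [p, M]
    congr 1
    push_cast
    simp
  have hHpq : ∀ r, dt (pos (q r)) (s r) = dt (pos (p r)) (s r) := by
    intro r
    have : pos (q r) = pos (p r) - c r • s r := by rw [← hdif]; abel
    rw [this, dt_sub_left, dt_smul_left, dt_self]; ring
  have hbool : ∀ a b d : Bool, a ≠ b → d ≠ b → d = a := by decide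
  have hcs : ∀ (r : ℤ) (a b : ℚ), 0 < a → 0 < b → a • s r = -(b • s r) → False := by
    intro r a b ha hb h
    have : (a + b) • s r = 0 := by rw [add_smul, h]; simp
    rcases smul_eq_zero.1 this with h | h
    · linarith
    · exact hs0 r h
  have L2 : ∀ r, q (r + 1) = p r := by
    intro r
    obtain ⟨z, hz, hzc, hzH⟩ : ∃ z, (z = p (r + 1) ∨ z = q (r + 1)) ∧ col z ≠ col (p r) ∧
        dt (pos z) (s (r + 1)) = dt (pos (p (r + 1))) (s (r + 1)) := by
      by_cases h : col (p (r + 1)) = col (p r)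
      · exact ⟨q (r + 1), Or.inr rfl, by rw [← h]; exact (hpq _).symm, hHpq _⟩
      · exact ⟨p (r + 1), Or.inl rfl, h, rfl⟩
    obtain ⟨k, e, he, hk⟩ := F3 z (p r) hzc
    obtain ⟨k', ek, h1, h2⟩ := hwin r k
    rw [← ek] at hk
    have i1 : e * dt (s k') (s r) ≤ 0 := by
      rw [← dt_smul_left, ← hk, dt_sub_left]
      linarith [hmax r z]
    have i2 : 0 ≤ e * dt (s k') (s (r + 1)) := by
      rw [← dt_smul_left, ← hk, dt_sub_left, hzH]
      linarith [hmax (r + 1) (p r)]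
    have j1 : 0 ≤ dt (s r) (s k') := by
      rw [dt_swap]
      have := nonpos_of_mul_nonpos_right i1 he
      linarith
    have j2 : dt (s (r + 1)) (s k') ≤ 0 := by
      rw [dt_swap]
      have := nonneg_of_mul_nonneg_right i2 he
      linarith
    have hk' : k' = r ∨ k' = r + 1 := by
      by_contra! hcon
      rcases lt_or_ge (r + m) k' with h | h
      · have := hneg r k' h h2
        linarith
      · have := hdet (r + 1) k' (by omega) (by omega)
        linarith
    rcases hk' with hk' | hk' <;> rw [hk'] at hk
    · exfalso
      have hzq : z = q r := by
        refine F2 r _ _ (hbool _ _ _ (hpq r).symm hzc) ?_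
        have : pos z = pos (p r) + e • s r := by rw [← hk]; abel
        rw [this, dt_add_left, dt_smul_left, dt_self, hHpq]; ring
      subst hzq
      refine hcs r e (c r) he (hc r) ?_
      rw [← hk, ← hdif]; abel
    · have hpz : dt (pos (p r)) (s (r + 1)) = dt (pos z) (s (r + 1)) := by
        have : pos z = pos (p r) + e • s (r + 1) := by rw [← hk]; abel
        rw [this, dt_add_left, dt_smul_left, dt_self]; ring
      rcases hz with rfl | rfl
      · refine F2 (r + 1) _ _ (hbool _ _ _ (Ne.symm hzc) (hpq (r + 1)).symm) ?_
        rw [hHpq, hpz]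
      · exfalso
        have : p r = p (r + 1) := by
          refine F2 (r + 1) _ _ (hbool _ _ _ (hpq (r + 1)) hzc.symm) ?_
          rw [hpz, hHpq]
        refine hcs (r + 1) e (c (r + 1)) he (hc _) ?_
        rw [← hk, ← hdif, this]; abel
  let v : ℤ → ℚ × ℚ := fun r => pos (p r)
  have hv : ∀ r, v (r + 1) - v r = c (r + 1) • s (r + 1) := by
    intro r
    rw [← hdif, L2]
  -- level set
  have hlev : ∀ r : ℤ, ((Finset.univ.filter (fun x => col x = true)).image
      (fun x => - dt (pos x) (s r))).card = m := by
    intro r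
    rw [Finset.card_image_of_injOn, hcard]
    intro x hx y hy hxy
    simp at hx hy hxy
    exact F2 r x y (by rw [hx, hy]) hxy
  have hmem : ∀ (r : ℤ) x, - dt (pos x) (s r) ∈ ((Finset.univ.filter (fun x => col x = true)).image
      (fun x => - dt (pos x) (s r))) := by
    intro r x
    rw [Finset.mem_image]
    by_cases h : col x = true
    · exact ⟨x, by simp [h], rfl⟩
    · obtain ⟨y, hy, hy'⟩ := F1 r x
      refine ⟨y, ?_, by rw [hy']⟩
      simp only [Finset.mem_filter, Finset.mem_univ, true_and]
      revert h hy
      cases col x <;> cases col y <;> simp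
  have hstep : ∀ r k : ℤ, dt (v (k + 1)) (s r) - dt (v k) (s r) = c (k + 1) * dt (s (k + 1)) (s r) := by
    intro r k
    rw [← dt_sub_left, hv, dt_smul_left]
  have hsym : ∀ (r : ℤ) (i : ℕ), i < m → dt (v (r + i)) (s r) = dt (v (r - 1 - i)) (s r) := by
    intro r i hi
    obtain ⟨n, rfl⟩ : ∃ n, m = n + 1 := ⟨m - 1, by omega⟩
    have e1 := Finset.orderEmbOfFin_unique (hlev r)
      (f := fun i : Fin (n + 1) => - dt (v (r + (i : ℕ))) (s r)) (fun i => hmem r _) (by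
        rw [Fin.strictMono_iff_lt_succ]
        intro i
        have := hstep r (r + (i : ℕ))
        have h2 := hdet r (r + (i : ℕ) + 1) (by omega) (by have := i.2; push_cast; omega)
        have h3 := mul_pos (hc (r + (i : ℕ) + 1)) h2
        rw [dt_swap (s _) (s r)] at this
        simp only [Fin.val_castSucc, Fin.val_succ]
        push_cast
        rw [← add_assoc]
        linarith)
    have e2 := Finset.orderEmbOfFin_unique (hlev r)
      (f := fun i : Fin (n + 1) => - dt (v (r - 1 - (i : ℕ))) (s r)) (fun i => hmem r _) (by
        rw [Fin.strictMono_iff_lt_succ]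
        intro i
        have := hstep r (r - 1 - (i : ℕ) - 1)
        have h2 := hdet (r - 1 - (i : ℕ)) r (by omega) (by have := i.2; push_cast; omega)
        rw [sub_add_cancel] at this
        have h3 := mul_pos (hc (r - 1 - (i : ℕ))) h2
        simp only [Fin.val_castSucc, Fin.val_succ]
        push_cast
        rw [← sub_sub]
        linarith)
    have := congrFun (e1.trans e2.symm) ⟨i, hi⟩
    simpa using this
  -- the differences
  let u : ℤ → ℚ × ℚ := fun r => c r • s r
  have huv : ∀ r, u r = v r - v (r - 1) := by
    intro r
    have := hv (r - 1)
    rw [sub_add_cancel] at this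
    exact this.symm
  have huper : ∀ k, u (k + 2 * m) = u k := by
    intro k
    rw [huv, huv]
    simp only [v]
    rw [show k + 2 * (m : ℤ) - 1 = (k - 1) + 2 * m by ring, hpper, hpper]
  have hpar0 : ∀ (r : ℤ) (i : ℕ), i ≤ m → dt (u (r - i) + u (r + i)) (s r) = 0 := by
    intro r i hi
    rcases Nat.eq_zero_or_pos i with rfl | h0
    · simp only [u]
      simp [dt_add_left, dt_smul_left, dt_self]
    · rcases Nat.eq_or_lt_of_le hi with rfl | hlt
      · simp only [u]
        have e := hanti (r - i)
        rw [sub_add_cancel] at e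
        have e' : s (r - i) = - s r := by rw [e, neg_neg]
        rw [e', hanti]
        simp [dt_add_left, dt_neg_left, dt_smul_left, dt_self]
      · obtain ⟨j, rfl⟩ : ∃ j, i = j + 1 := ⟨i - 1, by omega⟩
        have a := hsym r (j + 1) hlt
        have b := hsym r j (by omega)
        rw [dt_add_left, huv, huv, dt_sub_left, dt_sub_left]
        push_cast at a b ⊢
        rw [show r - ((j : ℤ) + 1) = r - 1 - j by ring, show r + ((j : ℤ) + 1) - 1 = r + j by ring]
        rw [show r - 1 - ((j : ℤ) + 1) = r - 1 - j - 1 by ring] at a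
        linarith
  have hpar1 : ∀ (r : ℤ) (i : ℤ), -m ≤ i → i ≤ m → dt (u (r - i) + u (r + i)) (s r) = 0 := by
    intro r i h1 h2
    rcases le_total 0 i with h | h
    · have := hpar0 r i.toNat (by omega)
      rwa [Int.toNat_of_nonneg h] at this
    · have := hpar0 r (-i).toNat (by omega)
      rw [Int.toNat_of_nonneg (by omega), sub_neg_eq_add, ← sub_eq_add_neg, add_comm] at this
      exact this
  refine no_u m hm h6 s hanti (fun k l h1 h2 => (hdet k l h1 h2).ne') u huper ?_ ?_
  · intro h
    have : u 0 = 0 := congrFun h 0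
    rcases smul_eq_zero.1 this with h | h
    · exact (hc 0).ne' h
    · exact hs0 0 h
  · intro r i
    rw [dt_swap]
    let g : ℤ → ℚ := fun j => dt (u (r - j) + u (r + j)) (s r)
    have hg : ∀ j, g (j + ((2 * m : ℕ) : ℤ)) = g j := by
      intro j
      simp only [g]
      push_cast
      have := huper (r - (j + 2 * m))
      rw [show r - (j + 2 * (m : ℤ)) + 2 * m = r - j by ring] at this
      rw [← this, ← add_assoc, huper]
    have h1 := per_mod (2 * m) (fun j => g (j - m)) (fun j => by
      rw [← hg (j - m)]; congr 1; ring) (i + m)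
    simp only [add_sub_cancel_right] at h1
    have b1 : 0 ≤ (i + m) % ((2 * m : ℕ) : ℤ) := Int.emod_nonneg _ (by omega)
    have b2 : (i + m) % ((2 * m : ℕ) : ℤ) < ((2 * m : ℕ) : ℤ) := Int.emod_lt_of_pos _ (by omega)
    have : g i = 0 := by
      rw [h1]
      exact hpar1 r _ (by omega) (by push_cast at b2 ⊢; omega)
    rw [show dt (u (r - i) + u (r + i)) (s r) = g i from rfl, this, neg_zero]

/-- `p - q` is a nonzero multiple of `(1, σ)`. -/
def SlopeRel (σ : ℚ) (p q : ℚ × ℚ) : Prop := ∃ t : ℚ, t ≠ 0 ∧ p - q = t • ((1 : ℚ), σ)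

lemma SlopeRel.symm {σ : ℚ} {p q : ℚ × ℚ} (h : SlopeRel σ p q) : SlopeRel σ q p := by
  obtain ⟨t, ht, h⟩ := h
  exact ⟨-t, neg_ne_zero.2 ht, by rw [neg_smul, ← h]; abel⟩

lemma SlopeRel.dt_eq {σ : ℚ} {p q : ℚ × ℚ} (h : SlopeRel σ p q) : dt p (1, σ) = dt q (1, σ) := by
  obtain ⟨t, ht, h⟩ := h
  have : dt (p - q) (1, σ) = 0 := by rw [h, dt_smul_left, dt_self, mul_zero]
  rw [dt_sub_left] at this
  linarith

lemma SlopeRel.of_dt {σ σ' : ℚ} {p q : ℚ × ℚ} (h : SlopeRel σ' p q) (h2 : dt p (1, σ) = dt q (1, σ)) :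
    σ' = σ := by
  obtain ⟨t, ht, h⟩ := h
  have : dt (p - q) (1, σ) = 0 := by rw [dt_sub_left, h2, sub_self]
  rw [h, dt_smul_left] at this
  have := (mul_eq_zero.1 this).resolve_left ht
  simp [dt] at this
  linarith

lemma core2 {V : Type*} (m : ℕ) (hm : 5 ≤ m) (h6 : m ≠ 6) (A B : Finset V)
    (sl : Finset ℚ) (hsl : sl.card = m) (hA : A.card = m) (pos : V → ℚ × ℚ)
    (H1 : ∀ a ∈ A, ∀ σ ∈ sl, ∃ b ∈ B, SlopeRel σ (pos a) (pos b))
    (H2 : ∀ b ∈ B, ∀ σ ∈ sl, ∃ a ∈ A, SlopeRel σ (pos a) (pos b))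
    (H3 : ∀ a ∈ A, ∀ b ∈ B, ∃ σ ∈ sl, SlopeRel σ (pos a) (pos b))
    (H4 : ∀ a ∈ A, ∀ a' ∈ A, ∀ b ∈ B, ∀ σ ∈ sl, SlopeRel σ (pos a) (pos b) → SlopeRel σ (pos a') (pos b) → a = a')
    (H5 : ∀ b ∈ B, ∀ b' ∈ B, ∀ a ∈ A, ∀ σ ∈ sl, SlopeRel σ (pos a) (pos b) → SlopeRel σ (pos a) (pos b') → b = b') :
    False := by
  have hm0 : (0 : ℤ) < m := by omega
  have hlt : ∀ k : ℤ, (k % m).toNat < m := by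
    intro k
    have := Int.emod_lt_of_pos k hm0
    have := Int.emod_nonneg k hm0.ne'
    omega
  let o := sl.orderEmbOfFin hsl
  let τ : ℤ → ℚ := fun k => o ⟨(k % m).toNat, hlt k⟩
  have hτmem : ∀ k, τ k ∈ sl := fun k => Finset.orderEmbOfFin_mem _ _ _
  let ep : ℤ → ℚ := fun k => if Even (k / m) then 1 else -1
  have hep : ∀ k, ep k ≠ 0 := by
    intro k; simp only [ep]; split_ifs <;> norm_num
  have hτper : ∀ k, τ (k + m) = τ k := by
    intro k; simp only [τ]; congr 3; simp
  have hepm : ∀ k, ep (k + m) = - ep k := by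
    intro k
    simp only [ep]
    rw [Int.add_ediv_of_dvd_right (dvd_refl _), Int.ediv_self hm0.ne']
    by_cases h : Even (k / m)
    · have : ¬ Even (k / m + 1) := by rw [Int.even_add_one]; simpa using h
      simp [h, this]
    · have : Even (k / m + 1) := by rw [Int.even_add_one]; exact h
      simp [h, this]
  let s : ℤ → ℚ × ℚ := fun k => ep k • ((1 : ℚ), τ k)
  have hanti : ∀ k, s (k + m) = - s k := by
    intro k; simp only [s]; rw [hepm, hτper, neg_smul]
  have hdets : ∀ k l, dt (s k) (s l) = ep k * ep l * (τ l - τ k) := by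
    intro k l; simp [s, dt]; ring
  have hdet : ∀ k l : ℤ, k < l → l < k + m → 0 < dt (s k) (s l) := by
    intro k l h1 h2
    rw [hdets]
    have d1 := Int.mul_ediv_add_emod k m
    have d2 := Int.mul_ediv_add_emod l m
    have k1 := Int.emod_lt_of_pos k hm0
    have k2 := Int.emod_nonneg k hm0.ne'
    have l1 := Int.emod_lt_of_pos l hm0
    have l2 := Int.emod_nonneg l hm0.ne'
    have hq : l / m = k / m ∨ l / m = k / m + 1 := by
      have a1 : k / m ≤ l / m := Int.ediv_le_ediv hm0 h1.le
      have a2 : l / m ≤ (k + m) / m := Int.ediv_le_ediv hm0 h2.le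
      rw [Int.add_ediv_of_dvd_right (dvd_refl _), Int.ediv_self hm0.ne'] at a2
      omega
    rcases hq with hq | hq
    · have e : ep l = ep k := by simp only [ep, hq]
      rw [hq] at d2
      have : τ k < τ l := by
        apply o.strictMono
        rw [Fin.mk_lt_mk]; omega
      rw [e]
      exact mul_pos (mul_self_pos.2 (hep k)) (by linarith)
    · have e : ep l = - ep k := by
        rw [← hepm]; simp only [ep, hq]
        rw [Int.add_ediv_of_dvd_right (dvd_refl _), Int.ediv_self hm0.ne']
      rw [hq, mul_add, mul_one] at d2
      have : τ l < τ k := by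
        apply o.strictMono
        rw [Fin.mk_lt_mk]; omega
      rw [e]
      have := mul_pos (mul_self_pos.2 (hep k)) (by linarith : 0 < τ k - τ l)
      linarith
  have hsurj : ∀ σ ∈ sl, ∃ k, s k = (1, σ) := by
    intro σ hσ
    have : σ ∈ Set.range o := by rw [Finset.range_orderEmbOfFin]; exact hσ
    obtain ⟨j, hj⟩ := this
    refine ⟨(j : ℕ), ?_⟩
    have hj' : ((j : ℕ) : ℤ) < m := by exact_mod_cast j.2
    have h1 : (((j : ℕ) : ℤ) / m) = 0 := Int.ediv_eq_zero_of_lt (by omega) hj'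
    have h2 : (((j : ℕ) : ℤ) % m) = (j : ℕ) := Int.emod_eq_of_lt (by omega) hj'
    have h3 : ep ((j : ℕ) : ℤ) = 1 := by simp only [ep, h1]; simp
    have h4 : τ ((j : ℕ) : ℤ) = σ := by
      rw [← hj]; simp only [τ]; congr 1; ext; simp [h2]
    simp only [s]
    rw [h3, h4, one_smul]
  have hdts : ∀ x r, dt x (s r) = ep r * dt x (1, τ r) := by
    intro x r; simp [s, dt]; ring
  have hdtiff : ∀ x y r, dt x (s r) = dt y (s r) ↔ dt x (1, τ r) = dt y (1, τ r) := by
    intro x y r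
    rw [hdts, hdts]
    exact ⟨fun h => mul_left_cancel₀ (hep r) h, fun h => by rw [h]⟩
  have hF3 : ∀ (p q : ℚ × ℚ) (σ : ℚ), σ ∈ sl → SlopeRel σ p q → ∃ (k : ℤ) (c : ℚ), 0 < c ∧ p - q = c • s k := by
    rintro p q σ hσ ⟨t, ht, h⟩
    obtain ⟨k, hk⟩ := hsurj σ hσ
    rcases lt_or_gt_of_ne ht with h0 | h0
    · refine ⟨k + m, -t, by linarith, ?_⟩
      rw [hanti, hk, h, smul_neg, neg_smul, neg_neg]
    · exact ⟨k, t, h0, by rw [h, hk]⟩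
  refine core (X := {a // a ∈ A} ⊕ {b // b ∈ B}) m hm h6 s hanti hdet Sum.isLeft
    (Sum.elim (fun a => pos a.1) (fun b => pos b.1)) ?_ ?_ ?_ ?_
  · rintro r (⟨a, ha⟩ | ⟨b, hb⟩)
    · obtain ⟨b, hb, h⟩ := H1 a ha (τ r) (hτmem r)
      exact ⟨Sum.inr ⟨b, hb⟩, by simp, (hdtiff _ _ _).2 h.dt_eq.symm⟩
    · obtain ⟨a, ha, h⟩ := H2 b hb (τ r) (hτmem r)
      exact ⟨Sum.inl ⟨a, ha⟩, by simp, (hdtiff _ _ _).2 h.dt_eq⟩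
  · rintro r (⟨a, ha⟩ | ⟨b, hb⟩) (⟨a', ha'⟩ | ⟨b', hb'⟩) hcol hd
    · rw [hdtiff] at hd
      simp only [Sum.elim_inl] at hd
      obtain ⟨b, hb, h⟩ := H1 a ha (τ r) (hτmem r)
      obtain ⟨σ, hσ, h'⟩ := H3 a' ha' b hb
      have := h'.of_dt (hd.symm.trans h.dt_eq)
      subst this
      have := H4 a ha a' ha' b hb _ hσ h h'
      subst this; rfl
    · simp at hcol
    · simp at hcol
    · rw [hdtiff] at hd
      simp only [Sum.elim_inr] at hd
      obtain ⟨a, ha, h⟩ := H2 b hb (τ r) (hτmem r)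
      obtain ⟨σ, hσ, h'⟩ := H3 a ha b' hb'
      have := h'.of_dt (h.dt_eq.trans hd)
      subst this
      have := H5 b hb b' hb' a ha _ hσ h h'
      subst this; rfl
  · rintro (⟨a, ha⟩ | ⟨b, hb⟩) (⟨a', ha'⟩ | ⟨b', hb'⟩) hcol
    · simp at hcol
    · obtain ⟨σ, hσ, h⟩ := H3 a ha b' hb'
      exact hF3 _ _ σ hσ h
    · obtain ⟨σ, hσ, h⟩ := H3 a' ha' b hb
      exact hF3 _ _ σ hσ h.symm
    · simp at hcol
  · rw [← hA]
    have : (Finset.univ.filter (fun x : {a // a ∈ A} ⊕ {b // b ∈ B} => x.isLeft = true))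
        = (Finset.univ : Finset {a // a ∈ A}).map ⟨Sum.inl, Sum.inl_injective⟩ := by
      ext x
      rcases x with x | x <;> simp
    rw [this, Finset.card_map]
    simp

lemma exists_functional {d : ℕ} (T : Finset (Fin d → ℤ)) (hT : (0 : Fin d → ℤ) ∉ T) :
    ∃ f : Fin d → ℤ, ∀ x ∈ T, f ⬝ᵥ x ≠ 0 := by
  let P : (Fin d → ℤ) → Polynomial ℤ := fun x => ∑ i : Fin d, Polynomial.monomial (i : ℕ) (x i)
  have hP : ∀ x ∈ T, P x ≠ 0 := by
    intro x hx h0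
    apply hT
    have : x = 0 := by
      funext i
      have := congrArg (fun p => Polynomial.coeff p (i : ℕ)) h0
      simp only [P, Polynomial.finsetSum_coeff, Polynomial.coeff_monomial, Polynomial.coeff_zero] at this
      rw [Finset.sum_eq_single i] at this
      · simpa using this
      · intro j _ hj
        rw [if_neg]
        exact fun h => hj (Fin.ext h)
      · simp
    rwa [← this]
  have hprod : ∏ x ∈ T, P x ≠ 0 := Finset.prod_ne_zero_iff.2 hP
  obtain ⟨t, ht⟩ : ∃ t : ℤ, (∏ x ∈ T, P x).eval t ≠ 0 := by
    by_contra! hc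
    exact hprod (Polynomial.funext (by simpa using hc))
  refine ⟨fun i => t ^ (i : ℕ), fun x hx h0 => ?_⟩
  rw [Polynomial.eval_prod, Finset.prod_ne_zero_iff] at ht
  apply ht x hx
  rw [← h0]
  simp only [P, Polynomial.eval_finsetSum, Polynomial.eval_monomial, dotProduct]
  exact Finset.sum_congr rfl (fun i _ => mul_comm _ _)

lemma step0 {d : ℕ} (S : Submodule ℝ (Fin d → ℝ)) (F₁ F₂ : Finset (Fin d → ℤ))
    (h : XrayEq S (embed '' ↑F₁) (embed '' ↑F₂)) (x : Fin d → ℤ) (hx : x ∈ F₁) (hx2 : x ∉ F₂) :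
    ∃ y ∈ F₂, y ∉ F₁ ∧ embed x - embed y ∈ S := by
  by_contra! hc
  have hinj : Function.Injective (embed : (Fin d → ℤ) → (Fin d → ℝ)) := by
    intro a b hab
    funext i
    have := congrFun hab i
    simpa [embed] using this
  have h1 := h (Submodule.Quotient.mk (embed x))
  have hlt : (embed '' (↑F₂ : Set (Fin d → ℤ)) ∩ fiber S (Submodule.Quotient.mk (embed x))).ncard <
      (embed '' (↑F₁ : Set (Fin d → ℤ)) ∩ fiber S (Submodule.Quotient.mk (embed x))).ncard := by
    apply Set.ncard_lt_ncard _ ((F₁.finite_toSet.image _).inter_of_left _)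
    refine ⟨?_, ?_⟩
    · rintro z ⟨⟨y, hy, rfl⟩, hz⟩
      refine ⟨⟨y, ?_, rfl⟩, hz⟩
      by_contra hy1
      apply hc y hy hy1
      exact (Submodule.Quotient.eq S).1 (Eq.symm hz)
    · intro hsub
      obtain ⟨⟨y, hy, hyx⟩, -⟩ := hsub (show embed x ∈ _ from ⟨⟨x, hx, rfl⟩, rfl⟩)
      rw [hinj hyx] at hy
      exact hx2 hy
  omega

lemma line_unique {d : ℕ} {S S' : Submodule ℝ (Fin d → ℝ)} (hS : IsLatticeLine S)
    (hS' : IsLatticeLine S') {e : Fin d → ℝ} (he : e ≠ 0) (h : e ∈ S) (h' : e ∈ S') : S = S' := by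
  have key : ∀ S : Submodule ℝ (Fin d → ℝ), IsLatticeLine S → e ∈ S → S = Submodule.span ℝ {e} := by
    rintro S ⟨w, -, rfl⟩ h
    obtain ⟨c, rfl⟩ := Submodule.mem_span_singleton.1 h
    have hc : c ≠ 0 := by rintro rfl; simp at he
    exact (Submodule.span_singleton_smul_eq (IsUnit.mk0 c hc) _).symm
  rw [key S hS h, key S' hS' h']

lemma half {d : ℕ} (𝓛 : Finset (Submodule ℝ (Fin d → ℝ))) (h𝓛 : ∀ S ∈ 𝓛, IsLatticeLine S)
    (A : Finset (Fin d → ℤ)) (hA : A.card ≤ 𝓛.card) (b : Fin d → ℤ)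
    (hne : ∀ a ∈ A, embed a - embed b ≠ 0)
    (h : ∀ S ∈ 𝓛, ∃ a ∈ A, embed a - embed b ∈ S) :
    A.card = 𝓛.card ∧ (∀ a ∈ A, ∃ S ∈ 𝓛, embed a - embed b ∈ S) ∧
    ∀ a ∈ A, ∀ a' ∈ A, ∀ S ∈ 𝓛, embed a - embed b ∈ S → embed a' - embed b ∈ S → a = a' := by
  have h' : ∀ S : 𝓛, ∃ a : A, embed a.1 - embed b ∈ S.1 := by
    rintro ⟨S, hS⟩
    obtain ⟨a, ha, h1⟩ := h S hS
    exact ⟨⟨a, ha⟩, h1⟩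
  choose φ hφ using h'
  have hinj : Function.Injective φ := by
    intro S S' hSS
    apply Subtype.ext
    refine line_unique (h𝓛 _ S.2) (h𝓛 _ S'.2) (hne _ (φ S).2) (hφ S) ?_
    rw [hSS]; exact hφ S'
  have hle := Fintype.card_le_of_injective φ hinj
  simp only [Fintype.card_coe] at hle
  have hcard : A.card = 𝓛.card := le_antisymm hA hle
  have hbij : Function.Bijective φ := by
    rw [Fintype.bijective_iff_injective_and_card]
    exact ⟨hinj, by simp [hcard]⟩
  refine ⟨hcard, fun a ha => ?_, fun a ha a' ha' S hS h1 h2 => ?_⟩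
  · obtain ⟨S, hS⟩ := hbij.2 ⟨a, ha⟩
    refine ⟨S.1, S.2, ?_⟩
    have := hφ S
    rwa [hS] at this
  · have key : ∀ a (ha : a ∈ A), embed a - embed b ∈ S → φ ⟨S, hS⟩ = ⟨a, ha⟩ := by
      intro a ha h1
      obtain ⟨S', hS'⟩ := hbij.2 ⟨a, ha⟩
      have h3 := hφ S'
      rw [hS'] at h3
      have : S' = ⟨S, hS⟩ := Subtype.ext (line_unique (h𝓛 _ S'.2) (h𝓛 _ hS) (hne a ha) h3 h1)
      rw [← this, hS']
    have := (key a ha h1).symm.trans (key a' ha' h2)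
    exact congrArg Subtype.val this

theorem renyi_improvement_lattice_case
    (d m : ℕ) (hd : 2 ≤ d) (hm : m ∉ ({1, 2, 3, 4, 6} : Set ℕ))
    (𝓛 : Finset (Submodule ℝ (Fin d → ℝ))) (h𝓛 : ∀ S ∈ 𝓛, IsLatticeLine S)
    (hcard : m ≤ 𝓛.card)
    (F₁ F₂ : Finset (Fin d → ℤ)) (h₁ : F₁.card ≤ m) (h₂ : F₂.card ≤ m)
    (h : TomEq (↑𝓛 : Set (Submodule ℝ (Fin d → ℝ))) (embed '' ↑F₁) (embed '' ↑F₂)) :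
    F₁ = F₂ := by
  classical
  rcases Nat.eq_zero_or_pos m with rfl | hmpos
  · rw [Finset.card_eq_zero.1 (Nat.le_zero.1 h₁), Finset.card_eq_zero.1 (Nat.le_zero.1 h₂)]
  simp only [Set.mem_insert_iff, Set.mem_singleton_iff, not_or] at hm
  have hm5 : 5 ≤ m := by omega
  by_contra hFF
  have hinj : Function.Injective (embed : (Fin d → ℤ) → (Fin d → ℝ)) := by
    intro a b hab
    funext i
    have := congrFun hab i
    simpa [embed] using this
  set A := F₁ \ F₂ with hAdef
  set B := F₂ \ F₁ with hBdef
  have S1 : ∀ a ∈ A, ∀ S ∈ 𝓛, ∃ b ∈ B, embed b - embed a ∈ S := by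
    intro a ha S hS
    rw [hAdef, Finset.mem_sdiff] at ha
    obtain ⟨y, hy, hy1, hy2⟩ := step0 S F₁ F₂ (h S hS) a ha.1 ha.2
    exact ⟨y, Finset.mem_sdiff.2 ⟨hy, hy1⟩, by rw [← neg_sub]; exact S.neg_mem hy2⟩
  have S2 : ∀ b ∈ B, ∀ S ∈ 𝓛, ∃ a ∈ A, embed a - embed b ∈ S := by
    intro a ha S hS
    rw [hBdef, Finset.mem_sdiff] at ha
    obtain ⟨y, hy, hy1, hy2⟩ := step0 S F₂ F₁ (fun T => (h S hS T).symm) a ha.1 ha.2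
    exact ⟨y, Finset.mem_sdiff.2 ⟨hy, hy1⟩, by rw [← neg_sub]; exact S.neg_mem hy2⟩
  have hne : ∀ a ∈ A, ∀ b ∈ B, a ≠ b := by
    rintro a ha b hb rfl
    exact (Finset.mem_sdiff.1 ha).2 (Finset.mem_sdiff.1 hb).1
  have hAle : A.card ≤ 𝓛.card := ((Finset.card_le_card Finset.sdiff_subset).trans h₁).trans hcard
  have hBle : B.card ≤ 𝓛.card := ((Finset.card_le_card Finset.sdiff_subset).trans h₂).trans hcard
  obtain ⟨S₀, hS₀⟩ : ∃ S, S ∈ 𝓛 := Finset.card_pos.1 (by omega)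
  have hBne : ∃ b, b ∈ B := by
    by_contra! hB
    have hA : ∀ a, a ∉ A := by
      intro a ha
      obtain ⟨b, hb, -⟩ := S1 a ha S₀ hS₀
      exact hB b hb
    apply hFF
    ext x
    have h1 := hA x
    have h2 := hB x
    simp only [hAdef, hBdef, Finset.mem_sdiff] at h1 h2
    tauto
  obtain ⟨b₀, hb₀⟩ := hBne
  have G1 : ∀ b ∈ B, _ := fun b hb => half 𝓛 h𝓛 A hAle b
    (fun a ha h0 => hne a ha b hb (hinj (sub_eq_zero.1 h0))) (S2 b hb)
  have G2 : ∀ a ∈ A, _ := fun a ha => half 𝓛 h𝓛 B hBle a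
    (fun b hb h0 => hne a ha b hb (hinj (sub_eq_zero.1 h0)).symm) (S1 a ha)
  have hAc : A.card = 𝓛.card := (G1 b₀ hb₀).1
  have hLm : 𝓛.card = m := le_antisymm
    (hAc ▸ (Finset.card_le_card Finset.sdiff_subset).trans h₁) hcard
  have hw : ∀ S, ∃ w : Fin d → ℤ, S ∈ 𝓛 → (w ≠ 0 ∧ S = Submodule.span ℝ {embed w}) := by
    intro S
    by_cases hS : S ∈ 𝓛
    · obtain ⟨w, h1, h2⟩ := h𝓛 S hS
      exact ⟨w, fun _ => ⟨h1, h2⟩⟩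
    · exact ⟨0, fun h => absurd h hS⟩
  choose w hw using hw
  obtain ⟨f, hf⟩ := exists_functional (𝓛.image w) (by
    intro h0
    obtain ⟨S, hS, h1⟩ := Finset.mem_image.1 h0
    exact (hw S hS).1 h1)
  have hf' : ∀ S ∈ 𝓛, f ⬝ᵥ w S ≠ 0 := fun S hS => hf _ (Finset.mem_image_of_mem _ hS)
  obtain ⟨g, hg⟩ := exists_functional (𝓛.offDiag.image
    (fun p => (f ⬝ᵥ w p.1) • w p.2 - (f ⬝ᵥ w p.2) • w p.1)) (by
    intro h0
    obtain ⟨⟨S, S'⟩, hSS, h1⟩ := Finset.mem_image.1 h0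
    rw [Finset.mem_offDiag] at hSS
    obtain ⟨hS, hS', hn⟩ := hSS
    simp only at hS hS' hn h1
    apply hn
    have e1 : ((f ⬝ᵥ w S : ℤ) : ℝ) • embed (w S') = ((f ⬝ᵥ w S' : ℤ) : ℝ) • embed (w S) := by
      funext i
      have := congrFun h1 i
      simp only [Pi.sub_apply, Pi.smul_apply, smul_eq_mul, Pi.zero_apply] at this
      simp only [Pi.smul_apply, smul_eq_mul, embed]
      have h2 : (f ⬝ᵥ w S) * w S' i = (f ⬝ᵥ w S') * w S i := by linarith
      exact_mod_cast h2
    have hz : ((f ⬝ᵥ w S : ℤ) : ℝ) • embed (w S') ≠ 0 := by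
      refine smul_ne_zero (by exact_mod_cast hf' S hS) ?_
      intro h3
      apply (hw S' hS').1
      apply hinj
      rw [h3]; funext i; simp [embed]
    refine line_unique (h𝓛 S hS) (h𝓛 S' hS') hz ?_ ?_
    · rw [e1]
      refine S.smul_mem _ ?_
      have := Submodule.mem_span_singleton_self (R := ℝ) (embed (w S))
      rwa [← (hw S hS).2] at this
    · refine S'.smul_mem _ ?_
      have := Submodule.mem_span_singleton_self (R := ℝ) (embed (w S'))
      rwa [← (hw S' hS').2] at this)
  let sg : Submodule ℝ (Fin d → ℝ) → ℚ := fun S => ((g ⬝ᵥ w S : ℤ) : ℚ) / ((f ⬝ᵥ w S : ℤ) : ℚ)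
  have hsg : Set.InjOn sg 𝓛 := by
    intro S hS S' hS' hs
    by_contra hn
    refine hg _ (Finset.mem_image_of_mem _ (Finset.mem_offDiag.2 ⟨hS, hS', hn⟩ : (S, S') ∈ _)) ?_
    have q1 : ((f ⬝ᵥ w S : ℤ) : ℚ) ≠ 0 := by exact_mod_cast hf' S hS
    have q2 : ((f ⬝ᵥ w S' : ℤ) : ℚ) ≠ 0 := by exact_mod_cast hf' S' hS'
    simp only [sg] at hs
    rw [div_eq_div_iff q1 q2] at hs
    have hs' : (g ⬝ᵥ w S) * (f ⬝ᵥ w S') = (g ⬝ᵥ w S') * (f ⬝ᵥ w S) := by exact_mod_cast hs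
    simp only [dotProduct_sub, dotProduct_smul, smul_eq_mul]
    linarith
  let pos : (Fin d → ℤ) → ℚ × ℚ := fun x => (((f ⬝ᵥ x : ℤ) : ℚ), ((g ⬝ᵥ x : ℤ) : ℚ))
  have K : ∀ S ∈ 𝓛, ∀ x y : Fin d → ℤ, x ≠ y → embed x - embed y ∈ S →
      SlopeRel (sg S) (pos x) (pos y) := by
    intro S hS x y hxy hmem
    rw [(hw S hS).2] at hmem
    obtain ⟨c, hc⟩ := Submodule.mem_span_singleton.1 hmem
    have hc0 : c ≠ 0 := by
      rintro rfl
      rw [zero_smul] at hc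
      exact hxy (hinj (sub_eq_zero.1 hc.symm))
    have dot : ∀ k : Fin d → ℤ, c * ((k ⬝ᵥ w S : ℤ) : ℝ) = ((k ⬝ᵥ x : ℤ) : ℝ) - ((k ⬝ᵥ y : ℤ) : ℝ) := by
      intro k
      simp only [dotProduct]
      push_cast
      rw [Finset.mul_sum, ← Finset.sum_sub_distrib]
      refine Finset.sum_congr rfl fun i _ => ?_
      have := congrFun hc i
      simp only [Pi.smul_apply, Pi.sub_apply, smul_eq_mul, embed] at this
      linear_combination (k i : ℝ) * this
    have q1 : ((f ⬝ᵥ w S : ℤ) : ℚ) ≠ 0 := by exact_mod_cast hf' S hS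
    refine ⟨((f ⬝ᵥ x : ℤ) : ℚ) - ((f ⬝ᵥ y : ℤ) : ℚ), ?_, ?_⟩
    · intro h0
      have h0' : ((f ⬝ᵥ x : ℤ) : ℝ) - ((f ⬝ᵥ y : ℤ) : ℝ) = 0 := by exact_mod_cast h0
      rw [← dot f] at h0'
      have : ((f ⬝ᵥ w S : ℤ) : ℝ) ≠ 0 := by exact_mod_cast hf' S hS
      exact mul_ne_zero hc0 this h0'
    · have e : (((g ⬝ᵥ x : ℤ) : ℝ) - ((g ⬝ᵥ y : ℤ) : ℝ)) * ((f ⬝ᵥ w S : ℤ) : ℝ) =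
          (((f ⬝ᵥ x : ℤ) : ℝ) - ((f ⬝ᵥ y : ℤ) : ℝ)) * ((g ⬝ᵥ w S : ℤ) : ℝ) := by
        rw [← dot, ← dot]; ring
      have e' : (((g ⬝ᵥ x : ℤ) : ℚ) - ((g ⬝ᵥ y : ℤ) : ℚ)) * ((f ⬝ᵥ w S : ℤ) : ℚ) =
          (((f ⬝ᵥ x : ℤ) : ℚ) - ((f ⬝ᵥ y : ℤ) : ℚ)) * ((g ⬝ᵥ w S : ℤ) : ℚ) := by exact_mod_cast e
      apply Prod.ext
      · simp [pos]
      · simp only [pos, sg, Prod.snd_sub, Prod.smul_snd, smul_eq_mul]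
        rw [← mul_div_assoc, eq_div_iff q1]
        exact e'
  have hback : ∀ S ∈ 𝓛, ∀ a ∈ A, ∀ b ∈ B, SlopeRel (sg S) (pos a) (pos b) →
      embed a - embed b ∈ S := by
    intro S hS a ha b hb hR
    obtain ⟨S', hS', h1⟩ := (G1 b hb).2.1 a ha
    have := (K S' hS' a b (hne a ha b hb) h1).of_dt hR.dt_eq
    rwa [hsg hS' hS this] at h1
  have negmem : ∀ (S : Submodule ℝ (Fin d → ℝ)) (x y : Fin d → ℝ), x - y ∈ S → y - x ∈ S := by
    intro S x y hxy
    rw [← neg_sub]; exact S.neg_mem hxy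
  refine core2 m hm5 hm.2.2.2.2 A B (𝓛.image sg) ?_ (hAc.trans hLm) pos ?_ ?_ ?_ ?_ ?_
  · rw [Finset.card_image_of_injOn hsg, hLm]
  · intro a ha σ hσ
    obtain ⟨S, hS, rfl⟩ := Finset.mem_image.1 hσ
    obtain ⟨b, hb, h1⟩ := S1 a ha S hS
    exact ⟨b, hb, K S hS a b (hne a ha b hb) (negmem _ _ _ h1)⟩
  · intro b hb σ hσ
    obtain ⟨S, hS, rfl⟩ := Finset.mem_image.1 hσ
    obtain ⟨a, ha, h1⟩ := S2 b hb S hS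
    exact ⟨a, ha, K S hS a b (hne a ha b hb) h1⟩
  · intro a ha b hb
    obtain ⟨S, hS, h1⟩ := (G1 b hb).2.1 a ha
    exact ⟨sg S, Finset.mem_image_of_mem _ hS, K S hS a b (hne a ha b hb) h1⟩
  · intro a ha a' ha' b hb σ hσ r1 r2
    obtain ⟨S, hS, rfl⟩ := Finset.mem_image.1 hσ
    exact (G1 b hb).2.2 a ha a' ha' S hS (hback S hS a ha b hb r1) (hback S hS a' ha' b hb r2)
  · intro b hb b' hb' a ha σ hσ r1 r2
    obtain ⟨S, hS, rfl⟩ := Finset.mem_image.1 hσ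
    exact (G2 a ha).2.2 b hb b' hb' S hS (negmem _ _ _ (hback S hS a ha b hb r1))
      (negmem _ _ _ (hback S hS a ha b' hb' r2))
end

section
/- (Gardner–Gritzmann, four directions) For every d ≥ 2 there exist four lattice lines S₁, S₂, S₃, S₄ in ℝ^d such that every finite convex lattice set F ⊆ ℤ^d is uniquely determined among finite convex lattice sets by its four X-rays parallel to S₁, …, S₄: if F' is a finite convex lattice set tomographically equivalent to F with respect to {S₁, S₂, S₃, S₄}, then F' = F. -/
open Set

variable {d : ℕ}

structure GGLin {D : Type*} (lab : D → Bool) (ψ : D → ℝ) (W : D → ℤ) : Prop where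
  mono : ∀ p q, ψ p ≤ ψ q → W p ≤ W q
  par : ∀ p q, Even (W p - W q) ↔ lab p = lab q
  int : ∀ p q w, W p < w → w < W q → ∃ r, W r = w

theorem GGLin.lt {D : Type*} {lab : D → Bool} {ψ : D → ℝ} {W : D → ℤ} (h : GGLin lab ψ W)
    {p q : D} (hpq : W p < W q) : ψ p < ψ q := by
  by_contra hc
  exact absurd (h.mono q p (not_lt.1 hc)) (not_le.2 hpq)

theorem GGLin.half_mono {D : Type*} {lab : D → Bool} {ψ : D → ℝ} {W : D → ℤ}
    (h : GGLin lab ψ W) (L : D → Prop) (f : D → ℝ)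
    (hL : ∀ p r q, L p → L q → ψ p < ψ r → ψ r < ψ q → L r)
    (hf : ∀ p q, L p → L q → lab p ≠ lab q → ψ p < ψ q → f q < f p)
    {p q : D} (hp : L p) (hq : L q) (hpq : f q ≤ f p) : W p ≤ W q := by
  by_cases hl : lab p = lab q
  · by_contra hc
    have hc := not_le.1 hc
    have hev := (h.par p q).2 hl
    have h2 : W q + 1 < W p := by
      rcases hev with ⟨k, hk⟩
      omega
    obtain ⟨r, hr⟩ := h.int q p (W q + 1) (by omega) h2
    have h3 : ψ q < ψ r := h.lt (by omega)
    have h4 : ψ r < ψ p := h.lt (by omega)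
    have hLr := hL q r p hq hp h3 h4
    have hlr : lab q ≠ lab r := by
      intro h5
      rcases (h.par q r).2 h5 with ⟨k, hk⟩
      omega
    have h5 := hf q r hq hLr hlr h3
    have h6 := hf r p hLr hp (by rw [hl]; exact hlr.symm) h4
    linarith
  · apply h.mono
    by_contra hc
    have := hf q p hq hp (Ne.symm hl) (not_le.1 hc)
    linarith

theorem gg_chain {L : Type*} (a b : L → ℤ) (f : L → ℝ)
    (ha : ∀ p q, f q ≤ f p → a p ≤ a q) (hb : ∀ p q, f q ≤ f p → b p ≤ b q)
    (hi : ∀ p q w, a p < w → w < a q → ∃ r, a r = w)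
    (hpar' : ∀ p q, Even (b p - b q) → Even (a p - a q)) :
    ∀ (k : ℕ) (p q : L), f q ≤ f p → a q - a p = k → (k : ℤ) ≤ b q - b p := by
  intro k
  induction k with
  | zero =>
    intro p q hpq _
    have := hb p q hpq
    push_cast
    omega
  | succ k ih =>
    intro p q hpq hk
    have step : ∀ r, a r = a p + 1 → b p + 1 ≤ b r := by
      intro r hr
      have h1 : f r ≤ f p := by
        by_contra hc
        have := ha r p (not_le.1 hc).le
        omega
      have h2 := hb p r h1
      have h3 : b r ≠ b p := by
        intro h4
        have : Even (b r - b p) := by rw [h4]; simp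
        rcases hpar' r p this with ⟨m, hm⟩
        omega
      omega
    by_cases hk0 : k = 0
    · subst hk0
      have := step q (by push_cast at hk; omega)
      push_cast
      omega
    · obtain ⟨r, hr⟩ := hi p q (a p + 1) (by omega) (by push_cast at hk; omega)
      have h1 := step r hr
      have h2 : f q ≤ f r := by
        by_contra hc
        have := ha q r (not_le.1 hc).le
        push_cast at hk
        omega
      have := ih r q h2 (by push_cast at hk; omega)
      push_cast
      omega

theorem GGLin.refl {D : Type*} [Nonempty D] {lab : D → Bool} {ψ : D → ℝ} {W : D → ℤ}
    (h : GGLin lab ψ W) (γ : ℝ) (f : D → ℝ) (σ : D → D)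
    (h1 : ∀ p q, ψ p < γ → ψ q < γ → lab p ≠ lab q → ψ p < ψ q → f q < f p)
    (h2 : ∀ p q, γ ≤ ψ p → γ ≤ ψ q → lab p ≠ lab q → ψ p < ψ q → f p < f q)
    (hσ : ∀ p, σ (σ p) = p) (hlab : ∀ p, lab (σ p) ≠ lab p) (hf : ∀ p, f (σ p) = f p)
    (hs : ∀ p, ψ p < γ ↔ γ ≤ ψ (σ p)) : ∃ c, ∀ p, W p + W (σ p) = c := by
  have hs' : ∀ p, γ ≤ ψ p → ψ (σ p) < γ := fun p hp => by
    rw [hs, hσ]; exact hp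
  let L := {p : D // ψ p < γ}
  let a : L → ℤ := fun p => W p.1
  let b : L → ℤ := fun p => - W (σ p.1)
  have ha : ∀ p q : L, f q.1 ≤ f p.1 → a p ≤ a q := by
    intro p q hpq
    exact h.half_mono (fun p => ψ p < γ) f (fun _ _ _ _ hq _ h4 => h4.trans hq) h1 p.2 q.2 hpq
  have hb : ∀ p q : L, f q.1 ≤ f p.1 → b p ≤ b q := by
    intro p q hpq
    have := h.half_mono (fun p => γ ≤ ψ p) (fun p => - f p)
      (fun _ _ _ hp _ h3 _ => hp.trans h3.le)
      (fun p q hp hq hl hlt => neg_lt_neg (h2 p q hp hq hl hlt))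
      ((hs q.1).1 q.2) ((hs p.1).1 p.2) (by simp only [hf]; linarith)
    simp only [b]
    omega
  have hia : ∀ (p q : L) w, a p < w → w < a q → ∃ r, a r = w := by
    intro p q w hp hq
    obtain ⟨r, hr⟩ := h.int p.1 q.1 w hp hq
    exact ⟨⟨r, (h.lt (hr.trans_lt hq)).trans q.2⟩, hr⟩
  have hib : ∀ (p q : L) w, b p < w → w < b q → ∃ r, b r = w := by
    intro p q w hp hq
    simp only [b] at hp hq
    obtain ⟨r, hr⟩ := h.int (σ q.1) (σ p.1) (-w) (by omega) (by omega)
    have h5 : γ ≤ ψ r := ((hs q.1).1 q.2).trans (h.lt (by omega)).le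
    refine ⟨⟨σ r, hs' r h5⟩, ?_⟩
    simp only [b, hσ]
    omega
  have hbool : ∀ x y z w : Bool, x ≠ y → z ≠ w → (x = z ↔ y = w) := by decide
  have hpp : ∀ p q : L, Even (a p - a q) ↔ Even (b p - b q) := by
    intro p q
    have e1 := h.par p.1 q.1
    have e2 := h.par (σ q.1) (σ p.1)
    have e3 : b p - b q = W (σ q.1) - W (σ p.1) := by simp only [b]; ring
    rw [e3, e2]
    change Even (W p.1 - W q.1) ↔ _
    rw [e1, eq_comm, hbool _ _ _ _ (hlab q.1) (hlab p.1)]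
  have key : ∀ p q : L, f q.1 ≤ f p.1 → a q - a p = b q - b p := by
    intro p q hpq
    have h3 := ha p q hpq
    have h4 := hb p q hpq
    have h5 := gg_chain a b (fun p => f p.1) ha hb hia (fun p q => (hpp p q).2) (a q - a p).toNat p q hpq (by omega)
    have h6 := gg_chain b a (fun p => f p.1) hb ha hib (fun p q => (hpp p q).1) (b q - b p).toNat p q hpq (by omega)
    omega
  have key2 : ∀ p q : L, a q - a p = b q - b p := by
    intro p q
    rcases le_total (f q.1) (f p.1) with h3 | h3
    · exact key p q h3
    · have := key q p h3
      omega
  have hne : ∃ p0 : D, ψ p0 < γ := by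
    obtain ⟨p⟩ := ‹Nonempty D›
    by_cases hp : ψ p < γ
    · exact ⟨p, hp⟩
    · exact ⟨σ p, hs' p (not_lt.1 hp)⟩
  obtain ⟨p0, hp0⟩ := hne
  have key3 : ∀ q, ψ q < γ → W q + W (σ q) = W p0 + W (σ p0) := by
    intro q hq
    have := key2 ⟨p0, hp0⟩ ⟨q, hq⟩
    simp only [a, b] at this
    omega
  refine ⟨W p0 + W (σ p0), fun p => ?_⟩
  by_cases hp : ψ p < γ
  · exact key3 p hp
  · have := key3 (σ p) (hs' p (not_lt.1 hp))
    rw [hσ] at this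
    omega

theorem gg_exists_index_aux {D : Type*} [DecidableEq D] (lab : D → Bool) (ψ : D → ℝ)
    (hψ : ∀ p q, ψ p = ψ q → lab p = lab q) (s : Finset D) :
    ∃ W : D → ℤ, (∀ p ∈ s, ∀ q ∈ s, ψ p ≤ ψ q → W p ≤ W q) ∧
      (∀ p ∈ s, ∀ q ∈ s, (Even (W p - W q) ↔ lab p = lab q)) ∧
      (∀ p ∈ s, 0 ≤ W p) ∧ (∀ p ∈ s, ∀ w, 0 ≤ w → w ≤ W p → ∃ r ∈ s, W r = w) := by
  induction s using Finset.induction_on_max_value ψ with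
  | empty => exact ⟨fun _ => 0, by simp⟩
  | insert a s has hmax ih =>
    obtain ⟨W, m1, m2, m3, m4⟩ := ih
    rcases s.eq_empty_or_nonempty with rfl | hne
    · refine ⟨fun _ => 0, by simp, by simp, by simp, ?_⟩
      intro p hp w h0 h1
      exact ⟨p, hp, le_antisymm h0 h1⟩
    obtain ⟨m, hm, hmm⟩ := s.exists_max_image ψ hne
    let v : ℤ := W m + if lab a = lab m then 0 else 1
    have hv1 : W m ≤ v := by simp only [v]; split_ifs <;> omega
    have hv2 : v ≤ W m + 1 := by simp only [v]; split_ifs <;> omega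
    have hW : ∀ p ∈ s, Function.update W a v p = W p := by
      intro p hp
      rw [Function.update_of_ne]
      rintro rfl
      exact has hp
    have hWa : Function.update W a v a = v := by simp
    have hva : ∀ q ∈ s, (Even (v - W q) ↔ lab a = lab q) := by
      intro q hq
      have := m2 m hm q hq
      by_cases hl : lab a = lab m
      · have : v = W m := by simp [v, hl]
        rw [this, hl, m2 m hm q hq]
      · have e : v - W q = (W m - W q) + 1 := by simp only [v, if_neg hl]; ring
        rw [e, Int.even_add_one, m2 m hm q hq]
        revert hl
        generalize lab a = x
        generalize lab m = y
        generalize lab q = z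
        revert x y z
        decide
    refine ⟨Function.update W a v, ?_, ?_, ?_, ?_⟩
    · intro p hp q hq hpq
      rcases Finset.mem_insert.1 hp with rfl | hp' <;>
        rcases Finset.mem_insert.1 hq with hq' | hq'
      · rw [hq']
      · rw [hWa, hW q hq']
        have e1 : ψ p = ψ m := le_antisymm (hpq.trans (hmm q hq')) (hmax m hm)
        have e2 := hψ _ _ e1
        have e3 : v = W m := by simp [v, e2]
        rw [e3]
        exact m1 m hm q hq' (by rw [← e1]; exact hpq)
      · rw [hq', hWa, hW p hp']
        exact (m1 p hp' m hm (hmm p hp')).trans hv1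
      · rw [hW p hp', hW q hq']
        exact m1 p hp' q hq' hpq
    · intro p hp q hq
      rcases Finset.mem_insert.1 hp with hp' | hp' <;>
        rcases Finset.mem_insert.1 hq with hq' | hq'
      · rw [hp', hq']
        simp
      · rw [hp', hWa, hW q hq']
        exact hva q hq'
      · rw [hq', hWa, hW p hp', ← neg_sub, even_neg, hva p hp', eq_comm]
      · rw [hW p hp', hW q hq']
        exact m2 p hp' q hq'
    · intro p hp
      rcases Finset.mem_insert.1 hp with rfl | hp
      · rw [hWa]
        exact (m3 m hm).trans hv1
      · rw [hW p hp]
        exact m3 p hp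
    · intro p hp w h0 h1
      have main : w ≤ W m → ∃ r ∈ insert a s, Function.update W a v r = w := by
        intro h2
        obtain ⟨r, hr, hrw⟩ := m4 m hm w h0 h2
        exact ⟨r, Finset.mem_insert_of_mem hr, by rw [hW r hr, hrw]⟩
      rcases Finset.mem_insert.1 hp with rfl | hp
      · rw [hWa] at h1
        by_cases h2 : w ≤ W m
        · exact main h2
        · exact ⟨p, Finset.mem_insert_self _ _, by rw [hWa]; omega⟩
      · rw [hW p hp] at h1
        exact main (h1.trans (m1 p hp m hm (hmm p hp)))

theorem gg_exists_index {D : Type*} [Fintype D] [Nonempty D] (lab : D → Bool) (ψ : D → ℝ)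
    (hψ : ∀ p q, ψ p = ψ q → lab p = lab q) :
    ∃ (W : D → ℤ) (N : ℕ), GGLin lab ψ W ∧ (∀ p, 0 ≤ W p) ∧ (∀ p, W p ≤ N) ∧
      (∀ w : ℤ, 0 ≤ w → w ≤ N → ∃ p, W p = w) := by
  classical
  obtain ⟨W, m1, m2, m3, m4⟩ := gg_exists_index_aux lab ψ hψ Finset.univ
  obtain ⟨m, hm, hmm⟩ := Finset.univ.exists_max_image W Finset.univ_nonempty
  have h0 := m3 m hm
  simp only [Finset.mem_univ, true_and, forall_const] at m1 m2 m3 m4 hmm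
  refine ⟨W, (W m).toNat, ⟨m1, m2, ?_⟩, m3, fun p => ?_, fun w hw0 hw1 => ?_⟩
  · intro p q w hp hq
    exact m4 q w ((m3 p).trans hp.le) hq.le
  · have := hmm p
    omega
  · exact m4 m w hw0 (by omega)
theorem gg_sub_dvd_prime {n : ℕ} (hn : 0 < n) {ζ ζb : ℂ} (h : ζ ^ n = 1) (h' : ζb ^ n = 1)
    (hne : ζ ≠ ζb) : ∃ (p : ℕ) (t : ℂ), p.Prime ∧ IsIntegral ℤ t ∧ (ζ - ζb) * t = p := by
  have hz0 : ζ ≠ 0 := by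
    rintro rfl
    rw [zero_pow hn.ne'] at h
    exact zero_ne_one h
  set η := ζb / ζ with hη
  have hη1 : η ≠ 1 := by
    intro h1
    rw [hη, div_eq_one_iff_eq hz0] at h1
    exact hne h1.symm
  have hηn : η ^ n = 1 := by rw [hη, div_pow, h, h', div_one]
  have hpr := IsPrimitiveRoot.orderOf η
  set m := orderOf η with hm
  have hm0 : 0 < m := orderOf_pos_iff.2 (isOfFinOrder_iff_pow_eq_one.2 ⟨n, hn, hηn⟩)
  have hm1 : m ≠ 1 := by
    rw [hm, Ne, orderOf_eq_one_iff]
    exact hη1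
  have hmem : η ∈ primitiveRoots m ℂ := (mem_primitiveRoots hm0).2 hpr
  have hint : ∀ (x : ℂ) (k : ℕ), 0 < k → x ^ k = 1 → IsIntegral ℤ x := fun x k hk hx =>
    IsIntegral.of_pow hk (by rw [hx]; exact isIntegral_one)
  have heval : (1 - η) * ∏ μ ∈ (primitiveRoots m ℂ).erase η, (1 - μ)
      = (Polynomial.cyclotomic m ℂ).eval 1 := by
    rw [Polynomial.cyclotomic_eq_prod_X_sub_primitiveRoots hpr, Polynomial.eval_prod,
      ← Finset.mul_prod_erase _ _ hmem]
    simp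
  set t := ∏ μ ∈ (primitiveRoots m ℂ).erase η, (1 - μ) with ht
  have hti : IsIntegral ℤ t := by
    apply IsIntegral.prod
    intro μ hμ
    have := (mem_primitiveRoots hm0).1 (Finset.mem_of_mem_erase hμ)
    exact isIntegral_one.sub (hint μ m hm0 this.pow_eq_one)
  have hzi : IsIntegral ℤ ζ⁻¹ := hint _ n hn (by rw [inv_pow, h, inv_one])
  have hfac : ζ - ζb = ζ * (1 - η) := by
    rw [hη]; field_simp
  by_cases hp : ∀ {p : ℕ}, p.Prime → ∀ k : ℕ, p ^ k ≠ m
  · rw [Polynomial.eval_one_cyclotomic_not_prime_pow hp] at heval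
    refine ⟨2, ζ⁻¹ * t * 2, Nat.prime_two, (hzi.mul hti).mul ?_, ?_⟩
    · exact_mod_cast (isIntegral_algebraMap (R := ℤ) (A := ℂ) (x := 2))
    · rw [hfac]
      have : ζ * (1 - η) * (ζ⁻¹ * t * 2) = (ζ * ζ⁻¹) * ((1 - η) * t) * 2 := by ring
      rw [this, heval, mul_inv_cancel₀ hz0]
      norm_num
  · push Not at hp
    obtain ⟨p, hpp, k, hk⟩ := hp
    have := Fact.mk hpp
    obtain ⟨j, rfl⟩ : ∃ j, k = j + 1 := by
      refine Nat.exists_eq_succ_of_ne_zero ?_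
      rintro rfl
      exact hm1 (by simpa using hk.symm)
    rw [← hk, Polynomial.eval_one_cyclotomic_prime_pow] at heval
    refine ⟨p, ζ⁻¹ * t, hpp, hzi.mul hti, ?_⟩
    rw [hfac]
    have : ζ * (1 - η) * (ζ⁻¹ * t) = (ζ * ζ⁻¹) * ((1 - η) * t) := by ring
    rw [this, heval, mul_inv_cancel₀ hz0, one_mul]

theorem gg_not_eight {n : ℕ} (hn : 0 < n) {a b c d α : ℂ} (ha : a ^ n = 1) (hb : b ^ n = 1)
    (hc : c ^ n = 1) (hd : d ^ n = 1) (hab : a ≠ b) (hcd : c ≠ d) (hα : IsIntegral ℤ α)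
    (h : 8 * α = (a - b) * (c - d)) : False := by
  obtain ⟨p, t, hp, ht, hpt⟩ := gg_sub_dvd_prime hn ha hb hab
  obtain ⟨q, s, hq, hs, hqs⟩ := gg_sub_dvd_prime hn hc hd hcd
  have h1 : 8 * (α * t * s) = (p : ℂ) * q := by
    rw [← hpt, ← hqs]
    linear_combination (t * s) * h
  have hint : IsIntegral ℤ (α * t * s) := (hα.mul ht).mul hs
  have h2 : α * t * s = algebraMap ℚ ℂ ((p : ℚ) * q / 8) := by
    simp only [map_div₀, map_mul, map_natCast, map_ofNat]
    rw [← h1]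
    ring
  rw [h2, isIntegral_algebraMap_iff (algebraMap ℚ ℂ).injective] at hint
  obtain ⟨z, hz⟩ := IsIntegrallyClosed.isIntegral_iff.1 hint
  have h3 : (z : ℚ) * 8 = p * q := by
    have : (z : ℚ) = (p : ℚ) * q / 8 := by simpa using hz
    rw [this]; ring
  have h4 : z * 8 = p * q := by exact_mod_cast h3
  have h5 : 8 ∣ p * q := by
    have : (8 : ℤ) ∣ (p : ℤ) * q := ⟨z, by rw [← h4]; ring⟩
    exact_mod_cast this
  have key : ∀ p q : ℕ, p.Prime → q.Prime → 8 ∣ p * q → 2 ∣ p → False := by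
    intro p q hp hq h hp2
    have : p = 2 := ((Nat.prime_dvd_prime_iff_eq Nat.prime_two hp).1 hp2).symm
    subst this
    have h4 : 4 ∣ q := by omega
    have h2 : 2 ∣ q := by omega
    have := (Nat.prime_dvd_prime_iff_eq Nat.prime_two hq).1 h2
    omega
  have h6 : 2 ∣ p * q := Dvd.dvd.trans (by norm_num) h5
  rcases (Nat.Prime.dvd_mul Nat.prime_two).1 h6 with h7 | h7
  · exact key p q hp hq h5 h7
  · exact key q p hq hp (by rwa [mul_comm]) h7
theorem gg_cos_left {x : ℝ} (h1 : Real.pi / 2 ≤ x) (h2 : x < 3 * Real.pi / 2)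
    (h0 : Real.cos x ≠ 0) : Real.cos x < 0 :=
  lt_of_le_of_ne (Real.cos_nonpos_of_pi_div_two_le_of_le h1 (by linarith)) h0

theorem gg_cos_right {x : ℝ} (h1 : 3 * Real.pi / 2 ≤ x) (h2 : x < 5 * Real.pi / 2)
    (h0 : Real.cos x ≠ 0) : 0 < Real.cos x := by
  refine lt_of_le_of_ne ?_ (Ne.symm h0)
  rw [← Real.cos_sub_two_pi]
  exact Real.cos_nonneg_of_neg_pi_div_two_le_of_le (by linarith) (by linarith)

theorem gg_geom {D : Type*} {lab : D → Bool} (px py nx ny ρ ψ : D → ℝ) (a b R β : ℝ)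
    (hR : 0 < R) (ha : a = R * Real.cos β) (hb : b = R * Real.sin β) (hρ : ∀ p, 0 < ρ p)
    (hnx : ∀ p, nx p = ρ p * Real.cos (ψ p)) (hny : ∀ p, ny p = ρ p * Real.sin (ψ p))
    (hw1 : ∀ p, β + Real.pi / 2 ≤ ψ p) (hw2 : ∀ p, ψ p < β + 5 * Real.pi / 2)
    (hsep : ∀ p q, lab p ≠ lab q → 0 < nx p * (px p - px q) + ny p * (py p - py q))
    (σ : D → D) (hlab : ∀ p, lab (σ p) ≠ lab p)
    (hf : ∀ p, a * py (σ p) - b * px (σ p) = a * py p - b * px p) :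
    (∀ p q, ψ p < β + 3 * Real.pi / 2 → ψ q < β + 3 * Real.pi / 2 → lab p ≠ lab q →
      ψ p < ψ q → a * py q - b * px q < a * py p - b * px p) ∧
    (∀ p q, β + 3 * Real.pi / 2 ≤ ψ p → β + 3 * Real.pi / 2 ≤ ψ q → lab p ≠ lab q →
      ψ p < ψ q → a * py p - b * px p < a * py q - b * px q) ∧
    (∀ p, ψ p < β + 3 * Real.pi / 2 ↔ β + 3 * Real.pi / 2 ≤ ψ (σ p)) ∧
    (∀ p, ψ p < β + 3 * Real.pi / 2 →
      a * (px p - px (σ p)) + b * (py p - py (σ p)) < 0) := by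
  have hdot : ∀ p, nx p * a + ny p * b = ρ p * R * Real.cos (ψ p - β) := by
    intro p
    rw [hnx, hny, ha, hb, Real.cos_sub]
    ring
  have hdet : ∀ p q, nx p * ny q - ny p * nx q = ρ p * ρ q * Real.sin (ψ q - ψ p) := by
    intro p q
    rw [hnx, hny, hnx, hny, Real.sin_sub]
    ring
  have hsq : a ^ 2 + b ^ 2 = R ^ 2 := by
    rw [ha, hb]
    linear_combination R ^ 2 * Real.sin_sq_add_cos_sq β
  have hmain : ∀ p, 0 < (a * (px p - px (σ p)) + b * (py p - py (σ p))) *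
      Real.cos (ψ p - β) := by
    intro p
    have h1 := hsep p (σ p) (hlab p).symm
    have h2 : R ^ 2 * (nx p * (px p - px (σ p)) + ny p * (py p - py (σ p))) =
        ρ p * R * ((a * (px p - px (σ p)) + b * (py p - py (σ p))) * Real.cos (ψ p - β)) := by
      linear_combination (a * (px p - px (σ p)) + b * (py p - py (σ p))) * hdot p
        - (nx p * (px p - px (σ p)) + ny p * (py p - py (σ p))) * hsq
        + (nx p * b - ny p * a) * (hf p)
    have h3 : 0 < R ^ 2 * (nx p * (px p - px (σ p)) + ny p * (py p - py (σ p))) := by positivity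
    rw [h2] at h3
    exact (pos_iff_pos_of_mul_pos h3).1 (mul_pos (hρ p) hR)
  have hmain' : ∀ p, (a * (px p - px (σ p)) + b * (py p - py (σ p))) *
      Real.cos (ψ (σ p) - β) < 0 := by
    intro p
    have h1 := hsep (σ p) p (hlab p)
    have h2 : R ^ 2 * (nx (σ p) * (px (σ p) - px p) + ny (σ p) * (py (σ p) - py p)) =
        ρ (σ p) * R * -((a * (px p - px (σ p)) + b * (py p - py (σ p))) *
          Real.cos (ψ (σ p) - β)) := by
      linear_combination -(a * (px p - px (σ p)) + b * (py p - py (σ p))) * hdot (σ p)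
        + (nx (σ p) * (px p - px (σ p)) + ny (σ p) * (py p - py (σ p))) * hsq
        - (nx (σ p) * b - ny (σ p) * a) * (hf p)
    have h3 : 0 < R ^ 2 * (nx (σ p) * (px (σ p) - px p) + ny (σ p) * (py (σ p) - py p)) := by
      positivity
    rw [h2] at h3
    have := (pos_iff_pos_of_mul_pos h3).1 (mul_pos (hρ (σ p)) hR)
    linarith
  have hc0 : ∀ p, Real.cos (ψ p - β) ≠ 0 := by
    intro p h
    have := hmain p
    rw [h, mul_zero] at this
    exact lt_irrefl _ this
  have hl : ∀ p, ψ p < β + 3 * Real.pi / 2 → Real.cos (ψ p - β) < 0 := fun p hp =>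
    gg_cos_left (by linarith [hw1 p]) (by linarith) (hc0 p)
  have hr : ∀ p, β + 3 * Real.pi / 2 ≤ ψ p → 0 < Real.cos (ψ p - β) := fun p hp =>
    gg_cos_right (by linarith) (by linarith [hw2 p]) (hc0 p)
  have binet : ∀ p q, (nx q * a + ny q * b) * (nx p * (px p - px q) + ny p * (py p - py q))
      + (nx p * a + ny p * b) * (nx q * (px q - px p) + ny q * (py q - py p))
      = - (nx p * ny q - ny p * nx q) * ((a * py p - b * px p) - (a * py q - b * px q)) := by
    intro p q
    ring
  refine ⟨?_, ?_, ?_, ?_⟩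
  · intro p q hp hq hpq hlt
    have e := binet p q
    have s1 := hsep p q hpq
    have s2 := hsep q p hpq.symm
    rw [hdot, hdot, hdet] at e
    have t1 : ρ q * R * Real.cos (ψ q - β) < 0 :=
      mul_neg_of_pos_of_neg (mul_pos (hρ q) hR) (hl q hq)
    have t2 : ρ p * R * Real.cos (ψ p - β) < 0 :=
      mul_neg_of_pos_of_neg (mul_pos (hρ p) hR) (hl p hp)
    have t3 : 0 < ρ p * ρ q * Real.sin (ψ q - ψ p) :=
      mul_pos (mul_pos (hρ p) (hρ q)) (Real.sin_pos_of_pos_of_lt_pi (by linarith)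
        (by linarith [hw1 p]))
    have u1 := mul_neg_of_neg_of_pos t1 s1
    have u2 := mul_neg_of_neg_of_pos t2 s2
    by_contra hc
    have hc := not_lt.1 hc
    nlinarith
  · intro p q hp hq hpq hlt
    have e := binet p q
    have s1 := hsep p q hpq
    have s2 := hsep q p hpq.symm
    rw [hdot, hdot, hdet] at e
    have t1 : 0 < ρ q * R * Real.cos (ψ q - β) :=
      mul_pos (mul_pos (hρ q) hR) (hr q hq)
    have t2 : 0 < ρ p * R * Real.cos (ψ p - β) :=
      mul_pos (mul_pos (hρ p) hR) (hr p hp)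
    have t3 : 0 < ρ p * ρ q * Real.sin (ψ q - ψ p) :=
      mul_pos (mul_pos (hρ p) (hρ q)) (Real.sin_pos_of_pos_of_lt_pi (by linarith)
        (by linarith [hw2 q]))
    have u1 := mul_pos t1 s1
    have u2 := mul_pos t2 s2
    by_contra hc
    have hc := not_lt.1 hc
    nlinarith
  · intro p
    have h1 := hmain p
    have h2 := hmain' p
    constructor
    · intro hp
      by_contra hc
      have h3 := hl p hp
      have h4 := hl (σ p) (not_le.1 hc)
      nlinarith
    · intro hp
      by_contra hc
      have h3 := hr p (not_lt.1 hc)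
      have h4 := hr (σ p) hp
      have h5 := (pos_iff_pos_of_mul_pos h1).2 h3
      nlinarith
  · intro p hp
    have h3 := hl p hp
    have h1 := hmain p
    by_contra hc
    nlinarith

/-- Rotating the cut of a cyclic index. -/
theorem gg_rotate {D : Type*} {lab : D → Bool} {ψ : D → ℝ} {W : D → ℤ} {N : ℕ} {γ : ℝ}
    (h : GGLin lab ψ W) (hw1 : ∀ p, γ ≤ ψ p) (hw2 : ∀ p, ψ p < γ + 2 * Real.pi)
    (h0 : ∀ p, 0 ≤ W p) (hN : ∀ p, W p ≤ N)
    (hsurj : ∀ w : ℤ, 0 ≤ w → w ≤ N → ∃ p, W p = w) (hodd : Odd N) (γb : ℝ) :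
    ∃ κ : D → ℤ, GGLin lab (fun p => ψ p + 2 * Real.pi * κ p) (fun p => W p + (N + 1) * κ p) ∧
      (∀ p, γb ≤ ψ p + 2 * Real.pi * κ p) ∧ (∀ p, ψ p + 2 * Real.pi * κ p < γb + 2 * Real.pi) := by
  have hpi := Real.pi_pos
  have mono : ∀ p q (k l : ℤ), ψ p + 2 * Real.pi * k ≤ ψ q + 2 * Real.pi * l →
      W p + (N + 1) * k ≤ W q + (N + 1) * l := by
    intro p q k l hkl
    have h1 := hw1 p
    have h2 := hw2 q
    have h3 : (k : ℝ) < l + 1 := by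
      by_contra hc
      have hc := not_lt.1 hc
      nlinarith
    have h4 : k < l + 1 := by exact_mod_cast h3
    rcases (Int.lt_add_one_iff.1 h4).lt_or_eq with h5 | h5
    · have a1 := h0 q
      have a2 := hN p
      nlinarith
    · subst h5
      have := h.mono p q (by linarith)
      linarith
  have lt : ∀ p q (k l : ℤ), W p + (N + 1) * k < W q + (N + 1) * l →
      ψ p + 2 * Real.pi * k < ψ q + 2 * Real.pi * l := by
    intro p q k l hlt
    by_contra hc
    exact absurd (mono q p l k (not_lt.1 hc)) (not_le.2 hlt)
  have hκ : ∀ p, ∃ k : ℤ, γb ≤ ψ p + 2 * Real.pi * k ∧ ψ p + 2 * Real.pi * k < γb + 2 * Real.pi := by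
    intro p
    refine ⟨⌈(γb - ψ p) / (2 * Real.pi)⌉, ?_, ?_⟩
    · have := Int.le_ceil ((γb - ψ p) / (2 * Real.pi))
      rw [div_le_iff₀ (by positivity)] at this
      linarith
    · have := Int.ceil_lt_add_one ((γb - ψ p) / (2 * Real.pi))
      rw [← sub_lt_iff_lt_add, lt_div_iff₀ (by positivity)] at this
      linarith
  choose κ hκ1 hκ2 using hκ
  refine ⟨κ, ⟨fun p q => mono p q _ _, ?_, ?_⟩, hκ1, hκ2⟩
  · intro p q
    rw [← h.par p q]
    obtain ⟨m, hm⟩ := hodd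
    have : W p + ((N : ℤ) + 1) * κ p - (W q + (N + 1) * κ q) =
        (W p - W q) + 2 * ((m + 1) * (κ p - κ q)) := by
      rw [hm]; push_cast; ring
    rw [this, Int.even_add]
    simp
  · intro p q w hp hq
    obtain ⟨r, hr⟩ := hsurj (w % (N + 1)) (Int.emod_nonneg _ (by omega))
      (by have := Int.emod_lt_of_pos w (show (0 : ℤ) < N + 1 by omega); omega)
    have hrw : W r + (N + 1) * (w / (N + 1)) = w := by rw [hr]; exact Int.emod_add_mul_ediv _ _
    have h1 := lt p r (κ p) (w / (N + 1)) (by rw [hrw]; exact hp)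
    have h2 := lt r q (w / (N + 1)) (κ q) (by rw [hrw]; exact hq)
    have h3 : κ r = w / (N + 1) := by
      have a1 := hκ1 p
      have a2 := hκ2 q
      have a3 := hκ1 r
      have a4 := hκ2 r
      generalize w / ((N : ℤ) + 1) = k at *
      have b1 : (κ r : ℝ) < k + 1 := by
        by_contra hc
        have hc := not_lt.1 hc
        nlinarith
      have b2 : (k : ℝ) < κ r + 1 := by
        by_contra hc
        have hc := not_lt.1 hc
        nlinarith
      have c1 : κ r < k + 1 := by exact_mod_cast b1
      have c2 : k < κ r + 1 := by exact_mod_cast b2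
      omega
    refine ⟨r, ?_⟩
    show W r + (N + 1) * κ r = w
    rw [h3]
    exact hrw
theorem gg_shift (x γ : ℝ) :
    ∃ k : ℤ, γ ≤ x + 2 * Real.pi * k ∧ x + 2 * Real.pi * k < γ + 2 * Real.pi := by
  have hpi := Real.pi_pos
  refine ⟨⌈(γ - x) / (2 * Real.pi)⌉, ?_, ?_⟩
  · have := Int.le_ceil ((γ - x) / (2 * Real.pi))
    rw [div_le_iff₀ (by positivity)] at this
    linarith
  · have := Int.ceil_lt_add_one ((γ - x) / (2 * Real.pi))
    rw [← sub_lt_iff_lt_add, lt_div_iff₀ (by positivity)] at this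
    linarith

theorem gg_cos_shift (x : ℝ) (k : ℤ) : Real.cos (x + 2 * Real.pi * k) = Real.cos x := by
  rw [mul_comm (2 * Real.pi)]
  exact Real.cos_add_int_mul_two_pi x k

theorem gg_sin_shift (x : ℝ) (k : ℤ) : Real.sin (x + 2 * Real.pi * k) = Real.sin x := by
  rw [mul_comm (2 * Real.pi)]
  exact Real.sin_add_int_mul_two_pi x k

theorem gg_polar (a b : ℝ) (h : a ≠ 0 ∨ b ≠ 0) :
    ∃ R β : ℝ, 0 < R ∧ a = R * Real.cos β ∧ b = R * Real.sin β := by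
  refine ⟨‖(⟨a, b⟩ : ℂ)‖, Complex.arg ⟨a, b⟩, ?_, ?_, ?_⟩
  · rw [norm_pos_iff]
    intro hc
    have h1 := congrArg Complex.re hc
    have h2 := congrArg Complex.im hc
    simp at h1 h2
    tauto
  · rw [Complex.norm_mul_cos_arg]
  · rw [Complex.norm_mul_sin_arg]

/-- Each direction acts as a reflection on the cyclic index. -/
theorem gg_direction {D : Type*} [Nonempty D] {lab : D → Bool} (px py nx ny ρ ψ : D → ℝ)
    {W : D → ℤ} {N : ℕ} {γ : ℝ} (a b : ℝ) (hab : a ≠ 0 ∨ b ≠ 0) (hρ : ∀ p, 0 < ρ p)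
    (hnx : ∀ p, nx p = ρ p * Real.cos (ψ p)) (hny : ∀ p, ny p = ρ p * Real.sin (ψ p))
    (hsep : ∀ p q, lab p ≠ lab q → 0 < nx p * (px p - px q) + ny p * (py p - py q))
    (h : GGLin lab ψ W) (hw1 : ∀ p, γ ≤ ψ p) (hw2 : ∀ p, ψ p < γ + 2 * Real.pi)
    (h0 : ∀ p, 0 ≤ W p) (hN : ∀ p, W p ≤ N)
    (hsurj : ∀ w : ℤ, 0 ≤ w → w ≤ N → ∃ p, W p = w) (hodd : Odd N)
    (σ : D → D) (hσ : ∀ p, σ (σ p) = p) (hlab : ∀ p, lab (σ p) ≠ lab p)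
    (hf : ∀ p, a * py (σ p) - b * px (σ p) = a * py p - b * px p) :
    ∃ c : ℤ, Odd c ∧ ∀ p, ((N : ℤ) + 1) ∣ W p + W (σ p) - c := by
  obtain ⟨R, β, hR, ha, hb⟩ := gg_polar a b hab
  obtain ⟨κ, hl, hk1, hk2⟩ := gg_rotate h hw1 hw2 h0 hN hsurj hodd (β + Real.pi / 2)
  obtain ⟨g1, g2, g3, -⟩ := gg_geom px py nx ny ρ (fun p => ψ p + 2 * Real.pi * κ p) a b R β hR ha hb
    hρ (fun p => by rw [gg_cos_shift, hnx]) (fun p => by rw [gg_sin_shift, hny]) hk1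
    (fun p => (hk2 p).trans_le (by linarith)) hsep σ hlab hf
  obtain ⟨c, hc⟩ := hl.refl _ (fun p => a * py p - b * px p) σ g1 g2 hσ hlab hf g3
  refine ⟨c, ?_, fun p => ⟨-(κ p + κ (σ p)), ?_⟩⟩
  · obtain ⟨p⟩ := ‹Nonempty D›
    have h1 := hc p
    have h2 := hl.par (σ p) p
    have h3 : ¬ Even (W (σ p) + (N + 1) * κ (σ p) - (W p + (N + 1) * κ p)) := fun h4 =>
      hlab p (h2.1 h4)
    rw [Int.not_even_iff_odd] at h3
    obtain ⟨m, hm⟩ := h3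
    exact ⟨m + (W p + (N + 1) * κ p), by rw [← hc p]; linarith⟩
  · rw [← hc p]
    ring

noncomputable def ggWt {D : Type*} [Fintype D] (W : D → ℤ) (p : D) : ℝ :=
  ((Finset.univ.filter (fun q => W q = W p)).card : ℝ)⁻¹

theorem ggWt_pos {D : Type*} [Fintype D] (W : D → ℤ) (p : D) : 0 < ggWt W p := by
  rw [ggWt, inv_pos]
  exact_mod_cast Finset.card_pos.2 ⟨p, by simp⟩

theorem gg_class {D : Type*} {W : D → ℤ} {N : ℕ}
    (h0 : ∀ p, 0 ≤ W p) (hN : ∀ p, W p ≤ N) {σ : D → D} {c : ℤ}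
    (hc : ∀ p, ((N : ℤ) + 1) ∣ W p + W (σ p) - c) {p q : D} (h : W p = W q) :
    W (σ p) = W (σ q) := by
  have h1 := dvd_sub (hc p) (hc q)
  rw [h] at h1
  have h2 : W q + W (σ p) - c - (W q + W (σ q) - c) = W (σ p) - W (σ q) := by ring
  rw [h2] at h1
  have := Int.eq_zero_of_abs_lt_dvd h1 (by
    rw [abs_lt]
    have := h0 (σ p)
    have := h0 (σ q)
    have := hN (σ p)
    have := hN (σ q)
    constructor <;> linarith)
  linarith

theorem ggWt_refl {D : Type*} [Fintype D] {W : D → ℤ} {N : ℕ}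
    (h0 : ∀ p, 0 ≤ W p) (hN : ∀ p, W p ≤ N) {σ : D → D} {c : ℤ} (hσ : ∀ p, σ (σ p) = p)
    (hc : ∀ p, ((N : ℤ) + 1) ∣ W p + W (σ p) - c) (p : D) : ggWt W (σ p) = ggWt W p := by
  rw [ggWt, ggWt]
  congr 2
  apply Finset.card_nbij' σ σ
  · intro q hq
    simp only [Finset.coe_filter, Finset.mem_univ, true_and, Set.mem_ofPred_eq] at hq ⊢
    have := gg_class h0 hN hc hq
    rwa [hσ] at this
  · intro q hq
    simp only [Finset.coe_filter, Finset.mem_univ, true_and, Set.mem_ofPred_eq] at hq ⊢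
    exact gg_class h0 hN hc hq
  · intro q _
    exact hσ q
  · intro q _
    exact hσ q

theorem gg_fourier {D : Type*} [Fintype D] {W : D → ℤ} {N : ℕ}
    (h0 : ∀ p, 0 ≤ W p) (hN : ∀ p, W p ≤ N) {σ : D → D} {c : ℤ} (hσ : ∀ p, σ (σ p) = p)
    (hc : ∀ p, ((N : ℤ) + 1) ∣ W p + W (σ p) - c) (g : D → ℝ) (hg : ∀ p, g (σ p) = g p)
    {ω : ℂ} (hω : ω ^ (N + 1) = 1) :
    ∑ p, (ggWt W p : ℂ) * ω ^ (W p) * (g p : ℂ) =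
      ω ^ c * (starRingEnd ℂ) (∑ p, (ggWt W p : ℂ) * ω ^ (W p) * (g p : ℂ)) := by
  have hω0 : ω ≠ 0 := by
    rintro rfl
    simp at hω
  have hn : ‖ω‖ = 1 := Complex.norm_eq_one_of_pow_eq_one hω (by omega)
  have hconj : (starRingEnd ℂ) ω = ω⁻¹ := (Complex.inv_eq_conj hn).symm
  rw [map_sum, Finset.mul_sum, ← Equiv.sum_comp (Function.Involutive.toPerm σ hσ)]
  apply Finset.sum_congr rfl
  intro p _
  change (ggWt W (σ p) : ℂ) * ω ^ W (σ p) * (g (σ p) : ℂ) = _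
  rw [ggWt_refl h0 hN hσ hc, hg]
  simp only [map_mul, Complex.conj_ofReal, map_zpow₀, hconj]
  have : ω ^ W (σ p) = ω ^ c * ω⁻¹ ^ W p := by
    obtain ⟨k, hk⟩ := hc p
    have e : W (σ p) = ((N + 1 : ℕ) : ℤ) * k + (c + -W p) := by
      push_cast
      linarith
    rw [e, zpow_add₀ hω0, zpow_mul, zpow_natCast, hω, one_zpow, one_mul, zpow_add₀ hω0, inv_zpow,
      zpow_neg]
  rw [this]
  ring

theorem gg_sum_wt {D : Type*} [Fintype D] {W : D → ℤ} {N : ℕ} (hN1 : 1 ≤ N)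
    (h0 : ∀ p, 0 ≤ W p) (hN : ∀ p, W p ≤ N)
    (hsurj : ∀ w : ℤ, 0 ≤ w → w ≤ N → ∃ p, W p = w)
    {ω : ℂ} (hω : IsPrimitiveRoot ω (N + 1)) :
    ∑ p, (ggWt W p : ℂ) * ω ^ (W p) = 0 := by
  rw [← hω.geom_sum_eq_zero (by omega),
    ← Finset.sum_fiberwise_of_maps_to (s := Finset.univ) (t := Finset.range (N + 1))
      (g := fun p => (W p).toNat) (by
        intro p _
        have := h0 p
        have := hN p
        rw [Finset.mem_range]
        omega)]
  apply Finset.sum_congr rfl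
  intro w hw
  rw [Finset.mem_range] at hw
  obtain ⟨p0, hp0⟩ := hsurj w (by omega) (by omega)
  have e : ∀ p ∈ Finset.univ.filter (fun p => (W p).toNat = w),
      (ggWt W p : ℂ) * ω ^ (W p) = (ggWt W p0 : ℂ) * ω ^ w := by
    intro p hp
    simp only [Finset.mem_filter, Finset.mem_univ, true_and] at hp
    have h1 : W p = w := by
      have := h0 p
      omega
    rw [ggWt, ggWt, h1, hp0, zpow_natCast]
  rw [Finset.sum_congr rfl e, Finset.sum_const]
  have e2 : (Finset.univ.filter (fun p => (W p).toNat = w)) =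
      Finset.univ.filter (fun q => W q = W p0) := by
    ext p
    simp only [Finset.mem_filter, Finset.mem_univ, true_and]
    have := h0 p
    omega
  have h3 := ggWt_pos W p0
  rw [e2, nsmul_eq_mul, ← mul_assoc]
  have : ((Finset.univ.filter (fun q => W q = W p0)).card : ℂ) * (ggWt W p0 : ℂ) = 1 := by
    rw [ggWt] at h3 ⊢
    have h4 := inv_pos.1 h3
    push_cast
    exact mul_inv_cancel₀ (by exact_mod_cast h4.ne')
  rw [this, one_mul]

theorem gg_distinct {D : Type*} [Fintype D] {W : D → ℤ} {N : ℕ} (hN1 : 1 ≤ N)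
    (h0 : ∀ p, 0 ≤ W p) (hN : ∀ p, W p ≤ N)
    (hsurj : ∀ w : ℤ, 0 ≤ w → w ≤ N → ∃ p, W p = w) (px py : D → ℝ)
    {σ : D → D} (hσ : ∀ p, σ (σ p) = p) (hc : ∀ p, W p + W (σ p) = N)
    (hy : ∀ p, py (σ p) = py p) (hx : ∀ p, W p = 0 → px p < px (σ p))
    {τ : D → D} (hτ : ∀ p, τ (τ p) = p) {c : ℤ} (hc' : ∀ p, ((N : ℤ) + 1) ∣ W p + W (τ p) - c)
    (k : ℝ) (hk : ∀ p, px (τ p) + k * py (τ p) = px p + k * py p) :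
    ¬ ((N : ℤ) + 1) ∣ (N : ℤ) - c := by
  intro hdvd
  have hW : ∀ p, W p + W (τ p) = N := by
    intro p
    have h1 := dvd_sub (hc' p) hdvd
    have h2 : W p + W (τ p) - c - (N - c) = W (τ p) - W (σ p) := by
      have := hc p
      linarith
    rw [h2] at h1
    have := Int.eq_zero_of_abs_lt_dvd h1 (by
      rw [abs_lt]
      have := h0 (σ p)
      have := h0 (τ p)
      have := hN (σ p)
      have := hN (τ p)
      constructor <;> linarith)
    have := hc p
    linarith
  have gen : ∀ (s : D → D), (∀ p, s (s p) = p) → (∀ p, W p + W (s p) = N) →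
      ∑ p ∈ Finset.univ.filter (fun p => W p = 0), (px (s p) + k * py (s p)) =
      ∑ p ∈ Finset.univ.filter (fun p => W p = N), (px p + k * py p) := by
    intro s hs hsW
    apply Finset.sum_nbij' s s
    · intro p hp
      simp only [Finset.mem_filter, Finset.mem_univ, true_and] at hp ⊢
      have := hsW p
      omega
    · intro p hp
      simp only [Finset.mem_filter, Finset.mem_univ, true_and] at hp ⊢
      have := hsW p
      omega
    · intro p _
      exact hs p
    · intro p _
      exact hs p
    · intro p _
      rfl
  have h1 := (gen σ hσ hc).trans (gen τ hτ hW).symm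
  simp only [hk] at h1
  have h2 : ∑ p ∈ Finset.univ.filter (fun p => W p = 0), (px p + k * py p) <
      ∑ p ∈ Finset.univ.filter (fun p => W p = 0), (px (σ p) + k * py (σ p)) := by
    apply Finset.sum_lt_sum_of_nonempty
    · obtain ⟨p, hp⟩ := hsurj 0 le_rfl (by omega)
      exact ⟨p, by simp [hp]⟩
    · intro p hp
      simp only [Finset.mem_filter, Finset.mem_univ, true_and] at hp
      have := hx p hp
      rw [hy]
      linarith
  linarith

theorem gg_nonzero {D : Type*} [Fintype D] {W : D → ℤ} {N : ℕ} (hN3 : 3 ≤ N) (hodd : Odd N)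
    (h0 : ∀ p, 0 ≤ W p) (hN : ∀ p, W p ≤ N)
    (hsurj : ∀ w : ℤ, 0 ≤ w → w ≤ N → ∃ p, W p = w) (py : D → ℝ)
    {σ : D → D} (hc : ∀ p, W p + W (σ p) = N) (hy : ∀ p, py (σ p) = py p)
    (L : D → Prop) (hL : ∀ p, L p ∨ L (σ p)) (hLW : ∀ p, L p → 2 * W p + 1 ≤ N)
    (hmono : ∀ p q, L p → L q → py q ≤ py p → W p ≤ W q) :
    ∑ p, (ggWt W p : ℂ) * (Complex.exp (2 * Real.pi * Complex.I / ((N + 1 : ℕ) : ℂ))) ^ (W p) *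
      (py p : ℂ) ≠ 0 := by
  intro hzero
  have hpi := Real.pi_pos
  have hn0 : (0 : ℝ) < N + 1 := by positivity
  set ω := Complex.exp (2 * Real.pi * Complex.I / ((N + 1 : ℕ) : ℂ)) with hω
  have hprim : IsPrimitiveRoot ω (N + 1) := Complex.isPrimitiveRoot_exp _ (by omega)
  have hz2 := gg_sum_wt (by omega) h0 hN hsurj hprim
  let C : D → ℝ := fun p => Real.cos (Real.pi * (2 * W p + 1) / (N + 1))
  let θ := Complex.exp (Real.pi * Complex.I / ((N + 1 : ℕ) : ℂ))
  have hre : ∀ p, (θ * ω ^ (W p)).re = C p := by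
    intro p
    have : θ * ω ^ (W p) = Complex.exp ((Real.pi * (2 * W p + 1) / (N + 1) : ℝ) * Complex.I) := by
      rw [hω, ← Complex.exp_int_mul, ← Complex.exp_add]
      congr 1
      push_cast
      have : (N : ℂ) + 1 ≠ 0 := by exact_mod_cast hn0.ne'
      field_simp
      ring
    rw [this, Complex.exp_ofReal_mul_I_re]
  have s1 : ∑ p, ggWt W p * C p * py p = 0 := by
    have := congrArg (fun z => (θ * z).re) hzero
    simp only [Finset.mul_sum, Complex.re_sum, mul_zero, Complex.zero_re] at this
    rw [← this]
    apply Finset.sum_congr rfl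
    intro p _
    rw [← hre p]
    have : θ * ((ggWt W p : ℂ) * ω ^ W p * (py p : ℂ)) =
      ((ggWt W p * py p : ℝ) : ℂ) * (θ * ω ^ W p) := by push_cast; ring
    rw [this, Complex.re_ofReal_mul]
    ring
  have s2 : ∑ p, ggWt W p * C p = 0 := by
    have := congrArg (fun z => (θ * z).re) hz2
    simp only [Finset.mul_sum, Complex.re_sum, mul_zero, Complex.zero_re] at this
    rw [← this]
    apply Finset.sum_congr rfl
    intro p _
    rw [← hre p]
    have : θ * ((ggWt W p : ℂ) * ω ^ W p) =
      ((ggWt W p : ℝ) : ℂ) * (θ * ω ^ W p) := by ring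
    rw [this, Complex.re_ofReal_mul]
  have hCσ : ∀ p, C (σ p) = C p := by
    intro p
    simp only [C]
    have h1 : (W (σ p) : ℝ) = N - W p := by
      have : W (σ p) = N - W p := by linarith [hc p]
      rw [this]
      push_cast
      ring
    have h2 : Real.pi * (2 * (W (σ p) : ℝ) + 1) / (N + 1) =
        2 * Real.pi - Real.pi * (2 * W p + 1) / (N + 1) := by
      rw [h1]
      field_simp
      ring
    rw [h2, Real.cos_two_pi_sub]
  have hleft : ∀ p q, L p → L q → C q < C p → py q < py p := by
    intro p q hp hq hlt
    by_contra hcon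
    have h1 := hmono q p hq hp (not_lt.1 hcon)
    apply absurd hlt
    rw [not_lt]
    apply Real.cos_le_cos_of_nonneg_of_le_pi
    · have : (0 : ℝ) ≤ W q := by exact_mod_cast h0 q
      positivity
    · rw [div_le_iff₀ hn0]
      have : (2 : ℝ) * W p + 1 ≤ N := by exact_mod_cast hLW p hp
      nlinarith
    · have : (W q : ℝ) ≤ W p := by exact_mod_cast h1
      gcongr
  have hall : ∀ p q, C q < C p → py q < py p := by
    intro p q hlt
    rcases hL p with hp | hp <;> rcases hL q with hq | hq
    · exact hleft p q hp hq hlt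
    · rw [← hy q]
      exact hleft p _ hp hq (by rwa [hCσ])
    · rw [← hy p]
      exact hleft _ q hp hq (by rwa [hCσ])
    · rw [← hy p, ← hy q]
      exact hleft _ _ hp hq (by rwa [hCσ, hCσ])
  have hN3' : (3 : ℝ) ≤ N := by exact_mod_cast hN3
  obtain ⟨r, hr⟩ := hodd
  obtain ⟨q0, hq0⟩ := hsurj r (by omega) (by omega)
  obtain ⟨p0, hp0⟩ := hsurj 0 (by omega) (by omega)
  have hCq0 : C q0 < 0 := by
    have e : (2 * (W q0 : ℝ) + 1) = N := by
      rw [hq0, hr]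
      push_cast
      ring
    simp only [C]
    rw [e]
    apply Real.cos_neg_of_pi_div_two_lt_of_lt
    · rw [lt_div_iff₀ hn0]
      nlinarith
    · rw [div_lt_iff₀ hn0]
      nlinarith
  have hCp0 : 0 < C p0 := by
    simp only [C, hp0]
    apply Real.cos_pos_of_mem_Ioo
    constructor
    · have : 0 < Real.pi * (2 * ((0 : ℤ) : ℝ) + 1) / (N + 1) := by
        push_cast
        positivity
      linarith
    · rw [div_lt_iff₀ hn0]
      push_cast
      nlinarith
  obtain ⟨m, hm, hmax⟩ := (Finset.univ.filter (fun q => C q < 0)).exists_max_image py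
    ⟨q0, by simp [hCq0]⟩
  simp only [Finset.mem_filter, Finset.mem_univ, true_and] at hm hmax
  have hpos : ∀ p, 0 < C p → 0 < ggWt W p * C p * (py p - py m) := by
    intro p hp
    have := hall p m (hm.trans hp)
    exact mul_pos (mul_pos (ggWt_pos W p) hp) (by linarith)
  have hsum : 0 < ∑ p, ggWt W p * C p * (py p - py m) := by
    apply Finset.sum_pos'
    · intro p _
      rcases lt_trichotomy (C p) 0 with h1 | h1 | h1
      · have := hmax p h1
        exact mul_nonneg_of_nonpos_of_nonpos
          (mul_nonpos_of_nonneg_of_nonpos (ggWt_pos W p).le h1.le) (by linarith)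
      · rw [h1]
        simp
      · exact (hpos p h1).le
    · exact ⟨p0, Finset.mem_univ _, hpos p0 hCp0⟩
  simp only [mul_sub, Finset.sum_sub_distrib, ← Finset.sum_mul] at hsum
  rw [s1, s2] at hsum
  simp at hsum
theorem gg_core {D : Type*} [Fintype D] [Nonempty D] (lab : D → Bool) (px py nx ny : D → ℝ)
    (hsep : ∀ p q, lab p ≠ lab q → 0 < nx p * (px p - px q) + ny p * (py p - py q))
    (σ₁ σ₂ σ₃ σ₄ : D → D)
    (i₁ : ∀ p, σ₁ (σ₁ p) = p) (i₂ : ∀ p, σ₂ (σ₂ p) = p)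
    (i₃ : ∀ p, σ₃ (σ₃ p) = p) (i₄ : ∀ p, σ₄ (σ₄ p) = p)
    (l₁ : ∀ p, lab (σ₁ p) ≠ lab p) (l₂ : ∀ p, lab (σ₂ p) ≠ lab p)
    (l₃ : ∀ p, lab (σ₃ p) ≠ lab p) (l₄ : ∀ p, lab (σ₄ p) ≠ lab p)
    (f₁ : ∀ p, py (σ₁ p) = py p) (f₂ : ∀ p, px (σ₂ p) = px p)
    (f₃ : ∀ p, px (σ₃ p) + py (σ₃ p) = px p + py p)
    (f₄ : ∀ p, px (σ₄ p) + 8 * py (σ₄ p) = px p + 8 * py p) : False := by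
  have hpi := Real.pi_pos
  have hn0 : ∀ p, nx p ≠ 0 ∨ ny p ≠ 0 := by
    intro p
    by_contra hc
    push Not at hc
    have := hsep p (σ₁ p) (l₁ p).symm
    rw [hc.1, hc.2] at this
    simp at this
  choose ρ φ hρ hφx hφy using fun p => gg_polar (nx p) (ny p) (hn0 p)
  choose κ hκ1 hκ2 using fun p => gg_shift (φ p) (Real.pi / 2)
  set ψ : D → ℝ := fun p => φ p + 2 * Real.pi * κ p with hψ
  have hnx : ∀ p, nx p = ρ p * Real.cos (ψ p) := fun p => by
    rw [hψ]; simp only []; rw [gg_cos_shift, hφx]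
  have hny : ∀ p, ny p = ρ p * Real.sin (ψ p) := fun p => by
    rw [hψ]; simp only []; rw [gg_sin_shift, hφy]
  have hψlab : ∀ p q, ψ p = ψ q → lab p = lab q := by
    intro p q hpq
    by_contra hne
    have h1 := hsep p q hne
    have h2 := hsep q p (Ne.symm hne)
    rw [hnx, hny, hpq] at h1
    rw [hnx q, hny q] at h2
    have e1 : ρ p * Real.cos (ψ q) * (px p - px q) + ρ p * Real.sin (ψ q) * (py p - py q) =
      ρ p * (Real.cos (ψ q) * (px p - px q) + Real.sin (ψ q) * (py p - py q)) := by ring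
    have e2 : ρ q * Real.cos (ψ q) * (px q - px p) + ρ q * Real.sin (ψ q) * (py q - py p) =
      ρ q * -(Real.cos (ψ q) * (px p - px q) + Real.sin (ψ q) * (py p - py q)) := by ring
    rw [e1] at h1
    rw [e2] at h2
    have h3 := (pos_iff_pos_of_mul_pos h1).1 (hρ p)
    have h4 := (pos_iff_pos_of_mul_pos h2).1 (hρ q)
    linarith
  obtain ⟨W, N, hlin, h0, hN, hsurj⟩ := gg_exists_index lab ψ hψlab
  obtain ⟨g1, g2, g3, g4⟩ := gg_geom px py nx ny ρ ψ 1 0 1 0 one_pos (by simp) (by simp)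
    hρ hnx hny (fun p => by linarith [hκ1 p]) (fun p => by linarith [hκ2 p]) hsep σ₁ l₁
    (fun p => by rw [f₁]; ring)
  obtain ⟨c, hc⟩ := hlin.refl _ (fun p => 1 * py p - 0 * px p) σ₁ g1 g2 i₁ l₁
    (fun p => by simp only [f₁]; ring) g3
  have hcN : c = N := by
    obtain ⟨p, hp⟩ := hsurj 0 le_rfl (by omega)
    obtain ⟨q, hq⟩ := hsurj N (by omega) le_rfl
    have a1 := hc p
    have a2 := hc q
    have a3 := hN (σ₁ p)
    have a4 := h0 (σ₁ q)
    omega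
  subst hcN
  have hodd : Odd N := by
    obtain ⟨p⟩ := ‹Nonempty D›
    have h3 : ¬ Even (W (σ₁ p) - W p) := fun h4 => l₁ p ((hlin.par _ _).1 h4)
    rw [Int.not_even_iff_odd] at h3
    obtain ⟨m, hm⟩ := h3
    have h5 : Odd (N : ℤ) := ⟨m + W p, by rw [← hc p]; linarith⟩
    exact_mod_cast h5
  have hN1 : 1 ≤ N := hodd.pos
  have hw1 : ∀ p, Real.pi / 2 ≤ ψ p := hκ1
  have hw2 : ∀ p, ψ p < Real.pi / 2 + 2 * Real.pi := hκ2
  have dir := fun a b hab σ hσ hl hf => gg_direction (γ := Real.pi / 2) px py nx ny ρ ψ a b hab hρ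
    hnx hny hsep hlin hw1 hw2 h0 hN hsurj hodd σ hσ hl hf
  obtain ⟨c₂, o₂, hc₂⟩ := dir 0 (-1) (by norm_num) σ₂ i₂ l₂ (fun p => by linarith [f₂ p])
  obtain ⟨c₃, o₃, hc₃⟩ := dir 1 (-1) (by norm_num) σ₃ i₃ l₃ (fun p => by linarith [f₃ p])
  obtain ⟨c₄, o₄, hc₄⟩ := dir 8 (-1) (by norm_num) σ₄ i₄ l₄ (fun p => by linarith [f₄ p])
  have hc₁ : ∀ p, ((N : ℤ) + 1) ∣ W p + W (σ₁ p) - N := fun p => by rw [hc p]; simp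
  have hleftW : ∀ p, ψ p < 0 + 3 * Real.pi / 2 → 2 * W p + 1 ≤ N := by
    intro p hp
    have h1 := (g3 p).1 hp
    have h2 := hlin.mono p (σ₁ p) (by linarith)
    have h3 := hc p
    obtain ⟨m, hm⟩ := hodd
    omega
  have hx : ∀ p, W p = 0 → px p < px (σ₁ p) := by
    intro p hp
    have hpl : ψ p < 0 + 3 * Real.pi / 2 := by
      by_contra hcon
      have h1 := (g3 (σ₁ p)).2 (by rw [i₁]; exact not_lt.1 hcon)
      have h2 := hleftW _ h1
      have h3 := hc p
      omega
    have := g4 p hpl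
    linarith
  have d₃ := gg_distinct hN1 h0 hN hsurj px py i₁ hc f₁ hx i₃ hc₃ 1
    (fun p => by linarith [f₃ p])
  have d₄ := gg_distinct hN1 h0 hN hsurj px py i₁ hc f₁ hx i₄ hc₄ 8 f₄
  have hN3 : 3 ≤ N := by
    by_contra hcon
    have : N = 1 := by
      obtain ⟨m, hm⟩ := hodd
      omega
    subst this
    apply d₃
    obtain ⟨m, hm⟩ := o₃
    exact ⟨-m, by rw [hm]; push_cast; ring⟩
  have hY := gg_nonzero hN3 hodd h0 hN hsurj py hc f₁ (fun p => ψ p < 0 + 3 * Real.pi / 2)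
    (fun p => by
      by_cases hp : ψ p < 0 + 3 * Real.pi / 2
      · exact Or.inl hp
      · exact Or.inr ((g3 (σ₁ p)).2 (by rw [i₁]; exact not_lt.1 hp)))
    hleftW (fun p q hp hq hpq => hlin.half_mono (fun p => ψ p < 0 + 3 * Real.pi / 2)
      (fun p => 1 * py p - 0 * px p) (fun _ _ _ _ hq _ h4 => h4.trans hq) g1 hp hq
      (by linarith))
  set ω := Complex.exp (2 * Real.pi * Complex.I / ((N + 1 : ℕ) : ℂ)) with hω
  have hprim : IsPrimitiveRoot ω (N + 1) := Complex.isPrimitiveRoot_exp _ (by omega)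
  have hω1 := hprim.pow_eq_one
  have hω0 : ω ≠ 0 := Complex.exp_ne_zero _
  have e₁ := gg_fourier h0 hN i₁ hc₁ py f₁ hω1
  have e₂ := gg_fourier h0 hN i₂ hc₂ px f₂ hω1
  have e₃ := gg_fourier h0 hN i₃ hc₃ (fun p => px p + py p) f₃ hω1
  have e₄ := gg_fourier h0 hN i₄ hc₄ (fun p => px p + 8 * py p) f₄ hω1
  set X := ∑ p, (ggWt W p : ℂ) * ω ^ (W p) * (px p : ℂ) with hX
  set Y := ∑ p, (ggWt W p : ℂ) * ω ^ (W p) * (py p : ℂ) with hYdef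
  have t₃ : ∑ p, (ggWt W p : ℂ) * ω ^ (W p) * ((px p + py p : ℝ) : ℂ) = X + Y := by
    rw [hX, hYdef, ← Finset.sum_add_distrib]
    apply Finset.sum_congr rfl
    intro p _
    push_cast
    ring
  have t₄ : ∑ p, (ggWt W p : ℂ) * ω ^ (W p) * ((px p + 8 * py p : ℝ) : ℂ) = X + 8 * Y := by
    rw [hX, hYdef, Finset.mul_sum, ← Finset.sum_add_distrib]
    apply Finset.sum_congr rfl
    intro p _
    push_cast
    ring
  rw [t₃, map_add] at e₃
  rw [t₄, map_add, map_mul, map_ofNat] at e₄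
  have hY' : (starRingEnd ℂ) Y ≠ 0 := by
    rw [Ne, map_eq_zero]
    exact hY
  have hpow : ∀ k : ℤ, (ω ^ k) ^ (N + 1) = 1 := by
    intro k
    rw [← zpow_natCast, ← zpow_mul, mul_comm, zpow_mul, zpow_natCast, hω1, one_zpow]
  have hne : ∀ k l : ℤ, ¬ ((N : ℤ) + 1) ∣ k - l → ω ^ k ≠ ω ^ l := by
    intro k l hkl heq
    apply hkl
    have := (hprim.zpow_eq_one_iff_dvd (k - l)).1 (by
      rw [zpow_sub₀ hω0, heq, div_self (zpow_ne_zero _ hω0)])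
    exact_mod_cast this
  have n₃ := hne _ _ d₃
  have n₄ := hne _ _ d₄
  have p₁ := hpow N
  have p₂ := hpow c₂
  have p₃ := hpow c₃
  have p₄ := hpow c₄
  generalize (starRingEnd ℂ) Y = y at *
  generalize (starRingEnd ℂ) X = x at *
  generalize ω ^ (N : ℤ) = z₁ at *
  generalize ω ^ c₂ = z₂ at *
  generalize ω ^ c₃ = z₃ at *
  generalize ω ^ c₄ = z₄ at *
  have q₃ : (z₂ - z₃) * x = (z₃ - z₁) * y := by linear_combination e₃ - e₁ - e₂
  have q₄ : (z₂ - z₄) * x = 8 * ((z₄ - z₁) * y) := by linear_combination e₄ - 8 * e₁ - e₂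
  have r₃ : (z₃ - z₁) * y ≠ 0 := mul_ne_zero (sub_ne_zero.2 n₃.symm) hY'
  have r₄ : (z₄ - z₁) * y ≠ 0 := mul_ne_zero (sub_ne_zero.2 n₄.symm) hY'
  have hx0 : x ≠ 0 := by
    rintro rfl
    rw [mul_zero] at q₃
    exact r₃ q₃.symm
  have n₂₄ : z₂ ≠ z₄ := by
    rintro rfl
    rw [sub_self, zero_mul] at q₄
    exact r₄ (by linear_combination -q₄ / 8)
  have hint : ∀ z : ℂ, z ^ (N + 1) = 1 → IsIntegral ℤ z := fun z hz =>
    IsIntegral.of_pow (Nat.succ_pos N) (by rw [hz]; exact isIntegral_one)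
  apply gg_not_eight (Nat.succ_pos N) (α := (z₂ - z₃) * (z₄ - z₁)) p₃ p₁ p₂ p₄ n₃.symm n₂₄
    (((hint _ p₂).sub (hint _ p₃)).mul ((hint _ p₄).sub (hint _ p₁)))
  apply mul_right_cancel₀ (mul_ne_zero hx0 hY')
  linear_combination 8 * (z₄ - z₁) * y * q₃ - (z₃ - z₁) * y * q₄
theorem gg_invol {α β : Type*} [DecidableEq α] [DecidableEq β] (F F' : Finset α) (q : α → β)
    (h : ∀ T, (F'.filter (fun x => q x = T)).card = (F.filter (fun x => q x = T)).card) :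
    ∃ σ : α → α, ∀ x, ((x ∈ F ∧ x ∉ F') ∨ (x ∈ F' ∧ x ∉ F)) →
      ((σ x ∈ F ∧ σ x ∉ F') ∨ (σ x ∈ F' ∧ σ x ∉ F)) ∧ σ (σ x) = x ∧
      (σ x ∈ F ↔ x ∉ F) ∧ q (σ x) = q x := by
  have h1 : ∀ T, ((F \ F').filter (fun x => q x = T)).card =
      ((F' \ F).filter (fun x => q x = T)).card := by
    intro T
    have e1 := Finset.card_sdiff_add_card_inter (F.filter (fun x => q x = T))
      (F'.filter (fun x => q x = T))
    have e2 := Finset.card_sdiff_add_card_inter (F'.filter (fun x => q x = T))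
      (F.filter (fun x => q x = T))
    rw [Finset.inter_comm, h T] at e2
    have e3 : (F \ F').filter (fun x => q x = T) =
        F.filter (fun x => q x = T) \ F'.filter (fun x => q x = T) := by
      ext x
      simp only [Finset.mem_filter, Finset.mem_sdiff]
      tauto
    have e4 : (F' \ F).filter (fun x => q x = T) =
        F'.filter (fun x => q x = T) \ F.filter (fun x => q x = T) := by
      ext x
      simp only [Finset.mem_filter, Finset.mem_sdiff]
      tauto
    rw [e3, e4]
    omega
  have h2 : ∀ T, Nonempty ({a : {x // x ∈ F \ F'} // q a.1 = T} ≃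
      {b : {x // x ∈ F' \ F} // q b.1 = T}) := by
    intro T
    have c : ∀ G : Finset α, Fintype.card {a : {x // x ∈ G} // q a.1 = T} =
        (G.filter (fun x => q x = T)).card := by
      intro G
      rw [← Fintype.card_coe]
      apply Fintype.card_congr
      exact
        { toFun := fun a => ⟨a.1.1, Finset.mem_filter.2 ⟨a.1.2, a.2⟩⟩
          invFun := fun a => ⟨⟨a.1, (Finset.mem_filter.1 a.2).1⟩, (Finset.mem_filter.1 a.2).2⟩
          left_inv := fun _ => rfl
          right_inv := fun _ => rfl }
    rw [← Fintype.card_eq, c, c, h1]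
  let E : ∀ T, ({a : {x // x ∈ F \ F'} // q a.1 = T} ≃ {b : {x // x ∈ F' \ F} // q b.1 = T}) :=
    fun T => (h2 T).some
  let e : {x // x ∈ F \ F'} ≃ {x // x ∈ F' \ F} :=
    (Equiv.sigmaFiberEquiv (fun a : {x // x ∈ F \ F'} => q a.1)).symm.trans
      ((Equiv.sigmaCongrRight E).trans (Equiv.sigmaFiberEquiv (fun b : {x // x ∈ F' \ F} => q b.1)))
  have he : ∀ a, q (e a).1 = q a.1 := fun a => (E (q a.1) ⟨a, rfl⟩).2
  have he' : ∀ b, q (e.symm b).1 = q b.1 := fun b => by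
    rw [← he, Equiv.apply_symm_apply]
  let σ : α → α := fun x => if hx : x ∈ F \ F' then (e ⟨x, hx⟩).1 else
    if hx : x ∈ F' \ F then (e.symm ⟨x, hx⟩).1 else x
  have s1 : ∀ x (hx : x ∈ F \ F'), σ x = (e ⟨x, hx⟩).1 := fun x hx => by
    simp only [σ, dif_pos hx]
  have s2 : ∀ x (hx : x ∈ F' \ F), σ x = (e.symm ⟨x, hx⟩).1 := fun x hx => by
    have : x ∉ F \ F' := by
      simp only [Finset.mem_sdiff] at hx ⊢
      tauto
    simp only [σ, dif_neg this, dif_pos hx]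
  refine ⟨σ, ?_⟩
  rintro x (hx | hx)
  · have hx' : x ∈ F \ F' := Finset.mem_sdiff.2 hx
    have m := (e ⟨x, hx'⟩).2
    have m' := Finset.mem_sdiff.1 m
    rw [s1 x hx']
    refine ⟨Or.inr m', ?_, ?_, he _⟩
    · rw [s2 _ m]
      simp
    · tauto
  · have hx' : x ∈ F' \ F := Finset.mem_sdiff.2 hx
    have m := (e.symm ⟨x, hx'⟩).2
    have m' := Finset.mem_sdiff.1 m
    rw [s2 x hx']
    refine ⟨Or.inl m', ?_, ?_, he' _⟩
    · rw [s1 _ m]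
      simp
    · tauto

theorem gg_embed_inj {d : ℕ} : Function.Injective (embed : (Fin d → ℤ) → (Fin d → ℝ)) := by
  intro x y h
  funext i
  have := congrFun h i
  simpa [embed] using this

theorem gg_sep {d : ℕ} {F : Finset (Fin d → ℤ)} (hF : IsConvexLatticeSet F) {x : Fin d → ℤ}
    (hx : x ∉ F) : ∃ g : (Fin d → ℝ) →ₗ[ℝ] ℝ, ∀ y ∈ F, g (embed y) < g (embed x) := by
  have h1 : embed x ∉ convexHull ℝ (embed '' (F : Set (Fin d → ℤ))) := by
    intro hc
    have : embed x ∈ embed '' (F : Set (Fin d → ℤ)) := by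
      rw [hF]
      exact ⟨hc, x, rfl⟩
    obtain ⟨y, hy, hyx⟩ := this
    rw [gg_embed_inj hyx] at hy
    exact hx hy
  have hfin : (embed '' (F : Set (Fin d → ℤ))).Finite := F.finite_toSet.image _
  obtain ⟨g, u, hg1, hg2⟩ := geometric_hahn_banach_closed_point (convex_convexHull ℝ _)
    (hfin.isClosed_convexHull ℝ) h1
  exact ⟨g.toLinearMap, fun y hy => (hg1 _ (subset_convexHull ℝ _ ⟨y, hy, rfl⟩)).trans hg2⟩

def ggVec {d : ℕ} (i₀ i₁ : Fin d) (a b : ℤ) : Fin d → ℤ := Pi.single i₀ a + Pi.single i₁ b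

def ggLine {d : ℕ} (i₀ i₁ : Fin d) (a b : ℤ) : Submodule ℝ (Fin d → ℝ) :=
  Submodule.span ℝ {fun i => (ggVec i₀ i₁ a b i : ℝ)}

theorem ggVec_zero {d : ℕ} {i₀ i₁ : Fin d} (h : i₀ ≠ i₁) (a b : ℤ) : ggVec i₀ i₁ a b i₀ = a := by
  simp [ggVec, h]

theorem ggVec_one {d : ℕ} {i₀ i₁ : Fin d} (h : i₀ ≠ i₁) (a b : ℤ) : ggVec i₀ i₁ a b i₁ = b := by
  simp [ggVec, h.symm]

theorem ggVec_other {d : ℕ} {i₀ i₁ : Fin d} (a b : ℤ) {i : Fin d} (h0 : i ≠ i₀) (h1 : i ≠ i₁) :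
    ggVec i₀ i₁ a b i = 0 := by
  simp [ggVec, h0, h1]

theorem ggLine_lattice {d : ℕ} {i₀ i₁ : Fin d} (h : i₀ ≠ i₁) (a b : ℤ) (hab : a ≠ 0 ∨ b ≠ 0) :
    IsLatticeLine (ggLine i₀ i₁ a b) := by
  refine ⟨ggVec i₀ i₁ a b, ?_, rfl⟩
  intro hc
  have h1 := congrFun hc i₀
  have h2 := congrFun hc i₁
  rw [ggVec_zero h] at h1
  rw [ggVec_one h] at h2
  simp at h1 h2
  tauto

theorem ggLine_mem {d : ℕ} {i₀ i₁ : Fin d} (h : i₀ ≠ i₁) {a b : ℤ} {x : Fin d → ℝ}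
    (hx : x ∈ ggLine i₀ i₁ a b) :
    (a : ℝ) * x i₁ - b * x i₀ = 0 ∧ ∀ i, i ≠ i₀ → i ≠ i₁ → x i = 0 := by
  obtain ⟨t, rfl⟩ := Submodule.mem_span_singleton.1 hx
  constructor
  · simp only [Pi.smul_apply, smul_eq_mul, ggVec_zero h, ggVec_one h]
    ring
  · intro i h0 h1
    simp [ggVec_other a b h0 h1]

theorem ggLine_ne {d : ℕ} {i₀ i₁ : Fin d} (h : i₀ ≠ i₁) {a b a' b' : ℤ}
    (hab : a * b' - b * a' ≠ 0) : ggLine i₀ i₁ a b ≠ ggLine i₀ i₁ a' b' := by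
  intro hc
  have hm : (fun i => (ggVec i₀ i₁ a' b' i : ℝ)) ∈ ggLine i₀ i₁ a b := by
    rw [hc]
    exact Submodule.mem_span_singleton_self _
  have := (ggLine_mem h hm).1
  rw [ggVec_zero h, ggVec_one h] at this
  exact hab (by exact_mod_cast this)

theorem gg_line_invol {d : ℕ} {i₀ i₁ : Fin d} (h : i₀ ≠ i₁) (a b : ℤ)
    (F F' : Finset (Fin d → ℤ)) (hX : XrayEq (ggLine i₀ i₁ a b) (embed '' ↑F') (embed '' ↑F)) :
    ∃ σ : (Fin d → ℤ) → (Fin d → ℤ), ∀ x, ((x ∈ F ∧ x ∉ F') ∨ (x ∈ F' ∧ x ∉ F)) →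
      ((σ x ∈ F ∧ σ x ∉ F') ∨ (σ x ∈ F' ∧ σ x ∉ F)) ∧ σ (σ x) = x ∧
      (σ x ∈ F ↔ x ∉ F) ∧
      ((a : ℝ) * (σ x i₁ : ℝ) - b * (σ x i₀ : ℝ) = a * (x i₁ : ℝ) - b * (x i₀ : ℝ)) ∧
      ∀ i, i ≠ i₀ → i ≠ i₁ → σ x i = x i := by
  classical
  let q : (Fin d → ℤ) → (Fin d → ℝ) ⧸ ggLine i₀ i₁ a b := fun x => Submodule.Quotient.mk (embed x)
  have hcard : ∀ (G : Finset (Fin d → ℤ)) T, (embed '' (G : Set (Fin d → ℤ)) ∩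
      fiber (ggLine i₀ i₁ a b) T).ncard = (G.filter (fun x => q x = T)).card := by
    intro G T
    have : embed '' (G : Set (Fin d → ℤ)) ∩ fiber (ggLine i₀ i₁ a b) T =
        embed '' ((G.filter (fun x => q x = T) : Finset (Fin d → ℤ)) : Set (Fin d → ℤ)) := by
      ext y
      constructor
      · rintro ⟨⟨x, hx, rfl⟩, hy⟩
        exact ⟨x, Finset.mem_coe.2 (Finset.mem_filter.2 ⟨hx, hy⟩), rfl⟩
      · rintro ⟨x, hx, rfl⟩
        have := Finset.mem_filter.1 (Finset.mem_coe.1 hx)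
        exact ⟨⟨x, this.1, rfl⟩, this.2⟩
    rw [this, Set.ncard_image_of_injective _ gg_embed_inj, Set.ncard_coe_finset]
  obtain ⟨σ, hσ⟩ := gg_invol F F' q (fun T => by rw [← hcard, ← hcard]; exact hX T)
  refine ⟨σ, fun x hx => ?_⟩
  obtain ⟨a1, a2, a3, a4⟩ := hσ x hx
  have a5 := ggLine_mem h ((Submodule.Quotient.eq _).1 a4)
  refine ⟨a1, a2, a3, ?_, ?_⟩
  · have := a5.1
    simp only [Pi.sub_apply, embed] at this
    linarith
  · intro i h0 h1
    have := a5.2 i h0 h1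
    simp only [Pi.sub_apply, embed] at this
    have h2 : (σ x i : ℝ) = x i := by linarith
    exact_mod_cast h2

theorem gg_plane {d : ℕ} {i₀ i₁ : Fin d} (h : i₀ ≠ i₁) (g : (Fin d → ℝ) →ₗ[ℝ] ℝ)
    {x y : Fin d → ℤ} (hxy : ∀ i, i ≠ i₀ → i ≠ i₁ → x i = y i) :
    g (embed x) - g (embed y) = g (Pi.single i₀ 1) * ((x i₀ : ℝ) - y i₀) +
      g (Pi.single i₁ 1) * ((x i₁ : ℝ) - y i₁) := by
  have : embed x - embed y = ((x i₀ : ℝ) - y i₀) • (Pi.single i₀ 1 : Fin d → ℝ) +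
      ((x i₁ : ℝ) - y i₁) • (Pi.single i₁ 1 : Fin d → ℝ) := by
    funext i
    by_cases h0 : i = i₀
    · subst h0
      simp [embed, h]
    · by_cases h1 : i = i₁
      · subst h1
        simp [embed, h.symm]
      · simp [embed, h0, h1, hxy i h0 h1]
  rw [← map_sub, this, map_add, map_smul, map_smul, smul_eq_mul, smul_eq_mul]
  ring

theorem gardner_gritzmann_four_directions
    (d : ℕ) (hd : 2 ≤ d) :
    ∃ S₁ S₂ S₃ S₄ : Submodule ℝ (Fin d → ℝ),
      IsLatticeLine S₁ ∧ IsLatticeLine S₂ ∧ IsLatticeLine S₃ ∧ IsLatticeLine S₄ ∧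
      S₁ ≠ S₂ ∧ S₁ ≠ S₃ ∧ S₁ ≠ S₄ ∧ S₂ ≠ S₃ ∧ S₂ ≠ S₄ ∧ S₃ ≠ S₄ ∧
      ∀ F F' : Finset (Fin d → ℤ), IsConvexLatticeSet F → IsConvexLatticeSet F' →
        TomEq {S₁, S₂, S₃, S₄} (embed '' ↑F') (embed '' ↑F) → F' = F := by
  classical
  let i₀ : Fin d := ⟨0, by omega⟩
  let i₁ : Fin d := ⟨1, by omega⟩
  have h : i₀ ≠ i₁ := by simp [i₀, i₁]
  refine ⟨ggLine i₀ i₁ 1 0, ggLine i₀ i₁ 0 (-1), ggLine i₀ i₁ 1 (-1), ggLine i₀ i₁ 8 (-1),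
    ggLine_lattice h _ _ (by norm_num), ggLine_lattice h _ _ (by norm_num),
    ggLine_lattice h _ _ (by norm_num), ggLine_lattice h _ _ (by norm_num),
    ggLine_ne h (by norm_num), ggLine_ne h (by norm_num), ggLine_ne h (by norm_num),
    ggLine_ne h (by norm_num), ggLine_ne h (by norm_num), ggLine_ne h (by norm_num), ?_⟩
  intro F F' hF hF' hT
  by_contra hne
  have hw : ∃ w, (w ∈ F ∧ w ∉ F') ∨ (w ∈ F' ∧ w ∉ F) := by
    by_contra hc
    push Not at hc
    apply hne
    ext x
    exact ⟨fun hx => (hc x).2 hx, fun hx => (hc x).1 hx⟩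
  obtain ⟨w, hw⟩ := hw
  obtain ⟨s₁, hs₁⟩ := gg_line_invol h 1 0 F F' (hT _ (by simp))
  obtain ⟨s₂, hs₂⟩ := gg_line_invol h 0 (-1) F F' (hT _ (by simp))
  obtain ⟨s₃, hs₃⟩ := gg_line_invol h 1 (-1) F F' (hT _ (by simp))
  obtain ⟨s₄, hs₄⟩ := gg_line_invol h 8 (-1) F F' (hT _ (by simp))
  let P : (Fin d → ℤ) → Prop := fun x => ((x ∈ F ∧ x ∉ F') ∨ (x ∈ F' ∧ x ∉ F)) ∧
    ∀ i, i ≠ i₀ → i ≠ i₁ → x i = w i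
  let D := {x : Fin d → ℤ // P x}
  have hfin : Finite D := by
    apply Set.Finite.subset (F ∪ F').finite_toSet
    rintro x ⟨hx, -⟩
    simp only [Finset.coe_union, Set.mem_union, Finset.mem_coe]
    tauto
  have := Fintype.ofFinite D
  have : Nonempty D := ⟨⟨w, hw, fun _ _ _ => rfl⟩⟩
  have hsep : ∀ x : D, ∃ n : ℝ × ℝ, ∀ y : D, (decide (x.1 ∈ F) ≠ decide (y.1 ∈ F)) →
      0 < n.1 * ((x.1 i₀ : ℝ) - y.1 i₀) + n.2 * ((x.1 i₁ : ℝ) - y.1 i₁) := by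
    rintro ⟨x, hx, hxw⟩
    have main : ∀ g : (Fin d → ℝ) →ₗ[ℝ] ℝ, ∀ y : D, g (embed y.1) < g (embed x) →
        0 < g (Pi.single i₀ 1) * ((x i₀ : ℝ) - y.1 i₀) +
          g (Pi.single i₁ 1) * ((x i₁ : ℝ) - y.1 i₁) := by
      intro g y hy
      rw [← gg_plane h g (fun i h0 h1 => (hxw i h0 h1).trans (y.2.2 i h0 h1).symm)]
      linarith
    rcases hx with hx | hx
    · obtain ⟨g, hg⟩ := gg_sep hF' hx.2
      refine ⟨(g (Pi.single i₀ 1), g (Pi.single i₁ 1)), fun y hy => main g y (hg _ ?_)⟩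
      have hy' : y.1 ∉ F := by
        intro hc
        simp [hx.1, hc] at hy
      have := y.2.1
      tauto
    · obtain ⟨g, hg⟩ := gg_sep hF hx.2
      refine ⟨(g (Pi.single i₀ 1), g (Pi.single i₁ 1)), fun y hy => main g y (hg _ ?_)⟩
      by_contra hc
      simp [hx.2, hc] at hy
  choose n hn using hsep
  have lift : ∀ (a b : ℤ) (s : (Fin d → ℤ) → (Fin d → ℤ)),
      (∀ x, ((x ∈ F ∧ x ∉ F') ∨ (x ∈ F' ∧ x ∉ F)) →
      ((s x ∈ F ∧ s x ∉ F') ∨ (s x ∈ F' ∧ s x ∉ F)) ∧ s (s x) = x ∧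
      (s x ∈ F ↔ x ∉ F) ∧
      ((a : ℝ) * (s x i₁ : ℝ) - b * (s x i₀ : ℝ) = a * (x i₁ : ℝ) - b * (x i₀ : ℝ)) ∧
      ∀ i, i ≠ i₀ → i ≠ i₁ → s x i = x i) →
      ∃ σ : D → D, (∀ p, σ (σ p) = p) ∧ (∀ p, decide ((σ p).1 ∈ F) ≠ decide (p.1 ∈ F)) ∧
        ∀ p, (a : ℝ) * ((σ p).1 i₁ : ℝ) - b * ((σ p).1 i₀ : ℝ) =
          a * (p.1 i₁ : ℝ) - b * (p.1 i₀ : ℝ) := by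
    intro a b s hs
    refine ⟨fun p => ⟨s p.1, (hs p.1 p.2.1).1, fun i h0 h1 =>
      ((hs p.1 p.2.1).2.2.2.2 i h0 h1).trans (p.2.2 i h0 h1)⟩, ?_, ?_, ?_⟩
    · intro p
      exact Subtype.ext (hs p.1 p.2.1).2.1
    · intro p hc
      have h1 := (hs p.1 p.2.1).2.2.1
      have h2 : s p.1 ∈ F ↔ p.1 ∈ F := by simpa using hc
      tauto
    · intro p
      exact (hs p.1 p.2.1).2.2.2.1
  obtain ⟨σ₁, u₁, v₁, w₁⟩ := lift _ _ s₁ hs₁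
  obtain ⟨σ₂, u₂, v₂, w₂⟩ := lift _ _ s₂ hs₂
  obtain ⟨σ₃, u₃, v₃, w₃⟩ := lift _ _ s₃ hs₃
  obtain ⟨σ₄, u₄, v₄, w₄⟩ := lift _ _ s₄ hs₄
  push_cast at w₁ w₂ w₃ w₄
  exact gg_core (D := D) (fun p => decide (p.1 ∈ F)) (fun p => (p.1 i₀ : ℝ))
    (fun p => (p.1 i₁ : ℝ)) (fun p => (n p).1) (fun p => (n p).2) hn σ₁ σ₂ σ₃ σ₄ u₁ u₂ u₃ u₄
    v₁ v₂ v₃ v₄ (fun p => by linarith [w₁ p]) (fun p => by linarith [w₂ p])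
    (fun p => by linarith [w₃ p]) (fun p => by linarith [w₄ p])
end
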